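/- For every ε ∈ (0, 1/100) there exists a constant K = K(ε) > 0 such that the following holds. Let X ≥ 1 and X^ε ≤ H ≤ X^{2/3 − ε}, and let z satisfy H^{1+ε} ≤ z ≤ min{ X/H^{1/2+ε}, H^{1/2−ε} X^{1/2} }. Then | (1/X) ∫_X^{2X} | ∑_{(n,d): x < n d² ≤ x+H, d² ≤ z} μ(d) − H ∑_{d: d² ≤ z} μ(d)/d² |² dx − C·√H | ≤ K · H^{1/2 − ε/10}. -/

import Mathlib

open MeasureTheory

/-- The constant `C = ζ(3/2)/π · ∏_p (1 - 3/p² + 2/p³)`. -/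
noncomputable def sqfConst : ℝ :=
  ((riemannZeta (3 / 2)).re / Real.pi) *
    ∏' p : Nat.Primes, (1 - 3 / ((p : ℕ) : ℝ) ^ 2 + 2 / ((p : ℕ) : ℝ) ^ 3)

/-- `∑_{(n,d) : x < n·d² ≤ x+H, d² ≤ z} μ(d)`, where `n, d` range over positive integers. -/
noncomputable def pairShortLE (x H z : ℝ) : ℝ :=
  ∑ d ∈ Finset.Icc 1 ⌊Real.sqrt z⌋₊,
    ∑ _n ∈ Finset.Ioc ⌊x / (d : ℝ) ^ 2⌋₊ ⌊(x + H) / (d : ℝ) ^ 2⌋₊,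
      (ArithmeticFunction.moebius d : ℝ)

/-- `∑_{d : d² ≤ z} μ(d)/d²`. -/
noncomputable def mertensTrunc (z : ℝ) : ℝ :=
  ∑ d ∈ Finset.Icc 1 ⌊Real.sqrt z⌋₊, (ArithmeticFunction.moebius d : ℝ) / (d : ℝ) ^ 2

/-- The `1`-periodic function `{h}(1 - {h})`. -/
noncomputable def sawSq (h : ℝ) : ℝ := Int.fract h * (1 - Int.fract h)

lemma sawSq_nonneg (h : ℝ) : 0 ≤ sawSq h :=
  mul_nonneg (Int.fract_nonneg h) (by linarith [Int.fract_lt_one h])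

lemma sawSq_le_one (h : ℝ) : sawSq h ≤ 1 := by
  have h0 := Int.fract_nonneg h
  have h1 := Int.fract_lt_one h
  unfold sawSq
  nlinarith

lemma sawSq_le_self {h : ℝ} (hh : 0 ≤ h) : sawSq h ≤ h := by
  have h0 := Int.fract_nonneg h
  have h1 := Int.fract_lt_one h
  have h2 : Int.fract h ≤ h := by
    have : (0 : ℝ) ≤ ⌊h⌋ := by exact_mod_cast Int.floor_nonneg.mpr hh
    linarith [Int.floor_add_fract h]
  unfold sawSq
  nlinarith

lemma abs_sawSq_sub_le (u v : ℝ) : |sawSq u - sawSq v| ≤ |u - v| := by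
  wlog huv : u ≤ v generalizing u v
  · rw [abs_sub_comm, abs_sub_comm u]
    exact this v u (le_of_not_ge huv)
  have hu0 := Int.fract_nonneg u
  have hu1 := Int.fract_lt_one u
  have hv0 := Int.fract_nonneg v
  have hv1 := Int.fract_lt_one v
  have hu := Int.floor_add_fract u
  have hv := Int.floor_add_fract v
  rw [abs_of_nonpos (sub_nonpos.mpr huv)]
  unfold sawSq
  rcases (Int.floor_mono huv).eq_or_lt with h | h
  · have : (⌊u⌋ : ℝ) = ⌊v⌋ := by exact_mod_cast h
    rw [abs_le]
    constructor <;> nlinarith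
  · have : (⌊u⌋ : ℝ) + 1 ≤ ⌊v⌋ := by exact_mod_cast h
    rw [abs_le]
    constructor <;> nlinarith

lemma hasSum_sawSq (h : ℝ) :
    HasSum (fun n : ℕ => (1 / Real.pi ^ 2) * ((1 - Real.cos (2 * Real.pi * n * h)) / (n : ℝ) ^ 2))
      (sawSq h) := by
  have hx : Int.fract h ∈ Set.Icc (0 : ℝ) 1 := ⟨Int.fract_nonneg h, (Int.fract_lt_one h).le⟩
  have h1 := hasSum_one_div_nat_pow_mul_cos (k := 1) one_ne_zero hx
  have hb : Polynomial.eval (Int.fract h) (Polynomial.map (algebraMap ℚ ℝ) (Polynomial.bernoulli 2))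
      = Int.fract h ^ 2 - Int.fract h + 6⁻¹ := by
    have := bernoulliFun_two (Int.fract h)
    rwa [bernoulliFun] at this
  have h2 := (hasSum_zeta_two.sub h1).mul_left (1 / Real.pi ^ 2)
  have e1 : (fun n : ℕ => (1 / Real.pi ^ 2) * ((1 - Real.cos (2 * Real.pi * n * h)) / (n : ℝ) ^ 2))
      = fun n : ℕ => 1 / Real.pi ^ 2 * (1 / (n : ℝ) ^ 2
        - 1 / (n : ℝ) ^ (2 * 1) * Real.cos (2 * Real.pi * n * Int.fract h)) := by
    funext n
    have : Real.cos (2 * Real.pi * n * Int.fract h) = Real.cos (2 * Real.pi * n * h) := by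
      have e : 2 * Real.pi * n * Int.fract h
          = 2 * Real.pi * n * h - ((n * ⌊h⌋ : ℤ) : ℝ) * (2 * Real.pi) := by
        have := Int.floor_add_fract h
        push_cast
        rw [← eq_sub_iff_add_eq'] at this
        rw [this]; ring
      rw [e, Real.cos_sub_int_mul_two_pi]
    rw [this]
    simp only [mul_one]
    ring
  have e2 : sawSq h = 1 / Real.pi ^ 2 * (Real.pi ^ 2 / 6 -
      (-1) ^ (1 + 1) * (2 * Real.pi) ^ (2 * 1) / 2 / ((2 * 1).factorial : ℝ) *
      Polynomial.eval (Int.fract h)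
        (Polynomial.map (algebraMap ℚ ℝ) (Polynomial.bernoulli (2 * 1)))) := by
    simp only [mul_one]
    rw [hb]
    unfold sawSq
    have := Real.pi_ne_zero
    norm_num [Nat.factorial]
    field_simp
    ring
  rw [e1, e2]
  exact h2

lemma integral_one_div_one_add_pow_four :
    ∫ r in Set.Ioi (0 : ℝ), 1 / (1 + r ^ 4) = Real.pi / (2 * √2) := by
  have s2 : √2 ^ 2 = (2 : ℝ) := Real.sq_sqrt (by norm_num)
  have s0 : 0 < √2 := by positivity
  have hp : ∀ r : ℝ, 0 < r ^ 2 + √2 * r + 1 := fun r => by nlinarith [sq_nonneg (√2 * r + 1)]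
  have hm : ∀ r : ℝ, 0 < r ^ 2 - √2 * r + 1 := fun r => by nlinarith [sq_nonneg (√2 * r - 1)]
  let g : ℝ → ℝ := fun r => (1 / (4 * √2)) * Real.log ((r ^ 2 + √2 * r + 1) / (r ^ 2 - √2 * r + 1))
    + (1 / (2 * √2)) * (Real.arctan (√2 * r + 1) + Real.arctan (√2 * r - 1))
  have hg : ∀ r : ℝ, HasDerivAt g (1 / (1 + r ^ 4)) r := by
    intro r
    have e1 : HasDerivAt (fun r : ℝ => r ^ 2 + √2 * r + 1) (2 * r + √2) r := by
      simpa using (((hasDerivAt_id r).pow 2).add ((hasDerivAt_id r).const_mul √2)).add_const 1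
    have e2 : HasDerivAt (fun r : ℝ => r ^ 2 - √2 * r + 1) (2 * r - √2) r := by
      simpa using (((hasDerivAt_id r).pow 2).sub ((hasDerivAt_id r).const_mul √2)).add_const 1
    have e3 : HasDerivAt (fun r : ℝ => √2 * r + 1) √2 r := by
      simpa using ((hasDerivAt_id r).const_mul √2).add_const 1
    have e4 : HasDerivAt (fun r : ℝ => √2 * r - 1) √2 r := by
      simpa using ((hasDerivAt_id r).const_mul √2).sub_const 1
    have := (((e1.div e2 (hm r).ne').log (div_pos (hp r) (hm r)).ne').const_mul (1 / (4 * √2))).add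
      ((e3.arctan.add e4.arctan).const_mul (1 / (2 * √2)))
    refine this.congr_deriv ?_
    have h1 := (hp r).ne'
    have h2 := (hm r).ne'
    have a1 : 1 + (√2 * r + 1) ^ 2 = 2 * (r ^ 2 + √2 * r + 1) := by linear_combination r ^ 2 * s2
    have a2 : 1 + (√2 * r - 1) ^ 2 = 2 * (r ^ 2 - √2 * r + 1) := by linear_combination r ^ 2 * s2
    have a3 : 1 + r ^ 4 = (r ^ 2 + √2 * r + 1) * (r ^ 2 - √2 * r + 1) := by
      linear_combination r ^ 2 * s2
    rw [a1, a2, a3]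
    simp only [Pi.div_apply]
    generalize hP : r ^ 2 + √2 * r + 1 = P at *
    generalize hQ : r ^ 2 - √2 * r + 1 = Q at *
    field_simp
    rw [← hP, ← hQ]
    linear_combination (0 : ℝ) * s2
  have hlim : Filter.Tendsto g Filter.atTop (nhds ((1 / (4 * √2)) * Real.log 1
      + (1 / (2 * √2)) * (Real.pi / 2 + Real.pi / 2))) := by
    refine Filter.Tendsto.add (Filter.Tendsto.const_mul _ ?_) (Filter.Tendsto.const_mul _ ?_)
    · refine Filter.Tendsto.log ?_ one_ne_zero
      have hi : Filter.Tendsto (fun r : ℝ => r⁻¹) Filter.atTop (nhds 0) := tendsto_inv_atTop_zero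
      have : Filter.Tendsto (fun r : ℝ => (1 + √2 * r⁻¹ + r⁻¹ ^ 2) / (1 - √2 * r⁻¹ + r⁻¹ ^ 2))
          Filter.atTop (nhds ((1 + √2 * 0 + 0 ^ 2) / (1 - √2 * 0 + 0 ^ 2))) := by
        refine Filter.Tendsto.div ?_ ?_ (by norm_num)
        · exact (tendsto_const_nhds.add (hi.const_mul _)).add (hi.pow 2)
        · exact (tendsto_const_nhds.sub (hi.const_mul _)).add (hi.pow 2)
      norm_num at this
      refine this.congr' ?_
      filter_upwards [Filter.eventually_gt_atTop 0] with r hr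
      have h1 := (hp r).ne'
      have h2 := (hm r).ne'
      have h3 : 1 - √2 * r⁻¹ + (r ^ 2)⁻¹ ≠ 0 := by
        have : 1 - √2 * r⁻¹ + (r ^ 2)⁻¹ = (r ^ 2 - √2 * r + 1) / r ^ 2 := by field_simp
        rw [this]; positivity
      rw [div_eq_div_iff h3 h2]
      field_simp
    · refine Filter.Tendsto.add ?_ ?_
      · refine (Real.tendsto_arctan_atTop.mono_right nhdsWithin_le_nhds).comp ?_
        exact Filter.tendsto_atTop_add_const_right _ _ (Filter.tendsto_id.const_mul_atTop s0)
      · refine (Real.tendsto_arctan_atTop.mono_right nhdsWithin_le_nhds).comp ?_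
        exact Filter.tendsto_atTop_add_const_right _ (-1) (Filter.tendsto_id.const_mul_atTop s0)
  rw [integral_Ioi_of_hasDerivAt_of_nonneg' (fun x _ => hg x) (fun x _ => by positivity) hlim]
  simp only [g]
  simp [Real.arctan_neg]
  field_simp

lemma integrableOn_of_integral_ne_zero {f : ℝ → ℝ} {s : Set ℝ} (h : ∫ x in s, f x ≠ 0) :
    IntegrableOn f s := not_imp_comm.1 integral_undef h

lemma integral_one_sub_cos_mul_exp {s : ℝ} (hs : 0 < s) :
    ∫ v in Set.Ioi (0 : ℝ), (1 - Real.cos v) * Real.exp (-(v * s)) = 1 / (s * (s ^ 2 + 1)) := by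
  let g : ℝ → ℝ := fun v => Real.exp (-(v * s)) *
    (-(1 / s) - (Real.sin v - s * Real.cos v) / (s ^ 2 + 1))
  have hg : ∀ v : ℝ, HasDerivAt g ((1 - Real.cos v) * Real.exp (-(v * s))) v := by
    intro v
    have e1 : HasDerivAt (fun v : ℝ => Real.exp (-(v * s))) (Real.exp (-(v * s)) * -s) v := by
      have : HasDerivAt (fun v : ℝ => -(v * s)) (-s) v := by
        have := ((hasDerivAt_id v).mul_const s).neg
        rw [one_mul] at this
        exact this
      exact this.exp
    have e2 : HasDerivAt (fun v : ℝ => -(1 / s) - (Real.sin v - s * Real.cos v) / (s ^ 2 + 1))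
        (-((Real.cos v - s * -Real.sin v) / (s ^ 2 + 1))) v :=
      (((Real.hasDerivAt_sin v).sub ((Real.hasDerivAt_cos v).const_mul s)).div_const _).const_sub _
    refine (e1.mul e2).congr_deriv ?_
    have : s ^ 2 + 1 ≠ 0 := by positivity
    field_simp
    ring
  have hlim : Filter.Tendsto g Filter.atTop (nhds 0) := by
    have hexp : Filter.Tendsto (fun v : ℝ => Real.exp (-(v * s))) Filter.atTop (nhds 0) :=
      Real.tendsto_exp_neg_atTop_nhds_zero.comp (Filter.tendsto_id.atTop_mul_const hs)
    refine hexp.zero_mul_isBoundedUnder_le ?_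
    refine Filter.isBoundedUnder_of ⟨1 / s + (1 + s) / (s ^ 2 + 1), fun v => ?_⟩
    have h1 : |Real.sin v - s * Real.cos v| ≤ 1 + s := by
      refine (abs_sub _ _).trans ?_
      rw [abs_mul, abs_of_pos hs]
      nlinarith [Real.abs_sin_le_one v, Real.abs_cos_le_one v]
    have h2 : |(Real.sin v - s * Real.cos v) / (s ^ 2 + 1)| ≤ (1 + s) / (s ^ 2 + 1) := by
      rw [abs_div, abs_of_pos (show 0 < s ^ 2 + 1 by positivity)]
      gcongr
    have h3 : |-(1 / s)| = 1 / s := by rw [abs_neg, abs_of_pos (by positivity)]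
    simp only [Function.comp, Real.norm_eq_abs]
    refine (abs_sub _ _).trans ?_
    rw [h3]
    linarith
  rw [integral_Ioi_of_hasDerivAt_of_nonneg' (fun x _ => hg x)
    (fun x _ => mul_nonneg (by linarith [Real.cos_le_one x]) (Real.exp_pos _).le) hlim]
  simp only [g]
  have : s ^ 2 + 1 ≠ 0 := by positivity
  simp
  field_simp
  ring

lemma integral_rpow_div_one_add_sq :
    ∫ s in Set.Ioi (0 : ℝ), s ^ (1 / 2 : ℝ) * (1 / (s * (s ^ 2 + 1))) = Real.pi / √2 := by
  have h := integral_comp_rpow_Ioi (fun r : ℝ => 1 / (1 + r ^ 4)) (p := 1 / 2) (by norm_num)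
  rw [integral_one_div_one_add_pow_four] at h
  have : ∀ s ∈ Set.Ioi (0 : ℝ), s ^ (1 / 2 : ℝ) * (1 / (s * (s ^ 2 + 1)))
      = 2 * ((|(1 / 2 : ℝ)| * s ^ ((1 / 2 : ℝ) - 1)) • (1 / (1 + (s ^ (1 / 2 : ℝ)) ^ 4))) := by
    intro s hs
    have hs : (0 : ℝ) < s := hs
    have e1 : (s ^ (1 / 2 : ℝ)) ^ 4 = s ^ 2 := by
      rw [← Real.rpow_natCast, ← Real.rpow_mul hs.le, ← Real.rpow_natCast s 2]
      norm_num
    rw [e1, Real.rpow_sub_one hs.ne', abs_of_pos (by norm_num), smul_eq_mul]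
    field_simp
    ring
  rw [setIntegral_congr_fun measurableSet_Ioi this, integral_const_mul, h]
  have : √2 ≠ 0 := by positivity
  field_simp

lemma integral_one_sub_cos_mul_rpow :
    ∫ v in Set.Ioi (0 : ℝ), (1 - Real.cos v) * (1 / v) ^ (3 / 2 : ℝ) = √(2 * Real.pi) := by
  have hG : Real.Gamma (3 / 2) = √Real.pi / 2 := by
    have := Real.Gamma_add_one (s := 1 / 2) (by norm_num)
    rw [Real.Gamma_one_half_eq] at this
    norm_num at this
    linarith
  have hpi := Real.pi_pos
  let F : ℝ → ℝ → ENNReal := fun v s =>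
    ENNReal.ofReal ((1 - Real.cos v) * (s ^ (1 / 2 : ℝ) * Real.exp (-(v * s))))
  have hF : Measurable (Function.uncurry F) := by
    refine ENNReal.measurable_ofReal.comp ?_
    have m1 : Measurable (fun p : ℝ × ℝ => p.1) := measurable_fst
    have m2 : Measurable (fun p : ℝ × ℝ => p.2) := measurable_snd
    exact (measurable_const.sub (Real.measurable_cos.comp m1)).mul
      ((m2.pow_const _).mul (Real.measurable_exp.comp (m1.mul m2).neg))
  have hswap := lintegral_lintegral_swap (μ := volume.restrict (Set.Ioi (0 : ℝ)))
    (ν := volume.restrict (Set.Ioi (0 : ℝ))) hF.aemeasurable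
  have hcos : ∀ v, 0 ≤ 1 - Real.cos v := fun v => by linarith [Real.cos_le_one v]
  have hL : ∀ v ∈ Set.Ioi (0 : ℝ), ∫⁻ s in Set.Ioi (0 : ℝ), F v s
      = ENNReal.ofReal (√Real.pi / 2 * ((1 - Real.cos v) * (1 / v) ^ (3 / 2 : ℝ))) := by
    intro v hv
    have hv : (0 : ℝ) < v := hv
    have h1 := Real.integral_rpow_mul_exp_neg_mul_Ioi (a := 3 / 2) (by norm_num) hv
    norm_num at h1
    rw [hG] at h1
    have h2 : IntegrableOn (fun s : ℝ => s ^ (1 / 2 : ℝ) * Real.exp (-(v * s))) (Set.Ioi 0) := by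
      refine integrableOn_of_integral_ne_zero ?_
      rw [h1]; positivity
    simp only [F]
    rw [← ofReal_integral_eq_lintegral_ofReal (h2.const_mul _), integral_const_mul, h1]
    · congr 1; rw [one_div]; ring
    · refine (ae_restrict_iff' measurableSet_Ioi).mpr (Filter.Eventually.of_forall fun s hs => ?_)
      have hs : (0 : ℝ) < s := hs
      exact mul_nonneg (hcos v) (by positivity)
  have hR : ∀ s ∈ Set.Ioi (0 : ℝ), ∫⁻ v in Set.Ioi (0 : ℝ), F v s
      = ENNReal.ofReal (s ^ (1 / 2 : ℝ) * (1 / (s * (s ^ 2 + 1)))) := by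
    intro s hs
    have hs : (0 : ℝ) < s := hs
    have h1 := integral_one_sub_cos_mul_exp hs
    have h2 : IntegrableOn (fun v : ℝ => (1 - Real.cos v) * Real.exp (-(v * s))) (Set.Ioi 0) := by
      refine integrableOn_of_integral_ne_zero ?_
      rw [h1]; positivity
    have h3 : ∀ v, F v s
        = ENNReal.ofReal (s ^ (1 / 2 : ℝ) * ((1 - Real.cos v) * Real.exp (-(v * s)))) := by
      intro v; simp only [F]; congr 1; ring
    simp only [h3]
    rw [← ofReal_integral_eq_lintegral_ofReal (h2.const_mul _), integral_const_mul, h1]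
    exact Filter.Eventually.of_forall fun v => mul_nonneg (Real.rpow_nonneg hs.le _)
      (mul_nonneg (hcos v) (Real.exp_pos _).le)
  rw [setLIntegral_congr_fun measurableSet_Ioi hL, setLIntegral_congr_fun measurableSet_Ioi hR] at hswap
  have hI := integral_rpow_div_one_add_sq
  have hI' := integrableOn_of_integral_ne_zero (hI.trans_ne (by positivity))
  rw [← ofReal_integral_eq_lintegral_ofReal hI', hI] at hswap
  · have h4 : ∫ v in Set.Ioi (0 : ℝ), √Real.pi / 2 * ((1 - Real.cos v) * (1 / v) ^ (3 / 2 : ℝ))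
        = Real.pi / √2 := by
      rw [integral_eq_lintegral_of_nonneg_ae, hswap, ENNReal.toReal_ofReal (by positivity)]
      · refine (ae_restrict_iff' measurableSet_Ioi).mpr (Filter.Eventually.of_forall fun v hv => ?_)
        have hv : (0 : ℝ) < v := hv
        exact mul_nonneg (by positivity) (mul_nonneg (hcos v) (by positivity))
      · exact (measurable_const.mul ((measurable_const.sub Real.measurable_cos).mul
          ((measurable_const.div measurable_id).pow_const _))).aestronglyMeasurable
    rw [integral_const_mul] at h4
    have e1 : √Real.pi ^ 2 = Real.pi := Real.sq_sqrt hpi.le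
    have e2 : √2 ^ 2 = (2 : ℝ) := Real.sq_sqrt (by norm_num)
    rw [Real.sqrt_mul (by norm_num)]
    have p1 : 0 < √Real.pi := by positivity
    have p2 : 0 < √(2 : ℝ) := by positivity
    generalize (∫ v in Set.Ioi (0 : ℝ), (1 - Real.cos v) * (1 / v) ^ (3 / 2 : ℝ)) = J at *
    rw [eq_div_iff p2.ne'] at h4
    have h5 : √Real.pi * (J * √2) = √Real.pi * (2 * √Real.pi) := by
      linear_combination 2 * h4 - 2 * e1
    have h6 := mul_left_cancel₀ p1.ne' h5
    have h7 : √2 * J = √2 * (√2 * √Real.pi) := by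
      rw [show √2 * (√2 * √Real.pi) = √2 ^ 2 * √Real.pi by ring, e2]; linarith
    exact mul_left_cancel₀ p2.ne' h7
  · refine (ae_restrict_iff' measurableSet_Ioi).mpr (Filter.Eventually.of_forall fun s hs => ?_)
    have hs : (0 : ℝ) < s := hs
    show (0 : ℝ) ≤ _
    positivity

lemma integral_one_sub_cos_div_sq {n : ℝ} (hn : 0 < n) :
    ∫ t in Set.Ioi (0 : ℝ), (1 - Real.cos (2 * Real.pi * n * (1 / t ^ 2))) = Real.pi * √n := by
  have hpi := Real.pi_pos
  set c : ℝ := √(2 * Real.pi * n) with hc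
  have hc0 : 0 < c := by positivity
  have hc2 : c ^ 2 = 2 * Real.pi * n := Real.sq_sqrt (by positivity)
  have h1 := integral_comp_rpow_Ioi (fun v : ℝ => (1 - Real.cos v) * (1 / v) ^ (3 / 2 : ℝ))
    (p := -2) (by norm_num)
  rw [integral_one_sub_cos_mul_rpow] at h1
  have h2 : ∀ t ∈ Set.Ioi (0 : ℝ), (|(-2 : ℝ)| * t ^ ((-2 : ℝ) - 1)) •
      ((1 - Real.cos (t ^ (-2 : ℝ))) * (1 / t ^ (-2 : ℝ)) ^ (3 / 2 : ℝ))
      = 2 * (1 - Real.cos (1 / t ^ 2)) := by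
    intro t ht
    have ht : (0 : ℝ) < t := ht
    have e1 : t ^ (-2 : ℝ) = 1 / t ^ 2 := by
      rw [Real.rpow_neg ht.le, one_div]; norm_num
    have e2 : (1 / (1 / t ^ 2)) ^ (3 / 2 : ℝ) = t ^ 3 := by
      rw [one_div_one_div, ← Real.rpow_natCast t 2, ← Real.rpow_mul ht.le, ← Real.rpow_natCast t 3]
      norm_num
    have e3 : t ^ ((-2 : ℝ) - 1) = 1 / t ^ 3 := by
      rw [show ((-2 : ℝ) - 1) = -(3 : ℕ) by norm_num, Real.rpow_neg ht.le, Real.rpow_natCast, one_div]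
    rw [e1, e2, e3, smul_eq_mul]
    norm_num
    field_simp
  rw [setIntegral_congr_fun measurableSet_Ioi h2, integral_const_mul] at h1
  have h3 := integral_comp_mul_left_Ioi (fun t : ℝ => 1 - Real.cos (1 / t ^ 2)) 0
    (b := 1 / c) (by positivity)
  rw [mul_zero, smul_eq_mul] at h3
  have h4 : ∀ t ∈ Set.Ioi (0 : ℝ), 1 - Real.cos (2 * Real.pi * n * (1 / t ^ 2))
      = 1 - Real.cos (1 / (1 / c * t) ^ 2) := by
    intro t ht
    have ht : (0 : ℝ) < t := ht
    rw [← hc2]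
    congr 2
    field_simp
  rw [setIntegral_congr_fun measurableSet_Ioi h4, h3]
  have h5 : ∫ t in Set.Ioi (0 : ℝ), (1 - Real.cos (1 / t ^ 2)) = √(2 * Real.pi) / 2 := by linarith
  rw [h5, one_div, inv_inv, hc, Real.sqrt_mul (by positivity)]
  have := Real.sq_sqrt (show 0 ≤ 2 * Real.pi by positivity)
  linear_combination √n / 2 * this

lemma zeta_three_halves :
    HasSum (fun n : ℕ => (1 : ℝ) / (n : ℝ) ^ (3 / 2 : ℝ)) (riemannZeta (3 / 2)).re := by
  have h : Summable (fun n : ℕ => (1 : ℝ) / (n : ℝ) ^ (3 / 2 : ℝ)) :=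
    Real.summable_one_div_nat_rpow.mpr (by norm_num)
  have h1 : riemannZeta (3 / 2) = ((∑' n : ℕ, (1 : ℝ) / (n : ℝ) ^ (3 / 2 : ℝ) : ℝ) : ℂ) := by
    rw [zeta_eq_tsum_one_div_nat_cpow (by norm_num), Complex.ofReal_tsum]
    refine tsum_congr fun n => ?_
    push_cast
    rw [Complex.ofReal_cpow (Nat.cast_nonneg n)]
    norm_num
  rw [h1, Complex.ofReal_re]
  exact h.hasSum

lemma integral_sawSq_one_div_sq :
    ∫ t in Set.Ioi (0 : ℝ), sawSq (1 / t ^ 2) = (riemannZeta (3 / 2)).re / Real.pi := by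
  have hpi := Real.pi_pos
  let F : ℕ → ℝ → ℝ := fun n t => (1 / Real.pi ^ 2) *
    ((1 - Real.cos (2 * Real.pi * n * (1 / t ^ 2))) / (n : ℝ) ^ 2)
  have hF0 : ∀ n t, 0 ≤ F n t := fun n t => by
    have : 0 ≤ 1 - Real.cos (2 * Real.pi * n * (1 / t ^ 2)) := by
      linarith [Real.cos_le_one (2 * Real.pi * n * (1 / t ^ 2))]
    simp only [F]; positivity
  have hFi : ∀ n : ℕ, ∫ t in Set.Ioi (0 : ℝ), F n t = (1 / Real.pi) * (1 / (n : ℝ) ^ (3 / 2 : ℝ)) := by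
    intro n
    rcases Nat.eq_zero_or_pos n with rfl | hn
    · simp [F]
    · have hn : (0 : ℝ) < n := by exact_mod_cast hn
      simp only [F]
      rw [integral_const_mul, integral_div, integral_one_sub_cos_div_sq hn]
      have : (n : ℝ) ^ (3 / 2 : ℝ) = n * √n := by
        rw [show (3 / 2 : ℝ) = 1 + 1 / 2 by norm_num, Real.rpow_add hn, Real.rpow_one,
          Real.sqrt_eq_rpow]
      rw [this]
      have h2 : √(n : ℝ) ^ 2 = n := Real.sq_sqrt hn.le
      have h3 : 0 < √(n : ℝ) := by positivity
      field_simp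
      exact h2
  have hint : ∀ n : ℕ, IntegrableOn (F n) (Set.Ioi 0) := by
    intro n
    rcases Nat.eq_zero_or_pos n with rfl | hn
    · have : F 0 = fun _ => 0 := by funext t; simp [F]
      rw [this]; exact integrableOn_zero
    · refine integrableOn_of_integral_ne_zero ?_
      rw [hFi]; positivity
  have hs := (zeta_three_halves.mul_left (1 / Real.pi))
  have h1 := hasSum_integral_of_summable_integral_norm hint (by
    refine hs.summable.congr fun n => ?_
    rw [← hFi n]
    refine integral_congr_ae (Filter.Eventually.of_forall fun t => ?_)
    exact (Real.norm_of_nonneg (hF0 n t)).symm)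
  simp only [hFi] at h1
  have h2 := h1.unique hs
  have h3 : ∀ t, ∑' n, F n t = sawSq (1 / t ^ 2) := fun t => (hasSum_sawSq (1 / t ^ 2)).tsum_eq
  simp only [h3] at h2
  rw [h2]; ring

/-- The mean value `∫₀^∞ {t⁻²}(1 - {t⁻²}) dt`. -/
noncomputable def sawInt : ℝ := ∫ t in Set.Ioi (0 : ℝ), sawSq (1 / t ^ 2)

lemma sawInt_eq : sawInt = (riemannZeta (3 / 2)).re / Real.pi := integral_sawSq_one_div_sq

lemma sawInt_pos : 0 < sawInt := by
  rw [sawInt_eq]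
  refine div_pos ?_ Real.pi_pos
  have := le_hasSum zeta_three_halves 1 (fun n _ => by positivity)
  norm_num at this
  linarith

lemma integral_sawSq_div_sq {y : ℝ} (hy : 0 < y) :
    ∫ t in Set.Ioi (0 : ℝ), sawSq (y ^ 2 / t ^ 2) = y * sawInt := by
  have h := integral_comp_mul_left_Ioi (fun t : ℝ => sawSq (1 / t ^ 2)) 0
    (b := 1 / y) (by positivity)
  rw [mul_zero, smul_eq_mul, one_div, inv_inv] at h
  rw [sawInt, ← h]
  refine setIntegral_congr_fun measurableSet_Ioi fun t _ => ?_
  congr 1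
  field_simp

lemma integrableOn_sawSq_div_sq {y : ℝ} (hy : 0 < y) :
    IntegrableOn (fun t : ℝ => sawSq (y ^ 2 / t ^ 2)) (Set.Ioi 0) := by
  refine integrableOn_of_integral_ne_zero ?_
  rw [integral_sawSq_div_sq hy]
  exact (mul_pos hy sawInt_pos).ne'

lemma abs_sum_sawSq_sub_integral_le {y : ℝ} (hy : 0 < y) {P Q : ℕ} (hP : 1 ≤ P) (hPQ : P ≤ Q) :
    |∑ m ∈ Finset.Ico P Q, sawSq (y ^ 2 / (m : ℝ) ^ 2)
      - ∫ t in (P : ℝ)..Q, sawSq (y ^ 2 / t ^ 2)| ≤ y ^ 2 / (P : ℝ) ^ 2 - y ^ 2 / (Q : ℝ) ^ 2 := by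
  have hii : ∀ a b : ℝ, 0 ≤ a → 0 ≤ b →
      IntervalIntegrable (fun t : ℝ => sawSq (y ^ 2 / t ^ 2)) volume a b := by
    intro a b ha hb
    rw [intervalIntegrable_iff]
    refine (integrableOn_sawSq_div_sq hy).mono_set ?_
    intro t ht
    exact (le_min ha hb).trans_lt ht.1
  induction Q, hPQ using Nat.le_induction with
  | base => simp
  | succ Q hPQ ih =>
    have hQ : (1 : ℝ) ≤ Q := by exact_mod_cast hP.trans hPQ
    rw [Finset.sum_Ico_succ_top hPQ, ← intervalIntegral.integral_add_adjacent_intervals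
      (hii P Q (by positivity) (by positivity)) (hii Q (Q + 1 : ℕ) (by positivity) (by positivity))]
    have h1 : |sawSq (y ^ 2 / (Q : ℝ) ^ 2) - ∫ t in (Q : ℝ)..(Q + 1 : ℕ), sawSq (y ^ 2 / t ^ 2)|
        ≤ y ^ 2 / (Q : ℝ) ^ 2 - y ^ 2 / ((Q + 1 : ℕ) : ℝ) ^ 2 := by
      have e : sawSq (y ^ 2 / (Q : ℝ) ^ 2) = ∫ _t in (Q : ℝ)..(Q + 1 : ℕ), sawSq (y ^ 2 / (Q : ℝ) ^ 2) := by
        rw [intervalIntegral.integral_const]; simp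
      rw [e, ← intervalIntegral.integral_sub (by simp) (hii _ _ (by positivity) (by positivity))]
      have := intervalIntegral.norm_integral_le_of_norm_le_const (a := (Q : ℝ)) (b := (Q + 1 : ℕ))
        (C := y ^ 2 / (Q : ℝ) ^ 2 - y ^ 2 / ((Q + 1 : ℕ) : ℝ) ^ 2)
        (f := fun t => sawSq (y ^ 2 / (Q : ℝ) ^ 2) - sawSq (y ^ 2 / t ^ 2)) ?_
      · simpa using this
      · intro t ht
        rw [Set.uIoc_of_le (by push_cast; linarith)] at ht
        obtain ⟨ht1, ht2⟩ := ht
        have ht0 : 0 < t := by linarith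
        rw [Real.norm_eq_abs]
        refine (abs_sawSq_sub_le _ _).trans ?_
        have a1 : y ^ 2 / t ^ 2 ≤ y ^ 2 / (Q : ℝ) ^ 2 := by gcongr
        have a2 : y ^ 2 / ((Q + 1 : ℕ) : ℝ) ^ 2 ≤ y ^ 2 / t ^ 2 := by gcongr
        rw [abs_of_nonneg (by linarith)]
        linarith
    have e : ∀ a b c d : ℝ, a + b - (c + d) = (a - c) + (b - d) := fun a b c d => by ring
    rw [e]
    refine (abs_add_le _ _).trans ?_
    linarith

lemma abs_sum_sawSq_sub_le_aux {y B : ℝ} (hy : 0 < y) {P : ℕ} (hP : 1 ≤ P) (M : ℕ)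
    (hB : ∫ t in (0 : ℝ)..P, sawSq (y ^ 2 / t ^ 2) ≤ B) :
    |∑ m ∈ Finset.Icc 1 M, sawSq (y ^ 2 / (m : ℝ) ^ 2) - y * sawInt|
      ≤ (P - 1) + B + y ^ 2 / (P : ℝ) ^ 2 + 2 * (y ^ 2 / (M + 1)) := by
  have hint := integrableOn_sawSq_div_sq hy
  have hii : ∀ a b : ℝ, 0 ≤ a → 0 ≤ b →
      IntervalIntegrable (fun t : ℝ => sawSq (y ^ 2 / t ^ 2)) volume a b := by
    intro a b ha hb
    rw [intervalIntegrable_iff]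
    refine hint.mono_set ?_
    intro t ht
    exact (le_min ha hb).trans_lt ht.1
  set R : ℕ := min P (M + 1) with hR
  have hR1 : 1 ≤ R := le_min hP (by omega)
  have hRP : R ≤ P := min_le_left _ _
  have hRM : R ≤ M + 1 := min_le_right _ _
  have hsplit : ∑ m ∈ Finset.Icc 1 M, sawSq (y ^ 2 / (m : ℝ) ^ 2)
      = ∑ m ∈ Finset.Ico 1 R, sawSq (y ^ 2 / (m : ℝ) ^ 2)
        + ∑ m ∈ Finset.Ico R (M + 1), sawSq (y ^ 2 / (m : ℝ) ^ 2) := by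
    rw [Finset.sum_Ico_consecutive _ hR1 hRM]
    rfl
  have hQ0 : (0 : ℝ) < (M + 1 : ℕ) := by positivity
  have htail : ∫ t in Set.Ioi ((M + 1 : ℕ) : ℝ), sawSq (y ^ 2 / t ^ 2) ≤ y ^ 2 / (M + 1) := by
    have h1 : ∫ t in Set.Ioi ((M + 1 : ℕ) : ℝ), y ^ 2 * t ^ (-2 : ℝ) = y ^ 2 / (M + 1) := by
      rw [integral_const_mul, integral_Ioi_rpow_of_lt (by norm_num) hQ0]
      rw [show (-2 : ℝ) + 1 = -1 by norm_num, Real.rpow_neg_one]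
      push_cast
      field_simp
    rw [← h1]
    refine setIntegral_mono_on (hint.mono_set (Set.Ioi_subset_Ioi hQ0.le))
      ((integrableOn_Ioi_rpow_of_lt (by norm_num) hQ0).const_mul _) measurableSet_Ioi ?_
    intro t ht
    have ht0 : 0 < t := hQ0.trans ht
    refine (sawSq_le_self (by positivity)).trans (le_of_eq ?_)
    rw [Real.rpow_neg ht0.le, div_eq_mul_inv]; norm_num
  have htail0 : 0 ≤ ∫ t in Set.Ioi ((M + 1 : ℕ) : ℝ), sawSq (y ^ 2 / t ^ 2) :=
    setIntegral_nonneg measurableSet_Ioi fun t _ => sawSq_nonneg _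
  have hI : y * sawInt = (∫ t in (0 : ℝ)..R, sawSq (y ^ 2 / t ^ 2))
      + (∫ t in (R : ℝ)..(M + 1 : ℕ), sawSq (y ^ 2 / t ^ 2))
      + ∫ t in Set.Ioi ((M + 1 : ℕ) : ℝ), sawSq (y ^ 2 / t ^ 2) := by
    rw [intervalIntegral.integral_add_adjacent_intervals (hii _ _ le_rfl (by positivity))
      (hii _ _ (by positivity) hQ0.le), ← integral_sawSq_div_sq hy,
      intervalIntegral.integral_interval_add_Ioi hint
        (hint.mono_set (Set.Ioi_subset_Ioi hQ0.le))]
  have h0R0 : 0 ≤ ∫ t in (0 : ℝ)..R, sawSq (y ^ 2 / t ^ 2) :=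
    intervalIntegral.integral_nonneg (by positivity) fun t _ => sawSq_nonneg _
  have h0R : ∫ t in (0 : ℝ)..R, sawSq (y ^ 2 / t ^ 2) ≤ B := by
    refine le_trans ?_ hB
    refine intervalIntegral.integral_mono_interval le_rfl (by positivity) (by exact_mod_cast hRP)
      (Filter.Eventually.of_forall fun t => sawSq_nonneg _) (hii _ _ le_rfl (by positivity))
  have hmid := abs_sum_sawSq_sub_integral_le hy hR1 hRM
  have hs0 : 0 ≤ ∑ m ∈ Finset.Ico 1 R, sawSq (y ^ 2 / (m : ℝ) ^ 2) :=
    Finset.sum_nonneg fun m _ => sawSq_nonneg _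
  have hs1 : ∑ m ∈ Finset.Ico 1 R, sawSq (y ^ 2 / (m : ℝ) ^ 2) ≤ P - 1 := by
    have : ∑ m ∈ Finset.Ico 1 R, sawSq (y ^ 2 / (m : ℝ) ^ 2) ≤ ∑ m ∈ Finset.Ico 1 R, (1 : ℝ) :=
      Finset.sum_le_sum fun m _ => sawSq_le_one _
    simp only [Finset.sum_const, Nat.card_Ico, nsmul_eq_mul, mul_one, Nat.cast_sub hR1] at this
    have h2 : (R : ℝ) ≤ P := by exact_mod_cast hRP
    push_cast at this
    linarith
  have hR2 : y ^ 2 / (R : ℝ) ^ 2 ≤ y ^ 2 / (P : ℝ) ^ 2 + y ^ 2 / (M + 1) := by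
    have q1 : 0 ≤ y ^ 2 / (P : ℝ) ^ 2 := by positivity
    have q2 : 0 ≤ y ^ 2 / ((M : ℝ) + 1) := by positivity
    rcases min_choice P (M + 1) with h | h
    · rw [hR, h]; linarith
    · rw [hR, h]
      have : y ^ 2 / (((M + 1 : ℕ) : ℝ)) ^ 2 ≤ y ^ 2 / ((M : ℝ) + 1) := by
        push_cast
        gcongr
        nlinarith [Nat.cast_nonneg (α := ℝ) M]
      linarith
  have q3 : 0 ≤ y ^ 2 / (((M + 1 : ℕ) : ℝ)) ^ 2 := by positivity
  have q2 : 0 ≤ y ^ 2 / ((M : ℝ) + 1) := by positivity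
  rw [hsplit, hI]
  rw [abs_le] at hmid ⊢
  constructor <;> linarith [hmid.1, hmid.2]

lemma abs_sum_sawSq_sub_le {y : ℝ} (hy : 0 < y) (M : ℕ) :
    |∑ m ∈ Finset.Icc 1 M, sawSq (y ^ 2 / (m : ℝ) ^ 2) - y * sawInt|
      ≤ (sawInt + 4) * y ^ (3 / 4 : ℝ) + 2 * (y ^ 2 / (M + 1)) := by
  have hI := sawInt_pos
  rcases le_total y 1 with h | h
  · have hB : ∫ t in (0 : ℝ)..(1 : ℕ), sawSq (y ^ 2 / t ^ 2) ≤ y * sawInt := by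
      rw [← integral_sawSq_div_sq hy, intervalIntegral.integral_of_le (by norm_num)]
      exact setIntegral_mono_set (integrableOn_sawSq_div_sq hy)
        (Filter.Eventually.of_forall fun t => sawSq_nonneg _)
        (LE.le.eventuallyLE fun t ht => ht.1)
    have := abs_sum_sawSq_sub_le_aux hy le_rfl M hB
    have h1 : y ≤ y ^ (3 / 4 : ℝ) := by
      conv_lhs => rw [← Real.rpow_one y]
      exact Real.rpow_le_rpow_of_exponent_ge hy h (by norm_num)
    norm_num at this
    nlinarith
  · set P := ⌈y ^ (3 / 4 : ℝ)⌉₊ with hP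
    have h34 : 1 ≤ y ^ (3 / 4 : ℝ) := Real.one_le_rpow h (by norm_num)
    have hP1 : y ^ (3 / 4 : ℝ) ≤ P := Nat.le_ceil _
    have hP2 : (P : ℝ) < y ^ (3 / 4 : ℝ) + 1 := Nat.ceil_lt_add_one (by positivity)
    have hP3 : 1 ≤ P := by
      have : (1 : ℝ) ≤ P := h34.trans hP1
      exact_mod_cast this
    have hB : ∫ t in (0 : ℝ)..P, sawSq (y ^ 2 / t ^ 2) ≤ P := by
      have := intervalIntegral.norm_integral_le_of_norm_le_const (a := (0 : ℝ)) (b := P)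
        (C := 1) (f := fun t => sawSq (y ^ 2 / t ^ 2)) (fun t _ => by
          rw [Real.norm_of_nonneg (sawSq_nonneg _)]; exact sawSq_le_one _)
      rw [sub_zero, one_mul, abs_of_nonneg (Nat.cast_nonneg P)] at this
      exact (Real.le_norm_self _).trans this
    have := abs_sum_sawSq_sub_le_aux hy hP3 M hB
    have h5 : y ^ 2 / (P : ℝ) ^ 2 ≤ y ^ (3 / 4 : ℝ) := by
      rw [div_le_iff₀ (by positivity)]
      have e : y ^ 2 ≤ y ^ (3 / 4 : ℝ) * (y ^ (3 / 4 : ℝ)) ^ 2 := by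
        rw [← Real.rpow_natCast, ← Real.rpow_natCast, ← Real.rpow_mul hy.le, ← Real.rpow_add hy]
        exact Real.rpow_le_rpow_of_exponent_le h (by norm_num)
      refine e.trans ?_
      gcongr
    nlinarith

/-- Partial sum of the Fourier series of `1/2 - {y}`. -/
noncomputable def sawPartial (N : ℕ) (y : ℝ) : ℝ :=
  ∑ n ∈ Finset.Icc 1 N, Real.sin (2 * Real.pi * n * y) / (Real.pi * n)

lemma sawPartial_add_one (N : ℕ) (y : ℝ) : sawPartial N (y + 1) = sawPartial N y := by
  refine Finset.sum_congr rfl fun n _ => ?_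
  rw [show 2 * Real.pi * n * (y + 1) = 2 * Real.pi * n * y + n * (2 * Real.pi) by ring,
    Real.sin_add_nat_mul_two_pi]

lemma continuous_sawPartial (N : ℕ) : Continuous (sawPartial N) := by
  unfold sawPartial
  fun_prop

lemma integral_cos_two_pi_int_mul {k : ℤ} (hk : k ≠ 0) :
    ∫ y in (0 : ℝ)..1, Real.cos (2 * Real.pi * k * y) = 0 := by
  have hk' : (k : ℝ) ≠ 0 := by exact_mod_cast hk
  have hc : 2 * Real.pi * (k : ℝ) ≠ 0 := by positivity
  rw [intervalIntegral.integral_comp_mul_left (fun y => Real.cos y) hc, integral_cos]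
  have : Real.sin (2 * Real.pi * k * 1) = 0 := by
    rw [show 2 * Real.pi * k * 1 = ((2 * k : ℤ) : ℝ) * Real.pi by push_cast; ring]
    exact Real.sin_int_mul_pi _
  rw [this]; simp

lemma integral_sin_mul_sin {m n : ℕ} (hn : n ≠ 0) :
    ∫ y in (0 : ℝ)..1, Real.sin (2 * Real.pi * m * y) * Real.sin (2 * Real.pi * n * y)
      = if m = n then 1 / 2 else 0 := by
  have e : ∀ y : ℝ, Real.sin (2 * Real.pi * m * y) * Real.sin (2 * Real.pi * n * y)
      = (1 / 2) * (Real.cos (2 * Real.pi * ((m : ℤ) - (n : ℤ) : ℤ) * y)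
        - Real.cos (2 * Real.pi * ((m : ℤ) + (n : ℤ) : ℤ) * y)) := by
    intro y
    push_cast
    rw [show 2 * Real.pi * ((m : ℝ) - n) * y = 2 * Real.pi * m * y - 2 * Real.pi * n * y by ring,
      show 2 * Real.pi * ((m : ℝ) + n) * y = 2 * Real.pi * m * y + 2 * Real.pi * n * y by ring,
      Real.cos_sub, Real.cos_add]
    ring
  simp_rw [e]
  rw [intervalIntegral.integral_const_mul, intervalIntegral.integral_sub
    (Continuous.intervalIntegrable (by fun_prop) _ _)
    (Continuous.intervalIntegrable (by fun_prop) _ _),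
    integral_cos_two_pi_int_mul (k := (m : ℤ) + n) (by omega)]
  split_ifs with h
  · subst h; simp
  · rw [integral_cos_two_pi_int_mul (by omega)]; simp

lemma integral_sub_half_mul_sin {n : ℕ} (hn : n ≠ 0) :
    ∫ y in (0 : ℝ)..1, (y - 1 / 2) * Real.sin (2 * Real.pi * n * y) = - (1 / (2 * Real.pi * n)) := by
  have hn' : (n : ℝ) ≠ 0 := by exact_mod_cast hn
  have hc : 2 * Real.pi * (n : ℝ) ≠ 0 := by positivity
  have hd : ∀ y ∈ Set.uIcc (0 : ℝ) 1, HasDerivAt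
      (fun y : ℝ => - ((y - 1 / 2) * Real.cos (2 * Real.pi * n * y)) / (2 * Real.pi * n)
        + Real.sin (2 * Real.pi * n * y) / (2 * Real.pi * n) ^ 2)
      ((y - 1 / 2) * Real.sin (2 * Real.pi * n * y)) y := by
    intro y _
    have h1 : HasDerivAt (fun y : ℝ => 2 * Real.pi * n * y) (2 * Real.pi * n) y := by
      simpa using (hasDerivAt_id y).const_mul (2 * Real.pi * (n : ℝ))
    have h2 : HasDerivAt (fun y : ℝ => y - 1 / 2) 1 y := by
      simpa using (hasDerivAt_id y).sub_const (1 / 2 : ℝ)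
    have := (((h2.mul h1.cos).neg).div_const (2 * Real.pi * n)).add
      (h1.sin.div_const ((2 * Real.pi * n) ^ 2))
    refine this.congr_deriv ?_
    field_simp
    ring
  rw [intervalIntegral.integral_eq_sub_of_hasDerivAt hd
    (Continuous.intervalIntegrable (by fun_prop) _ _)]
  have h1 : Real.cos (2 * Real.pi * n * 1) = 1 := by
    rw [show 2 * Real.pi * n * 1 = (n : ℝ) * (2 * Real.pi) by ring, Real.cos_nat_mul_two_pi]
  have h2 : Real.sin (2 * Real.pi * n * 1) = 0 := by
    rw [show 2 * Real.pi * n * 1 = ((2 * n : ℕ) : ℝ) * Real.pi by push_cast; ring]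
    exact Real.sin_nat_mul_pi _
  rw [h1, h2]
  simp
  field_simp
  ring

lemma integral_sub_half_add_sawPartial_sq (N : ℕ) :
    ∫ y in (0 : ℝ)..1, (y - 1 / 2 + sawPartial N y) ^ 2
      = 1 / 12 - (1 / (2 * Real.pi ^ 2)) * ∑ n ∈ Finset.Icc 1 N, ((n : ℝ) ^ 2)⁻¹ := by
  induction N with
  | zero =>
    simp [sawPartial]
    have : ∀ y : ℝ, (y - 2⁻¹) ^ 2 = y ^ 2 - y + 1 / 4 := fun y => by ring
    simp_rw [this]
    rw [intervalIntegral.integral_add (Continuous.intervalIntegrable (by fun_prop) _ _)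
      (Continuous.intervalIntegrable (by fun_prop) _ _),
      intervalIntegral.integral_sub (Continuous.intervalIntegrable (by fun_prop) _ _)
      (Continuous.intervalIntegrable (by fun_prop) _ _)]
    norm_num
  | succ N ih =>
    have hc := continuous_sawPartial N
    have hs : ∀ y, sawPartial (N + 1) y = sawPartial N y
        + Real.sin (2 * Real.pi * (N + 1 : ℕ) * y) / (Real.pi * (N + 1 : ℕ)) := fun y => by
      unfold sawPartial
      rw [Finset.sum_Icc_succ_top (by omega)]
    have e : ∀ y : ℝ, (y - 1 / 2 + sawPartial (N + 1) y) ^ 2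
        = (y - 1 / 2 + sawPartial N y) ^ 2
          + ((2 / (Real.pi * (N + 1 : ℕ)) * ((y - 1 / 2) * Real.sin (2 * Real.pi * (N + 1 : ℕ) * y))
          + 2 / (Real.pi * (N + 1 : ℕ)) * (sawPartial N y * Real.sin (2 * Real.pi * (N + 1 : ℕ) * y)))
          + (1 / (Real.pi * (N + 1 : ℕ))) ^ 2 * (Real.sin (2 * Real.pi * (N + 1 : ℕ) * y)
            * Real.sin (2 * Real.pi * (N + 1 : ℕ) * y))) := by
      intro y
      rw [hs]
      ring
    have h0 : ∫ y in (0 : ℝ)..1, sawPartial N y * Real.sin (2 * Real.pi * (N + 1 : ℕ) * y) = 0 := by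
      unfold sawPartial
      simp_rw [Finset.sum_mul]
      rw [intervalIntegral.integral_finsetSum
        (fun n _ => Continuous.intervalIntegrable (by fun_prop) _ _)]
      refine Finset.sum_eq_zero fun n hn => ?_
      rw [Finset.mem_Icc] at hn
      have : ∀ y : ℝ, Real.sin (2 * Real.pi * n * y) / (Real.pi * n)
          * Real.sin (2 * Real.pi * (N + 1 : ℕ) * y) = (1 / (Real.pi * n)) *
          (Real.sin (2 * Real.pi * n * y) * Real.sin (2 * Real.pi * (N + 1 : ℕ) * y)) :=
        fun y => by ring
      simp_rw [this]
      rw [intervalIntegral.integral_const_mul, integral_sin_mul_sin (by omega),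
        if_neg (by omega), mul_zero]
    simp_rw [e]
    rw [intervalIntegral.integral_add (Continuous.intervalIntegrable (by fun_prop) _ _)
      (Continuous.intervalIntegrable (by fun_prop) _ _), ih,
      intervalIntegral.integral_add (Continuous.intervalIntegrable (by fun_prop) _ _)
      (Continuous.intervalIntegrable (by fun_prop) _ _),
      intervalIntegral.integral_add (Continuous.intervalIntegrable (by fun_prop) _ _)
      (Continuous.intervalIntegrable (by fun_prop) _ _),
      intervalIntegral.integral_const_mul, intervalIntegral.integral_const_mul,
      intervalIntegral.integral_const_mul, h0, integral_sub_half_mul_sin (by omega),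
      integral_sin_mul_sin (by omega), if_pos rfl,
      Finset.sum_Icc_succ_top (by omega)]
    have : ((N + 1 : ℕ) : ℝ) ≠ 0 := by positivity
    field_simp
    ring

lemma integral_sub_half_add_sawPartial_sq_le {N : ℕ} (hN : N ≠ 0) :
    ∫ y in (0 : ℝ)..1, (y - 1 / 2 + sawPartial N y) ^ 2 ≤ 1 / (N : ℝ) := by
  rw [integral_sub_half_add_sawPartial_sq]
  have hN' : (0 : ℝ) < N := by positivity
  have hz : HasSum (fun n : ℕ => ((n : ℝ) ^ 2)⁻¹) (Real.pi ^ 2 / 6) := by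
    simpa using hasSum_zeta_two
  have hlim := hz.tendsto_sum_nat
  have hle : Real.pi ^ 2 / 6 ≤ (∑ n ∈ Finset.Icc 1 N, ((n : ℝ) ^ 2)⁻¹) + 1 / N := by
    refine le_of_tendsto hlim ?_
    filter_upwards [Filter.eventually_gt_atTop N] with M hM
    have h1 := sum_Ioc_inv_sq_le_sub (α := ℝ) hN (show N ≤ M - 1 by omega)
    have h2 : ∑ i ∈ Finset.range M, ((i : ℝ) ^ 2)⁻¹
        = ∑ n ∈ Finset.Icc 1 N, ((n : ℝ) ^ 2)⁻¹ + ∑ i ∈ Finset.Ioc N (M - 1), ((i : ℝ) ^ 2)⁻¹ := by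
      rw [show Finset.Icc 1 N = Finset.Ioc 0 N from rfl,
        Finset.sum_Ioc_consecutive _ (Nat.zero_le _) (by omega), Finset.range_eq_Ico,
        Finset.sum_eq_sum_Ico_succ_bot (by omega)]
      simp
      refine Finset.sum_congr ?_ fun _ _ => rfl
      ext i; simp; omega
    rw [h2]
    have : (0 : ℝ) ≤ ((M - 1 : ℕ) : ℝ)⁻¹ := by positivity
    rw [one_div]
    linarith
  have hpi := Real.pi_gt_three
  have h3 : (1 / (2 * Real.pi ^ 2)) * (Real.pi ^ 2 / 6)
      ≤ (1 / (2 * Real.pi ^ 2)) * ((∑ n ∈ Finset.Icc 1 N, ((n : ℝ) ^ 2)⁻¹) + 1 / N) := by gcongr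
  have h4 : (1 / (2 * Real.pi ^ 2)) * (Real.pi ^ 2 / 6) = 1 / 12 := by field_simp; norm_num
  have h5 : (1 / (2 * Real.pi ^ 2)) * (1 / (N : ℝ)) ≤ 1 * (1 / N) := by
    gcongr
    rw [div_le_one (by positivity)]
    nlinarith
  rw [mul_add] at h3
  linarith

/-- The error in truncating the Fourier series of `1/2 - {y}`. -/
noncomputable def sawRem (N : ℕ) (y : ℝ) : ℝ := Int.fract y - 1 / 2 + sawPartial N y

lemma measurable_sawRem (N : ℕ) : Measurable (sawRem N) := by
  unfold sawRem
  exact (measurable_fract.sub_const _).add (continuous_sawPartial N).measurable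

lemma abs_sawPartial_le (N : ℕ) (y : ℝ) : |sawPartial N y| ≤ N := by
  refine (Finset.abs_sum_le_sum_abs _ _).trans ?_
  refine (Finset.sum_le_sum (g := fun _ => (1 : ℝ)) fun n hn => ?_).trans (by simp)
  have hn1 : (1 : ℝ) ≤ n := by exact_mod_cast (Finset.mem_Icc.1 hn).1
  have hpi := Real.pi_gt_three
  rw [abs_div, div_le_one (by positivity), abs_of_pos (show 0 < Real.pi * n by positivity)]
  exact (Real.abs_sin_le_one _).trans (by nlinarith)

lemma abs_sawRem_le (N : ℕ) (y : ℝ) : |sawRem N y| ≤ N + 1 := by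
  have h1 := abs_le.1 (abs_sawPartial_le N y)
  have h2 := Int.fract_nonneg y
  have h3 := Int.fract_lt_one y
  rw [sawRem, abs_le]
  constructor <;> linarith [h1.1, h1.2]

lemma intervalIntegrable_of_bounded {f : ℝ → ℝ} (hf : Measurable f) {C : ℝ}
    (hC : ∀ x, |f x| ≤ C) (a b : ℝ) : IntervalIntegrable f volume a b := by
  have h : IntervalIntegrable (fun _ : ℝ => C) volume a b := by simp
  refine h.mono_fun hf.aestronglyMeasurable (Filter.Eventually.of_forall fun x => ?_)
  simp only [Real.norm_eq_abs]
  exact (hC x).trans (le_abs_self C)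

lemma intervalIntegrable_sawRem_sq (N : ℕ) (a b : ℝ) :
    IntervalIntegrable (fun y => sawRem N y ^ 2) volume a b := by
  refine intervalIntegrable_of_bounded ((measurable_sawRem N).pow_const 2) (C := (N + 1) ^ 2)
    (fun x => ?_) a b
  rw [abs_pow]
  exact pow_le_pow_left₀ (abs_nonneg _) (abs_sawRem_le N x) 2

lemma integral_sawRem_sq_le {N : ℕ} (hN : N ≠ 0) {a b : ℝ} (hab : a ≤ b) :
    ∫ y in a..b, sawRem N y ^ 2 ≤ (b - a + 1) / N := by
  have hper : Function.Periodic (fun y => sawRem N y ^ 2) 1 := by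
    intro y
    simp only [sawRem, sawPartial_add_one, Int.fract_add_one]
  have h01 : ∫ y in (0 : ℝ)..1, sawRem N y ^ 2 ≤ 1 / (N : ℝ) := by
    refine le_of_eq_of_le ?_ (integral_sub_half_add_sawPartial_sq_le hN)
    refine intervalIntegral.integral_congr_ae ?_
    have : ∀ᵐ y : ℝ, y ≠ 1 := by simp [ae_iff]
    filter_upwards [this] with y hy1 hy
    rw [Set.uIoc_of_le zero_le_one] at hy
    rw [sawRem, Int.fract_eq_self.2 ⟨hy.1.le, lt_of_le_of_ne hy.2 hy1⟩]
  have h0 : 0 ≤ ∫ y in (0 : ℝ)..1, sawRem N y ^ 2 :=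
    intervalIntegral.integral_nonneg zero_le_one fun _ _ => sq_nonneg _
  set k : ℤ := ⌈b - a⌉ with hk
  have hkb : b ≤ a + k • (1 : ℝ) := by
    have := Int.le_ceil (b - a)
    simp
    linarith
  have hk2 : (k : ℝ) ≤ b - a + 1 := (Int.ceil_lt_add_one _).le
  have hk0 : (0 : ℝ) ≤ k := le_trans (by linarith) (Int.le_ceil (b - a))
  have h1 : ∫ y in a..b, sawRem N y ^ 2 ≤ ∫ y in a..(a + k • (1 : ℝ)), sawRem N y ^ 2 :=
    intervalIntegral.integral_mono_interval le_rfl hab hkb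
      (Filter.Eventually.of_forall fun _ => sq_nonneg _) (intervalIntegrable_sawRem_sq N _ _)
  have h2 := hper.intervalIntegral_add_zsmul_eq k a
    (fun t₁ t₂ => intervalIntegrable_sawRem_sq N t₁ t₂)
  rw [h2, hper.intervalIntegral_add_eq a 0, zero_add, zsmul_eq_mul] at h1
  refine h1.trans ?_
  calc (k : ℝ) * ∫ y in (0 : ℝ)..1, sawRem N y ^ 2 ≤ (b - a + 1) * (1 / N) := by gcongr
    _ = _ := by ring

lemma integral_sawRem_comp_sq_le {N : ℕ} (hN : N ≠ 0) {X q : ℝ} (hq : 0 < q) (hqX : q ≤ X)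
    (c : ℝ) : ∫ x in X..(2 * X), sawRem N (x / q + c) ^ 2 ≤ 2 * X / N := by
  have hX : 0 < X := hq.trans_le hqX
  rw [intervalIntegral.integral_comp_div_add (fun y => sawRem N y ^ 2) hq.ne', smul_eq_mul]
  have h := integral_sawRem_sq_le hN (a := X / q + c) (b := 2 * X / q + c) (by gcongr; linarith)
  calc q * _ ≤ q * ((2 * X / q + c - (X / q + c) + 1) / N) := by gcongr
    _ = (X + q) / N := by field_simp; ring
    _ ≤ _ := by gcongr; linarith

/-- `∑_{d ≤ D} μ(d) ({x/d²} - {(x+H)/d²})`. -/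
noncomputable def shortErr (D : ℕ) (H x : ℝ) : ℝ :=
  ∑ d ∈ Finset.Icc 1 D, (ArithmeticFunction.moebius d : ℝ) *
    (Int.fract (x / (d : ℝ) ^ 2) - Int.fract ((x + H) / (d : ℝ) ^ 2))

/-- The Fourier truncation of `shortErr`. -/
noncomputable def shortTrunc (D N : ℕ) (H x : ℝ) : ℝ :=
  ∑ d ∈ Finset.Icc 1 D, (ArithmeticFunction.moebius d : ℝ) *
    (sawPartial N ((x + H) / (d : ℝ) ^ 2) - sawPartial N (x / (d : ℝ) ^ 2))

lemma pairShortLE_sub_eq_shortErr {x H : ℝ} (hx : 0 ≤ x) (hH : 0 ≤ H) (z : ℝ) :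
    pairShortLE x H z - H * mertensTrunc z = shortErr ⌊Real.sqrt z⌋₊ H x := by
  rw [pairShortLE, mertensTrunc, shortErr, Finset.mul_sum, ← Finset.sum_sub_distrib]
  refine Finset.sum_congr rfl fun d hd => ?_
  have hd1 : (1 : ℝ) ≤ d := by exact_mod_cast (Finset.mem_Icc.1 hd).1
  have h1 : 0 ≤ x / (d : ℝ) ^ 2 := by positivity
  have h2 : x / (d : ℝ) ^ 2 ≤ (x + H) / (d : ℝ) ^ 2 := by gcongr; linarith
  have h3 := Nat.floor_mono h2
  rw [Finset.sum_const, Nat.card_Ioc, nsmul_eq_mul, Nat.cast_sub h3, Int.fract, Int.fract,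
    natCast_floor_eq_intCast_floor h1, natCast_floor_eq_intCast_floor (h1.trans h2)]
  field_simp
  ring

lemma abs_moebius_cast_le_one (d : ℕ) : |(ArithmeticFunction.moebius d : ℝ)| ≤ 1 := by
  exact_mod_cast ArithmeticFunction.abs_moebius_le_one (n := d)

lemma moebius_cast_sq_le_one (d : ℕ) : (ArithmeticFunction.moebius d : ℝ) ^ 2 ≤ 1 := by
  rw [← sq_abs]
  exact pow_le_one₀ (abs_nonneg _) (abs_moebius_cast_le_one d)

lemma abs_shortErr_le (D : ℕ) (H x : ℝ) : |shortErr D H x| ≤ D := by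
  refine (Finset.abs_sum_le_sum_abs _ _).trans ?_
  refine (Finset.sum_le_sum (g := fun _ => (1 : ℝ)) fun d _ => ?_).trans (by simp)
  rw [abs_mul]
  refine mul_le_one₀ (abs_moebius_cast_le_one d) (abs_nonneg _) ?_
  have h1 := Int.fract_nonneg (x / (d : ℝ) ^ 2)
  have h2 := Int.fract_lt_one (x / (d : ℝ) ^ 2)
  have h3 := Int.fract_nonneg ((x + H) / (d : ℝ) ^ 2)
  have h4 := Int.fract_lt_one ((x + H) / (d : ℝ) ^ 2)
  rw [abs_le]
  constructor <;> linarith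

lemma measurable_shortErr (D : ℕ) (H : ℝ) : Measurable (shortErr D H) := by
  unfold shortErr
  refine Finset.measurable_sum _ fun d _ => ?_
  refine Measurable.const_mul ?_ _
  exact (measurable_fract.comp (by fun_prop : Measurable fun x : ℝ => x / (d : ℝ) ^ 2)).sub
    (measurable_fract.comp (by fun_prop : Measurable fun x : ℝ => (x + H) / (d : ℝ) ^ 2))

lemma continuous_shortTrunc (D N : ℕ) (H : ℝ) : Continuous (shortTrunc D N H) := by
  unfold shortTrunc
  refine continuous_finsetSum _ fun d _ => ?_
  have := continuous_sawPartial N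
  fun_prop

lemma shortErr_sub_shortTrunc_sq_le (D N : ℕ) (H x : ℝ) :
    (shortErr D H x - shortTrunc D N H x) ^ 2 ≤
      2 * D * ∑ d ∈ Finset.Icc 1 D, (sawRem N (x / (d : ℝ) ^ 2 + 0) ^ 2
        + sawRem N (x / (d : ℝ) ^ 2 + H / (d : ℝ) ^ 2) ^ 2) := by
  have e : shortErr D H x - shortTrunc D N H x = ∑ d ∈ Finset.Icc 1 D,
      (ArithmeticFunction.moebius d : ℝ) * (sawRem N (x / (d : ℝ) ^ 2 + 0)
        - sawRem N (x / (d : ℝ) ^ 2 + H / (d : ℝ) ^ 2)) := by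
    rw [shortErr, shortTrunc, ← Finset.sum_sub_distrib]
    refine Finset.sum_congr rfl fun d _ => ?_
    rw [← add_div, add_zero, sawRem, sawRem]
    ring
  rw [e]
  refine (sq_sum_le_card_mul_sum_sq).trans ?_
  rw [Nat.card_Icc, Nat.add_sub_cancel, mul_comm 2 (D : ℝ), mul_assoc, Finset.mul_sum _ _ (2 : ℝ)]
  gcongr with d _
  rw [mul_pow]
  refine (mul_le_of_le_one_left (sq_nonneg _) (moebius_cast_sq_le_one d)).trans ?_
  nlinarith [sq_nonneg (sawRem N (x / (d : ℝ) ^ 2 + 0)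
        + sawRem N (x / (d : ℝ) ^ 2 + H / (d : ℝ) ^ 2))]

lemma abs_integral_shortErr_sq_sub_le {D N : ℕ} {H X : ℝ} (hD : 1 ≤ D) (hDX : (D : ℝ) ^ 2 ≤ X)
    (hN : D ^ 4 ≤ N) :
    |(∫ x in X..(2 * X), shortErr D H x ^ 2) - ∫ x in X..(2 * X), shortTrunc D N H x ^ 2|
      ≤ 17 * X := by
  have hD1 : (1 : ℝ) ≤ D := by exact_mod_cast hD
  have hN0 : N ≠ 0 := by
    have := Nat.pow_pos (n := 4) hD
    omega
  have hNr : (D : ℝ) ^ 4 ≤ N := by exact_mod_cast hN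
  have hNp : (0 : ℝ) < N := by positivity
  have hX : 0 < X := by nlinarith
  have hX2 : X ≤ 2 * X := by linarith
  have hfi : IntervalIntegrable (fun x => shortErr D H x ^ 2) volume X (2 * X) := by
    refine intervalIntegrable_of_bounded ((measurable_shortErr D H).pow_const 2) (C := (D : ℝ) ^ 2)
      (fun x => ?_) _ _
    rw [abs_pow]
    exact pow_le_pow_left₀ (abs_nonneg _) (abs_shortErr_le D H x) 2
  have hgi : IntervalIntegrable (fun x => shortTrunc D N H x ^ 2) volume X (2 * X) :=
    ((continuous_shortTrunc D N H).pow 2).intervalIntegrable _ _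
  have hRi : ∀ q c : ℝ, IntervalIntegrable (fun x => sawRem N (x / q + c) ^ 2) volume X (2 * X) := by
    intro q c
    refine intervalIntegrable_of_bounded (((measurable_sawRem N).comp
      (by fun_prop : Measurable fun x : ℝ => x / q + c)).pow_const 2) (C := (N + 1) ^ 2)
      (fun x => ?_) _ _
    rw [abs_pow]
    exact pow_le_pow_left₀ (abs_nonneg _) (abs_sawRem_le N _) 2
  have hsi : ∀ d : ℕ, IntervalIntegrable (fun x => sawRem N (x / (d : ℝ) ^ 2 + 0) ^ 2
        + sawRem N (x / (d : ℝ) ^ 2 + H / (d : ℝ) ^ 2) ^ 2) volume X (2 * X) :=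
    fun d => (hRi _ _).add (hRi _ _)
  have hSi : IntervalIntegrable (fun x => ∑ d ∈ Finset.Icc 1 D, (sawRem N (x / (d : ℝ) ^ 2 + 0) ^ 2
        + sawRem N (x / (d : ℝ) ^ 2 + H / (d : ℝ) ^ 2) ^ 2)) volume X (2 * X) := by
    have := IntervalIntegrable.sum (Finset.Icc 1 D) (fun d _ => hsi d)
    rwa [Finset.sum_fn] at this
  have hSb : ∫ x in X..(2 * X), ∑ d ∈ Finset.Icc 1 D, (sawRem N (x / (d : ℝ) ^ 2 + 0) ^ 2
        + sawRem N (x / (d : ℝ) ^ 2 + H / (d : ℝ) ^ 2) ^ 2) ≤ D * (4 * X / N) := by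
    rw [intervalIntegral.integral_finsetSum (fun d _ => hsi d)]
    refine (Finset.sum_le_sum (g := fun _ => 4 * X / N) fun d hd => ?_).trans (by simp)
    have hd' := Finset.mem_Icc.1 hd
    have hd1 : (1 : ℝ) ≤ d := by exact_mod_cast hd'.1
    have hdD : (d : ℝ) ≤ D := by exact_mod_cast hd'.2
    have hq : (d : ℝ) ^ 2 ≤ X := le_trans (by gcongr) hDX
    rw [intervalIntegral.integral_add (hRi _ _) (hRi _ _)]
    have h1 := integral_sawRem_comp_sq_le hN0 (by positivity) hq 0
    have h2 := integral_sawRem_comp_sq_le hN0 (by positivity) hq (H / (d : ℝ) ^ 2)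
    have : 4 * X / N = 2 * X / N + 2 * X / N := by ring
    linarith
  rw [← intervalIntegral.integral_sub hfi hgi]
  refine (intervalIntegral.abs_integral_le_integral_abs hX2).trans ?_
  have hmono : ∫ x in X..(2 * X), |shortErr D H x ^ 2 - shortTrunc D N H x ^ 2| ≤
      ∫ x in X..(2 * X), (1 + (1 + (D : ℝ) ^ 2) * (2 * D) *
        ∑ d ∈ Finset.Icc 1 D, (sawRem N (x / (d : ℝ) ^ 2 + 0) ^ 2
        + sawRem N (x / (d : ℝ) ^ 2 + H / (d : ℝ) ^ 2) ^ 2)) := by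
    refine intervalIntegral.integral_mono_on hX2 (hfi.sub hgi).abs
      ((by simp : IntervalIntegrable (fun _ => (1 : ℝ)) volume X (2 * X)).add (hSi.const_mul _)) ?_
    intro x _
    have h1 := shortErr_sub_shortTrunc_sq_le D N H x
    have h2 := abs_shortErr_le D H x
    set S := ∑ d ∈ Finset.Icc 1 D, (sawRem N (x / (d : ℝ) ^ 2 + 0) ^ 2
        + sawRem N (x / (d : ℝ) ^ 2 + H / (d : ℝ) ^ 2) ^ 2)
    set f := shortErr D H x
    set g := shortTrunc D N H x
    have h3 : f ^ 2 ≤ (D : ℝ) ^ 2 := by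
      rw [← sq_abs]; exact pow_le_pow_left₀ (abs_nonneg _) h2 2
    have h4 : f ^ 2 * (f - g) ^ 2 ≤ (D : ℝ) ^ 2 * (f - g) ^ 2 := by gcongr
    have h5 : (1 + (D : ℝ) ^ 2) * (f - g) ^ 2 ≤ (1 + (D : ℝ) ^ 2) * (2 * D * S) := by gcongr
    rw [abs_le]
    constructor
    · nlinarith [sq_nonneg (f * (f - g) + 1), sq_nonneg (f - g)]
    · nlinarith [sq_nonneg (f * (f - g) - 1), sq_nonneg (f - g)]
  refine hmono.trans ?_
  rw [intervalIntegral.integral_add (by simp) (hSi.const_mul _),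
    intervalIntegral.integral_const_mul]
  have h6 : (1 + (D : ℝ) ^ 2) * (2 * D) * (∫ x in X..(2 * X), ∑ d ∈ Finset.Icc 1 D,
      (sawRem N (x / (d : ℝ) ^ 2 + 0) ^ 2 + sawRem N (x / (d : ℝ) ^ 2 + H / (d : ℝ) ^ 2) ^ 2))
      ≤ (1 + (D : ℝ) ^ 2) * (2 * D) * (D * (4 * X / N)) := by gcongr
  have h7 : (1 + (D : ℝ) ^ 2) * (2 * D) * (D * (4 * X / N)) ≤ 16 * X := by
    have : (1 + (D : ℝ) ^ 2) * (2 * D) * (D * (4 * X / N))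
        = (8 * X) * ((1 + (D : ℝ) ^ 2) * (D : ℝ) ^ 2) / N := by ring
    rw [this, div_le_iff₀ hNp]
    have h8 : (1 + (D : ℝ) ^ 2) * (D : ℝ) ^ 2 ≤ 2 * N := by nlinarith [one_le_pow₀ (n := 2) hD1]
    nlinarith
  have h9 : ∫ x in X..(2 * X), (1 : ℝ) = X := by simp; ring
  rw [h9]
  linarith

/-- Harmonic sum `∑_{n ≤ N} 1/n`. -/
noncomputable def harm (N : ℕ) : ℝ := ∑ n ∈ Finset.Icc 1 N, 1 / (n : ℝ)

lemma harm_nonneg (N : ℕ) : 0 ≤ harm N := Finset.sum_nonneg fun _ _ => by positivity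

lemma harm_mono {M N : ℕ} (h : M ≤ N) : harm M ≤ harm N :=
  Finset.sum_le_sum_of_subset_of_nonneg (Finset.Icc_subset_Icc_right h) fun _ _ _ => by positivity

lemma harm_le (N : ℕ) : harm N ≤ 1 + Real.log N := by
  have h := harmonic_le_one_add_log N
  rw [harmonic_eq_sum_Icc] at h
  push_cast at h
  simpa [harm] using h

lemma one_le_harm {N : ℕ} (hN : 1 ≤ N) : 1 ≤ harm N := by
  have := harm_mono hN
  simpa [harm] using this

/-- A sum over well-spaced points of a function decaying like `M/|t-ρ|`. -/
lemma sum_spaced_le {ι : Type*} (S : Finset ι) (t F : ι → ℝ) {ρ δ A M : ℝ} {J : ℕ} (hδ : 0 < δ)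
    (hA : 0 ≤ A) (hM : 0 ≤ M)
    (hsep : ∀ p ∈ S, ∀ q ∈ S, p ≠ q → δ ≤ |t p - t q|)
    (hFA : ∀ p ∈ S, F p ≤ A) (hFM : ∀ p ∈ S, F p * |t p - ρ| ≤ M)
    (hJ : ∀ p ∈ S, |t p - ρ| ≤ J * δ) :
    ∑ p ∈ S, F p ≤ 2 * A + 2 * (M / δ) * harm J := by
  classical
  set φ : ι → ℕ × Bool := fun p => (⌊|t p - ρ| / δ⌋₊, decide (ρ ≤ t p)) with hφ
  set G : ℕ × Bool → ℝ := fun j => if j.1 = 0 then A else M / (j.1 * δ) with hG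
  have hG0 : ∀ j, 0 ≤ G j := fun j => by
    simp only [hG]
    split_ifs
    · exact hA
    · positivity
  have hinj : Set.InjOn φ S := by
    intro p hp q hq hpq
    by_contra hne
    have h1 := hsep p hp q hq hne
    simp only [hφ, Prod.mk.injEq, decide_eq_decide] at hpq
    obtain ⟨h2, h3⟩ := hpq
    have a1 := Nat.floor_le (show 0 ≤ |t p - ρ| / δ by positivity)
    have a2 := Nat.lt_floor_add_one (|t p - ρ| / δ)
    have b1 := Nat.floor_le (show 0 ≤ |t q - ρ| / δ by positivity)
    have b2 := Nat.lt_floor_add_one (|t q - ρ| / δ)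
    rw [h2] at a1 a2
    generalize (⌊|t q - ρ| / δ⌋₊ : ℝ) = j at a1 a2 b1 b2
    rw [le_div_iff₀ hδ] at a1 b1
    rw [div_lt_iff₀ hδ] at a2 b2
    refine absurd h1 (not_le.2 ?_)
    by_cases hc : ρ ≤ t p
    · have hc' := h3.1 hc
      rw [abs_of_nonneg (by linarith)] at a1 a2 b1 b2
      rw [abs_lt]; constructor <;> linarith
    · have hc' : ¬ ρ ≤ t q := fun h => hc (h3.2 h)
      push Not at hc hc'
      rw [abs_of_neg (by linarith)] at a1 a2 b1 b2
      rw [abs_lt]; constructor <;> linarith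
  have hFG : ∀ p ∈ S, F p ≤ G (φ p) := by
    intro p hp
    simp only [hG, hφ]
    split_ifs with h0
    · exact hFA p hp
    · have hj : (1 : ℝ) ≤ (⌊|t p - ρ| / δ⌋₊ : ℝ) := by
        exact_mod_cast Nat.one_le_iff_ne_zero.2 h0
      have a1 := Nat.floor_le (show 0 ≤ |t p - ρ| / δ by positivity)
      rw [le_div_iff₀ hδ] at a1
      have hpos : 0 < (⌊|t p - ρ| / δ⌋₊ : ℝ) * δ := by positivity
      rw [le_div_iff₀ hpos]
      rcases le_or_gt (F p) 0 with hF | hF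
      · exact (mul_nonpos_of_nonpos_of_nonneg hF hpos.le).trans hM
      · exact (mul_le_mul_of_nonneg_left a1 hF.le).trans (hFM p hp)
  have hmaps : ∀ p ∈ S, φ p ∈ Finset.range (J + 1) ×ˢ (Finset.univ : Finset Bool) := by
    intro p hp
    simp only [hφ, Finset.mem_product, Finset.mem_range, Finset.mem_univ, and_true]
    have : ⌊|t p - ρ| / δ⌋₊ ≤ J := by
      refine Nat.floor_le_of_le ?_
      rw [div_le_iff₀ hδ]
      exact hJ p hp
    omega
  calc ∑ p ∈ S, F p ≤ ∑ p ∈ S, G (φ p) := Finset.sum_le_sum hFG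
    _ = ∑ j ∈ S.image φ, G j := (Finset.sum_image hinj).symm
    _ ≤ ∑ j ∈ Finset.range (J + 1) ×ˢ (Finset.univ : Finset Bool), G j :=
        Finset.sum_le_sum_of_subset_of_nonneg (by
          intro j hj
          obtain ⟨p, hp, rfl⟩ := Finset.mem_image.1 hj
          exact hmaps p hp) fun _ _ _ => hG0 _
    _ = 2 * ∑ j ∈ Finset.range (J + 1), (if j = 0 then A else M / (j * δ)) := by
        rw [Finset.sum_product, Finset.mul_sum]
        refine Finset.sum_congr rfl fun j _ => ?_
        simp [hG]
    _ = 2 * A + 2 * (M / δ) * harm J := by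
        rw [Finset.sum_range_succ', harm, mul_assoc, Finset.mul_sum, Finset.range_eq_Ico,
          Finset.sum_Ico_add' (fun j : ℕ => if j = 0 then A else M / (j * δ)) 0 J 1]
        rw [show Finset.Ico (0 + 1) (J + 1) = Finset.Icc 1 J from rfl]
        have : ∀ j ∈ Finset.Icc 1 J, (if j = 0 then A else M / (j * δ)) = M / δ * (1 / (j : ℝ)) := by
          intro j hj
          rw [if_neg (by have := (Finset.mem_Icc.1 hj).1; omega)]
          have : δ ≠ 0 := hδ.ne'
          field_simp
        rw [Finset.sum_congr rfl this]
        simp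
        ring

lemma gcd_sq_le_abs_sub {a b c d g : ℕ} (ha : g ∣ a) (hb : g ∣ b) (hc : g ∣ c) (hd : g ∣ d)
    (hne : a * b ≠ c * d) : (g : ℝ) ^ 2 ≤ |(a : ℝ) * b - c * d| := by
  have h1 : ((g : ℤ) ^ 2) ∣ ((a : ℤ) * b - c * d) := by
    rw [sq]
    refine dvd_sub (mul_dvd_mul ?_ ?_) (mul_dvd_mul ?_ ?_) <;> exact_mod_cast ‹_›
  have h2 : (a : ℤ) * b - c * d ≠ 0 := by
    rw [sub_ne_zero]; exact_mod_cast hne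
  have h3 := Int.le_of_dvd (abs_pos.2 h2) ((dvd_abs _ _).2 h1)
  exact_mod_cast h3

lemma eq_of_gcd_eq_of_mul_eq {a b c d : ℕ} (hb : 0 < b) (hd : 0 < d)
    (hg : Nat.gcd a b = Nat.gcd c d) (h : a * d = c * b) : a = c ∧ b = d := by
  have hbd : b = d := by
    have h1 : Nat.gcd (a * d) (b * d) = Nat.gcd a b * d := Nat.gcd_mul_right _ _ _
    have h2 : Nat.gcd (c * b) (d * b) = Nat.gcd c d * b := Nat.gcd_mul_right _ _ _
    rw [h, mul_comm b d, h2, hg] at h1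
    have : 0 < Nat.gcd c d := Nat.gcd_pos_of_pos_right _ hd
    exact Nat.eq_of_mul_eq_mul_left this h1
  subst hbd
  exact ⟨Nat.eq_of_mul_eq_mul_right hb h, rfl⟩

lemma sum_two_pow_log_le {D : ℕ} (hD : 1 ≤ D) :
    ∑ k ∈ Finset.range (Nat.log 2 D + 1), (2 : ℝ) ^ k ≤ 2 * D := by
  have h := Nat.geomSum_eq (le_refl 2) (Nat.log 2 D + 1)
  have h1 : ∑ k ∈ Finset.range (Nat.log 2 D + 1), 2 ^ k ≤ 2 * D := by
    rw [h]
    have := Nat.pow_log_le_self 2 (show D ≠ 0 by omega)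
    rw [pow_succ]
    simp
    omega
  exact_mod_cast h1

lemma sum_offdiag_le {D N J : ℕ} (hD : 1 ≤ D) (hJ : 4 * D ^ 2 * (D + N) ≤ J) {ρ P Q : ℝ}
    (hP : 0 ≤ P) (hQ : 0 ≤ Q)
    (hρ0 : 0 ≤ ρ) (hρN : ρ ≤ N) (S : Finset (ℕ × ℕ)) (hS : S ⊆ Finset.Icc 1 D ×ˢ Finset.Icc 1 D)
    (F : ℕ × ℕ → ℝ)
    (hFA : ∀ p ∈ S, F p ≤ P * (p.1 * p.2 / Nat.gcd p.1 p.2))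
    (hFM : ∀ p ∈ S, F p * |(p.1 : ℝ) / p.2 - ρ| ≤ Q * (p.1 / p.2)) :
    ∑ p ∈ S, F p ≤ harm D * (8 * D ^ 2 * P + 16 * D ^ 2 * Q * harm J) := by
  classical
  have hD0 : (0 : ℝ) < D := by exact_mod_cast hD
  set ψ : ℕ × ℕ → ℕ × ℕ := fun p => (Nat.gcd p.1 p.2, Nat.log 2 p.2) with hψ
  set T := Finset.Icc 1 D ×ˢ Finset.range (Nat.log 2 D + 1) with hT
  have hmaps : ∀ p ∈ S, ψ p ∈ T := by
    intro p hp
    have := Finset.mem_product.1 (hS hp)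
    simp only [Finset.mem_Icc] at this
    simp only [hψ, hT, Finset.mem_product, Finset.mem_Icc, Finset.mem_range]
    refine ⟨⟨Nat.gcd_pos_of_pos_left _ this.1.1, (Nat.gcd_le_left _ this.1.1).trans this.1.2⟩, ?_⟩
    have := Nat.log_mono_right (b := 2) this.2.2
    omega
  rw [← Finset.sum_fiberwise_of_maps_to hmaps]
  have hfib : ∀ j ∈ T, ∑ p ∈ S.filter (fun p => ψ p = j), F p ≤
      (1 / (j.1 : ℝ)) * ((2 : ℝ) ^ j.2 * (4 * D * P + 8 * D * Q * harm J)) := by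
    rintro ⟨g, k⟩ hj
    simp only [hT, Finset.mem_product, Finset.mem_Icc, Finset.mem_range] at hj
    have hg1 : (1 : ℝ) ≤ g := by exact_mod_cast hj.1.1
    have hmem : ∀ p ∈ S.filter (fun p => ψ p = (g, k)), p ∈ S ∧ 1 ≤ p.1 ∧ p.1 ≤ D ∧ 1 ≤ p.2 ∧ p.2 ≤ D
        ∧ Nat.gcd p.1 p.2 = g ∧ 2 ^ k ≤ p.2 ∧ p.2 < 2 ^ (k + 1) := by
      intro p hp
      rw [Finset.mem_filter] at hp
      have h1 := Finset.mem_product.1 (hS hp.1)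
      simp only [Finset.mem_Icc] at h1
      simp only [hψ, Prod.mk.injEq] at hp
      refine ⟨hp.1, h1.1.1, h1.1.2, h1.2.1, h1.2.2, hp.2.1, ?_, ?_⟩
      · rw [← hp.2.2]; exact Nat.pow_log_le_self 2 (by omega)
      · rw [← hp.2.2]; exact Nat.lt_pow_succ_log_self (by norm_num) _
    have h2k : (2 : ℝ) ^ k ≤ D := by
      have h1 := Nat.pow_log_le_self 2 (show D ≠ 0 by omega)
      have h2 : 2 ^ k ≤ 2 ^ Nat.log 2 D := Nat.pow_le_pow_right (by norm_num) (by omega)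
      exact_mod_cast h2.trans h1
    have h2p : (0 : ℝ) < 2 ^ k := by positivity
    have key := sum_spaced_le (S.filter (fun p => ψ p = (g, k))) (fun p => (p.1 : ℝ) / p.2) F
      (ρ := ρ) (δ := (g : ℝ) ^ 2 / (2 * 2 ^ k) ^ 2) (A := P * (D * (2 * 2 ^ k) / g))
      (M := Q * (D / 2 ^ k)) (J := J) (by positivity) (by positivity) (by positivity) ?_ ?_ ?_ ?_
    · refine key.trans (le_of_sub_nonneg ?_)
      have e : 1 / ((g, k) : ℕ × ℕ).1 * (2 ^ ((g, k) : ℕ × ℕ).2 * (4 * D * P + 8 * D * Q * harm J))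
          - (2 * (P * (D * (2 * 2 ^ k) / g)) + 2 * (Q * (D / 2 ^ k) / ((g : ℝ) ^ 2 / (2 * 2 ^ k) ^ 2))
            * harm J) = 8 * D * Q * harm J * 2 ^ k * (1 / g - 1 / (g : ℝ) ^ 2) := by
        simp only
        field_simp
        ring
      rw [e]
      have h3 : 1 / (g : ℝ) ^ 2 ≤ 1 / g := by
        apply one_div_le_one_div_of_le (by positivity)
        nlinarith
      have := harm_nonneg J
      have h4 : 0 ≤ 1 / (g : ℝ) - 1 / (g : ℝ) ^ 2 := by linarith
      positivity
    · intro p hp q hq hne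
      obtain ⟨-, -, -, hp2, -, hpg, -, hpk⟩ := hmem p hp
      obtain ⟨-, -, -, hq2, -, hqg, -, hqk⟩ := hmem q hq
      have hp2r : (1 : ℝ) ≤ p.2 := by exact_mod_cast hp2
      have hq2r : (1 : ℝ) ≤ q.2 := by exact_mod_cast hq2
      have hpkr : (p.2 : ℝ) ≤ 2 * 2 ^ k := by
        have : p.2 ≤ 2 * 2 ^ k := by rw [pow_succ] at hpk; omega
        exact_mod_cast this
      have hqkr : (q.2 : ℝ) ≤ 2 * 2 ^ k := by
        have : q.2 ≤ 2 * 2 ^ k := by rw [pow_succ] at hqk; omega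
        exact_mod_cast this
      have hdist : p.1 * q.2 ≠ q.1 * p.2 := by
        intro h
        obtain ⟨h1, h2⟩ := eq_of_gcd_eq_of_mul_eq hp2 hq2 (hpg.trans hqg.symm) h
        exact hne (Prod.ext h1 h2)
      have hg2 := gcd_sq_le_abs_sub (g := g) (hpg ▸ Nat.gcd_dvd_left _ _) (hqg ▸ Nat.gcd_dvd_right _ _)
        (hqg ▸ Nat.gcd_dvd_left _ _) (hpg ▸ Nat.gcd_dvd_right _ _) hdist
      have e : (p.1 : ℝ) / p.2 - q.1 / q.2 = ((p.1 : ℝ) * q.2 - q.1 * p.2) / (p.2 * q.2) := by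
        field_simp
      rw [e, abs_div, abs_of_pos (show (0 : ℝ) < p.2 * q.2 by positivity)]
      have : (p.2 : ℝ) * q.2 ≤ (2 * 2 ^ k) ^ 2 := by rw [sq]; gcongr
      gcongr
    · intro p hp
      obtain ⟨hpS, hp1, hp1', hp2, -, hpg, -, hpk⟩ := hmem p hp
      refine (hFA p hpS).trans ?_
      have hpkr : (p.2 : ℝ) ≤ 2 * 2 ^ k := by
        have : p.2 ≤ 2 * 2 ^ k := by rw [pow_succ] at hpk; omega
        exact_mod_cast this
      have : (p.1 : ℝ) ≤ D := by exact_mod_cast hp1'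
      rw [hpg]
      gcongr
    · intro p hp
      obtain ⟨hpS, hp1, hp1', hp2, -, hpg, hpk, -⟩ := hmem p hp
      refine (hFM p hpS).trans ?_
      have hpkr : (2 : ℝ) ^ k ≤ p.2 := by exact_mod_cast hpk
      have : (p.1 : ℝ) ≤ D := by exact_mod_cast hp1'
      gcongr
    · intro p hp
      obtain ⟨hpS, hp1, hp1', hp2, -, hpg, hpk, -⟩ := hmem p hp
      have hp2r : (1 : ℝ) ≤ p.2 := by exact_mod_cast hp2
      have h1 : (p.1 : ℝ) / p.2 ≤ D := by
        rw [div_le_iff₀ (by positivity)]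
        have : (p.1 : ℝ) ≤ D := by exact_mod_cast hp1'
        nlinarith
      have h2 : 0 ≤ (p.1 : ℝ) / p.2 := by positivity
      have h3 : |(p.1 : ℝ) / p.2 - ρ| ≤ D + N := by
        have hN0 : (0 : ℝ) ≤ N := by positivity
        rw [abs_le]; constructor <;> linarith
      refine h3.trans ?_
      have hJr : 4 * (D : ℝ) ^ 2 * (D + N) ≤ J := by exact_mod_cast hJ
      rw [mul_div_assoc', le_div_iff₀ (by positivity)]
      calc ((D : ℝ) + N) * (2 * 2 ^ k) ^ 2 ≤ (D + N) * (2 * D) ^ 2 := by gcongr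
        _ = 4 * (D : ℝ) ^ 2 * (D + N) * 1 := by ring
        _ ≤ J * (g : ℝ) ^ 2 := by gcongr; exact one_le_pow₀ hg1
  refine (Finset.sum_le_sum hfib).trans ?_
  rw [hT, Finset.sum_product]
  simp only
  simp_rw [← Finset.mul_sum]
  rw [← Finset.sum_mul, ← Finset.sum_mul]
  rw [← harm]
  refine mul_le_mul_of_nonneg_left ?_ (harm_nonneg D)
  have h0 : 0 ≤ 4 * D * P + 8 * D * Q * harm J := by have := harm_nonneg J; positivity
  calc _ ≤ (2 * (D : ℝ)) * (4 * D * P + 8 * D * Q * harm J) :=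
        mul_le_mul_of_nonneg_right (sum_two_pow_log_le hD) h0
    _ = _ := by ring

/-- The mean of `cos(2πλ(x+h))` over `[X, 2X]`. -/
noncomputable def cosMean (X h l : ℝ) : ℝ :=
  (1 / X) * ∫ x in X..(2 * X), Real.cos (2 * Real.pi * l * (x + h))

lemma cosMean_zero {X : ℝ} (hX : 0 < X) (h : ℝ) : cosMean X h 0 = 1 := by
  simp [cosMean]
  field_simp
  ring

lemma abs_cosMean_le_one {X : ℝ} (hX : 0 < X) (h l : ℝ) : |cosMean X h l| ≤ 1 := by
  have h1 := intervalIntegral.norm_integral_le_of_norm_le_const (a := X) (b := 2 * X) (C := 1)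
    (f := fun x => Real.cos (2 * Real.pi * l * (x + h))) (fun x _ => Real.abs_cos_le_one _)
  rw [Real.norm_eq_abs, show 2 * X - X = X by ring, abs_of_pos hX, one_mul] at h1
  rw [cosMean, abs_mul, abs_of_pos (by positivity : 0 < 1 / X), one_div, inv_mul_le_iff₀ hX, mul_one]
  exact h1

lemma abs_cosMean_le {X : ℝ} (hX : 0 < X) (h : ℝ) {l : ℝ} (hl : l ≠ 0) :
    |cosMean X h l| ≤ 1 / (|l| * X) := by
  have hc : 2 * Real.pi * l ≠ 0 := by positivity
  have e : ∫ x in X..(2 * X), Real.cos (2 * Real.pi * l * (x + h))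
      = (2 * Real.pi * l)⁻¹ * (Real.sin (2 * Real.pi * l * (2 * X) + 2 * Real.pi * l * h)
        - Real.sin (2 * Real.pi * l * X + 2 * Real.pi * l * h)) := by
    simp_rw [mul_add]
    rw [intervalIntegral.integral_comp_mul_add (fun y => Real.cos y) hc, integral_cos, smul_eq_mul]
  have hs : |Real.sin (2 * Real.pi * l * (2 * X) + 2 * Real.pi * l * h)
        - Real.sin (2 * Real.pi * l * X + 2 * Real.pi * l * h)| ≤ 2 := by
    have h1 := Real.neg_one_le_sin (2 * Real.pi * l * (2 * X) + 2 * Real.pi * l * h)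
    have h2 := Real.sin_le_one (2 * Real.pi * l * (2 * X) + 2 * Real.pi * l * h)
    have h3 := Real.neg_one_le_sin (2 * Real.pi * l * X + 2 * Real.pi * l * h)
    have h4 := Real.sin_le_one (2 * Real.pi * l * X + 2 * Real.pi * l * h)
    rw [abs_le]; constructor <;> linarith
  have hpi := Real.pi_gt_three
  have hl' := abs_pos.2 hl
  rw [cosMean, e, abs_mul, abs_mul, abs_inv, abs_mul, abs_of_pos (by positivity : 0 < 1 / X),
    abs_of_pos (by positivity : 0 < 2 * Real.pi)]
  calc 1 / X * ((2 * Real.pi * |l|)⁻¹ * _) ≤ 1 / X * ((2 * Real.pi * |l|)⁻¹ * 2) := by gcongr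
    _ = 1 / (|l| * X) * (1 / Real.pi) := by field_simp
    _ ≤ 1 / (|l| * X) * 1 := by
        gcongr
        rw [div_le_one (by positivity)]; linarith
    _ = _ := mul_one _

lemma mean_sq_sum_cos {ι : Type*} (S : Finset ι) (c l : ι → ℝ) {X : ℝ} (h : ℝ) :
    (1 / X) * ∫ x in X..(2 * X), (∑ p ∈ S, c p * Real.cos (2 * Real.pi * l p * (x + h))) ^ 2
      = (1 / 2) * ∑ p ∈ S, ∑ q ∈ S, c p * c q * cosMean X h (l p - l q)
        + (1 / 2) * ∑ p ∈ S, ∑ q ∈ S, c p * c q * cosMean X h (l p + l q) := by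
  have e : ∀ x : ℝ, (∑ p ∈ S, c p * Real.cos (2 * Real.pi * l p * (x + h))) ^ 2
      = ∑ p ∈ S, ∑ q ∈ S, (c p * c q / 2) * (Real.cos (2 * Real.pi * (l p - l q) * (x + h))
        + Real.cos (2 * Real.pi * (l p + l q) * (x + h))) := by
    intro x
    rw [sq, Finset.sum_mul_sum]
    refine Finset.sum_congr rfl fun p _ => Finset.sum_congr rfl fun q _ => ?_
    rw [show 2 * Real.pi * (l p - l q) * (x + h)
        = 2 * Real.pi * l p * (x + h) - 2 * Real.pi * l q * (x + h) by ring,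
      show 2 * Real.pi * (l p + l q) * (x + h)
        = 2 * Real.pi * l p * (x + h) + 2 * Real.pi * l q * (x + h) by ring,
      Real.cos_sub, Real.cos_add]
    ring
  simp_rw [e]
  rw [intervalIntegral.integral_finsetSum
    (fun p _ => Continuous.intervalIntegrable (by fun_prop) _ _), Finset.mul_sum, Finset.mul_sum,
    Finset.mul_sum, ← Finset.sum_add_distrib]
  refine Finset.sum_congr rfl fun p _ => ?_
  rw [intervalIntegral.integral_finsetSum
    (fun q _ => Continuous.intervalIntegrable (by fun_prop) _ _), Finset.mul_sum, Finset.mul_sum,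
    Finset.mul_sum, ← Finset.sum_add_distrib]
  refine Finset.sum_congr rfl fun q _ => ?_
  rw [intervalIntegral.integral_const_mul, intervalIntegral.integral_add
    (Continuous.intervalIntegrable (by fun_prop) _ _)
    (Continuous.intervalIntegrable (by fun_prop) _ _), cosMean, cosMean]
  ring

lemma abs_mean_sq_sum_cos_sub_le {ι : Type*} (S : Finset ι) (c l : ι → ℝ) {X : ℝ} (hX : 0 < X)
    (h : ℝ) (r : ι → ι → Prop) [DecidableRel r] (hr : ∀ p ∈ S, ∀ q ∈ S, r p q ↔ l p = l q)
    (hl : ∀ p ∈ S, 0 < l p) :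
    |(1 / X) * (∫ x in X..(2 * X), (∑ p ∈ S, c p * Real.cos (2 * Real.pi * l p * (x + h))) ^ 2)
      - (1 / 2) * ∑ p ∈ S, ∑ q ∈ S, if r p q then c p * c q else 0|
      ≤ (1 / 2) * (∑ p ∈ S, ∑ q ∈ S,
          if r p q then 0 else |c p| * |c q| * min 1 (1 / (|l p - l q| * X)))
        + (1 / 2) * ∑ p ∈ S, ∑ q ∈ S, |c p| * |c q| * (1 / ((l p + l q) * X)) := by
  have e : (1 / X) * (∫ x in X..(2 * X), (∑ p ∈ S, c p * Real.cos (2 * Real.pi * l p * (x + h))) ^ 2)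
      - (1 / 2) * ∑ p ∈ S, ∑ q ∈ S, (if r p q then c p * c q else 0)
      = (1 / 2) * (∑ p ∈ S, ∑ q ∈ S, if r p q then 0 else c p * c q * cosMean X h (l p - l q))
        + (1 / 2) * ∑ p ∈ S, ∑ q ∈ S, c p * c q * cosMean X h (l p + l q) := by
    rw [mean_sq_sum_cos, add_sub_right_comm, ← mul_sub, ← Finset.sum_sub_distrib]
    congr 2
    refine Finset.sum_congr rfl fun p hp => ?_
    rw [← Finset.sum_sub_distrib]
    refine Finset.sum_congr rfl fun q hq => ?_
    split_ifs with hrpq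
    · rw [(hr p hp q hq).1 hrpq, sub_self, cosMean_zero hX]; ring
    · ring
  rw [e]
  refine (abs_add_le _ _).trans ?_
  rw [abs_mul, abs_mul, abs_of_pos (by norm_num : (0 : ℝ) < 1 / 2)]
  gcongr
  · refine (Finset.abs_sum_le_sum_abs _ _).trans (Finset.sum_le_sum fun p hp => ?_)
    refine (Finset.abs_sum_le_sum_abs _ _).trans (Finset.sum_le_sum fun q hq => ?_)
    split_ifs with hrpq
    · simp
    · rw [abs_mul, abs_mul]
      have hne : l p - l q ≠ 0 := sub_ne_zero.2 fun h => hrpq ((hr p hp q hq).2 h)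
      gcongr
      exact le_min (abs_cosMean_le_one hX _ _) (abs_cosMean_le hX _ hne)
  · refine (Finset.abs_sum_le_sum_abs _ _).trans (Finset.sum_le_sum fun p hp => ?_)
    refine (Finset.abs_sum_le_sum_abs _ _).trans (Finset.sum_le_sum fun q hq => ?_)
    rw [abs_mul, abs_mul]
    have hpos : 0 < l p + l q := add_pos (hl p hp) (hl q hq)
    gcongr
    have := abs_cosMean_le hX h hpos.ne'
    rwa [abs_of_pos hpos] at this

/-- Amplitude of the `n`-th harmonic with modulus `d²`. -/
noncomputable def sawCoef (H : ℝ) (d n : ℕ) : ℝ :=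
  2 * Real.sin (Real.pi * n * H / (d : ℝ) ^ 2) / (Real.pi * n)

lemma shortTrunc_eq (D N : ℕ) (H x : ℝ) :
    shortTrunc D N H x = ∑ p ∈ Finset.Icc 1 D ×ˢ Finset.Icc 1 N,
      ((ArithmeticFunction.moebius p.1 : ℝ) * sawCoef H p.1 p.2) *
        Real.cos (2 * Real.pi * ((p.2 : ℝ) / (p.1 : ℝ) ^ 2) * (x + H / 2)) := by
  rw [Finset.sum_product, shortTrunc]
  refine Finset.sum_congr rfl fun d _ => ?_
  rw [sawPartial, sawPartial, ← Finset.sum_sub_distrib, Finset.mul_sum]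
  refine Finset.sum_congr rfl fun n _ => ?_
  simp only
  rw [← sub_div, Real.sin_sub_sin, sawCoef,
    show (2 * Real.pi * n * ((x + H) / (d : ℝ) ^ 2) - 2 * Real.pi * n * (x / (d : ℝ) ^ 2)) / 2
      = Real.pi * n * H / (d : ℝ) ^ 2 by ring,
    show (2 * Real.pi * n * ((x + H) / (d : ℝ) ^ 2) + 2 * Real.pi * n * (x / (d : ℝ) ^ 2)) / 2
      = 2 * Real.pi * ((n : ℝ) / (d : ℝ) ^ 2) * (x + H / 2) by ring]
  ring

lemma abs_sawCoef_le_one_div {H : ℝ} {d n : ℕ} (hn : 1 ≤ n) : |sawCoef H d n| ≤ 1 / n := by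
  have hn' : (0 : ℝ) < n := by exact_mod_cast hn
  have hpi := Real.pi_gt_three
  rw [sawCoef, abs_div, abs_mul, abs_of_pos (by positivity : 0 < Real.pi * n), abs_two,
    div_le_div_iff₀ (by positivity) hn']
  nlinarith [Real.abs_sin_le_one (Real.pi * n * H / (d : ℝ) ^ 2)]

lemma abs_sawCoef_le {H : ℝ} (hH : 0 ≤ H) {d n : ℕ} (hd : 1 ≤ d) (hn : 1 ≤ n) :
    |sawCoef H d n| ≤ 2 * H / (d : ℝ) ^ 2 := by
  have hn' : (0 : ℝ) < n := by exact_mod_cast hn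
  have hd' : (0 : ℝ) < d := by exact_mod_cast hd
  have hpi := Real.pi_gt_three
  rw [sawCoef, abs_div, abs_mul, abs_of_pos (by positivity : 0 < Real.pi * n), abs_two,
    div_le_iff₀ (by positivity)]
  have h1 := Real.abs_sin_le_abs (x := Real.pi * n * H / (d : ℝ) ^ 2)
  rw [abs_of_nonneg (show 0 ≤ Real.pi * n * H / (d : ℝ) ^ 2 by positivity)] at h1
  calc _ ≤ 2 * (Real.pi * n * H / (d : ℝ) ^ 2) := by gcongr
    _ = _ := by ring

lemma abs_sawCoef_le_sqrt {H : ℝ} (hH : 0 ≤ H) {d n : ℕ} (hd : 1 ≤ d) (hn : 1 ≤ n) :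
    |sawCoef H d n| ≤ Real.sqrt (2 * H) / (d * Real.sqrt n) := by
  have hn' : (0 : ℝ) < n := by exact_mod_cast hn
  have hd' : (0 : ℝ) < d := by exact_mod_cast hd
  rw [← abs_of_nonneg (by positivity : 0 ≤ Real.sqrt (2 * H) / (d * Real.sqrt n)), ← sq_le_sq,
    ← sq_abs, div_pow, mul_pow, Real.sq_sqrt (by positivity), Real.sq_sqrt hn'.le]
  calc |sawCoef H d n| ^ 2 = |sawCoef H d n| * |sawCoef H d n| := sq _
    _ ≤ (1 / n) * (2 * H / (d : ℝ) ^ 2) := by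
        gcongr
        · exact abs_sawCoef_le_one_div hn
        · exact abs_sawCoef_le hH hd hn
    _ = _ := by field_simp

lemma sawCoef_plus_le {H X : ℝ} (hH : 0 ≤ H) (hX : 0 < X) {d e m n : ℕ} (hd : 1 ≤ d) (he : 1 ≤ e)
    (hm : 1 ≤ m) (hn : 1 ≤ n) :
    |sawCoef H d m| * |sawCoef H e n| * (1 / (((m : ℝ) / (d : ℝ) ^ 2 + (n : ℝ) / (e : ℝ) ^ 2) * X))
      ≤ H / X * (1 / m * (1 / n)) := by
  have hn' : (0 : ℝ) < n := by exact_mod_cast hn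
  have hm' : (0 : ℝ) < m := by exact_mod_cast hm
  have hd' : (0 : ℝ) < d := by exact_mod_cast hd
  have he' : (0 : ℝ) < e := by exact_mod_cast he
  set u := Real.sqrt m with hu
  set v := Real.sqrt n with hv
  have hu0 : 0 < u := Real.sqrt_pos.2 hm'
  have hv0 : 0 < v := Real.sqrt_pos.2 hn'
  have hu2 : (m : ℝ) = u ^ 2 := (Real.sq_sqrt hm'.le).symm
  have hv2 : (n : ℝ) = v ^ 2 := (Real.sq_sqrt hn'.le).symm
  have h1 : 2 * (u / d) * (v / e) ≤ (m : ℝ) / (d : ℝ) ^ 2 + (n : ℝ) / (e : ℝ) ^ 2 := by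
    rw [hu2, hv2, ← div_pow, ← div_pow]
    exact two_mul_le_add_sq _ _
  calc _ ≤ (Real.sqrt (2 * H) / (d * u)) * (Real.sqrt (2 * H) / (e * v))
        * (1 / ((2 * (u / d) * (v / e)) * X)) := by
        gcongr
        · exact abs_sawCoef_le_sqrt hH hd hm
        · exact abs_sawCoef_le_sqrt hH he hn
    _ = (Real.sqrt (2 * H) * Real.sqrt (2 * H)) / (2 * u ^ 2 * v ^ 2 * X) := by field_simp
    _ = _ := by rw [Real.mul_self_sqrt (by positivity), hu2, hv2]; field_simp

lemma sawCoef_minus_le_gcd {H X : ℝ} (hX : 0 < X) {d e m n : ℕ} (hd : 1 ≤ d) (he : 1 ≤ e)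
    (hm : 1 ≤ m) (hn : 1 ≤ n) (hne : m * e ^ 2 ≠ n * d ^ 2) :
    |sawCoef H d m| * |sawCoef H e n|
      * min 1 (1 / (|(m : ℝ) / (d : ℝ) ^ 2 - (n : ℝ) / (e : ℝ) ^ 2| * X))
      ≤ (1 / m * (1 / n)) * (1 / Real.sqrt X) * (d * e / Nat.gcd d e) := by
  have hn' : (0 : ℝ) < n := by exact_mod_cast hn
  have hm' : (0 : ℝ) < m := by exact_mod_cast hm
  have hd' : (0 : ℝ) < d := by exact_mod_cast hd
  have he' : (0 : ℝ) < e := by exact_mod_cast he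
  have hg0 : (0 : ℝ) < Nat.gcd d e := by exact_mod_cast Nat.gcd_pos_of_pos_left _ hd
  have hs : 0 < Real.sqrt X := Real.sqrt_pos.2 hX
  have hnum : ((Nat.gcd d e : ℕ) : ℝ) ^ 2 ≤ |(m : ℝ) * (e : ℝ) ^ 2 - n * (d : ℝ) ^ 2| := by
    have h1 : ((Nat.gcd d e : ℤ) ^ 2) ∣ ((m : ℤ) * (e : ℤ) ^ 2 - n * (d : ℤ) ^ 2) := by
      refine dvd_sub (Dvd.dvd.mul_left (pow_dvd_pow_of_dvd ?_ 2) _)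
        (Dvd.dvd.mul_left (pow_dvd_pow_of_dvd ?_ 2) _)
      · exact_mod_cast Nat.gcd_dvd_right d e
      · exact_mod_cast Nat.gcd_dvd_left d e
    have h2 : (m : ℤ) * (e : ℤ) ^ 2 - n * (d : ℤ) ^ 2 ≠ 0 := by
      rw [sub_ne_zero]; exact_mod_cast hne
    have h3 := Int.le_of_dvd (abs_pos.2 h2) ((dvd_abs _ _).2 h1)
    exact_mod_cast h3
  have hl : (m : ℝ) / (d : ℝ) ^ 2 - (n : ℝ) / (e : ℝ) ^ 2
      = ((m : ℝ) * (e : ℝ) ^ 2 - n * (d : ℝ) ^ 2) / ((d : ℝ) * e) ^ 2 := by field_simp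
  have hlam : (Nat.gcd d e / ((d : ℝ) * e)) ^ 2 ≤ |(m : ℝ) / (d : ℝ) ^ 2 - (n : ℝ) / (e : ℝ) ^ 2| := by
    rw [hl, abs_div, abs_of_pos (by positivity : 0 < ((d : ℝ) * e) ^ 2), div_pow]
    gcongr
  have hmin : min 1 (1 / (|(m : ℝ) / (d : ℝ) ^ 2 - (n : ℝ) / (e : ℝ) ^ 2| * X))
      ≤ (1 / Real.sqrt X) * (d * e / Nat.gcd d e) := by
    set w := (1 / Real.sqrt X) * (d * e / Nat.gcd d e) with hw
    have hw0 : 0 < w := by positivity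
    have h2 : 1 / (|(m : ℝ) / (d : ℝ) ^ 2 - (n : ℝ) / (e : ℝ) ^ 2| * X) ≤ w ^ 2 := by
      calc _ ≤ 1 / ((Nat.gcd d e / ((d : ℝ) * e)) ^ 2 * X) := by gcongr
        _ = 1 / ((Nat.gcd d e / ((d : ℝ) * e)) ^ 2 * Real.sqrt X ^ 2) := by rw [Real.sq_sqrt hX.le]
        _ = w ^ 2 := by rw [hw]; field_simp
    rcases le_or_gt 1 w with h | h
    · exact (min_le_left _ _).trans h
    · exact (min_le_right _ _).trans (h2.trans (by nlinarith))
  calc _ ≤ (1 / m) * (1 / n) * ((1 / Real.sqrt X) * (d * e / Nat.gcd d e)) := by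
        gcongr
        · exact abs_sawCoef_le_one_div hm
        · exact abs_sawCoef_le_one_div hn
    _ = _ := by ring

lemma sawCoef_minus_mul_le {H X : ℝ} (hH : 0 ≤ H) (hX : 0 < X) {d e m n : ℕ} (hd : 1 ≤ d)
    (he : 1 ≤ e) (hm : 1 ≤ m) (hn : 1 ≤ n) :
    |sawCoef H d m| * |sawCoef H e n|
      * min 1 (1 / (|(m : ℝ) / (d : ℝ) ^ 2 - (n : ℝ) / (e : ℝ) ^ 2| * X))
      * |(d : ℝ) / e - Real.sqrt (m / n)|
      ≤ (1 / m * (1 / n)) * (2 * H / X) * (d / e) := by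
  have hn' : (0 : ℝ) < n := by exact_mod_cast hn
  have hm' : (0 : ℝ) < m := by exact_mod_cast hm
  have hd' : (0 : ℝ) < d := by exact_mod_cast hd
  have he' : (0 : ℝ) < e := by exact_mod_cast he
  set ρ := Real.sqrt (m / n) with hρ
  have hρ0 : 0 ≤ ρ := Real.sqrt_nonneg _
  have hρ2 : ρ ^ 2 = m / n := Real.sq_sqrt (by positivity)
  have hm2 : (m : ℝ) = n * ρ ^ 2 := by rw [hρ2]; field_simp
  set l := |(m : ℝ) / (d : ℝ) ^ 2 - (n : ℝ) / (e : ℝ) ^ 2| with hl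
  have hll : n / (d * e) * |(d : ℝ) / e - ρ| ≤ l := by
    have e1 : (m : ℝ) / (d : ℝ) ^ 2 - (n : ℝ) / (e : ℝ) ^ 2
        = (n / (d : ℝ) ^ 2 * (d / e + ρ)) * (-((d : ℝ) / e - ρ)) := by
      rw [hm2]; field_simp; ring
    rw [hl, e1, abs_mul, abs_neg,
      abs_of_nonneg (by positivity : 0 ≤ (n : ℝ) / (d : ℝ) ^ 2 * (d / e + ρ))]
    refine mul_le_mul_of_nonneg_right ?_ (abs_nonneg _)
    calc (n : ℝ) / (d * e) = n / (d : ℝ) ^ 2 * (d / e) := by field_simp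
      _ ≤ _ := by gcongr; linarith
  have hl0 : 0 ≤ l := abs_nonneg _
  have hmin : min 1 (1 / (l * X)) * |(d : ℝ) / e - ρ| ≤ d * e / (n * X) := by
    rcases hl0.eq_or_lt with h | h
    · have : |(d : ℝ) / e - ρ| = 0 := by
        rw [← h] at hll
        have h1 : 0 < (n : ℝ) / (d * e) := by positivity
        have h2 := abs_nonneg ((d : ℝ) / e - ρ)
        nlinarith
      rw [this, mul_zero]; positivity
    · calc _ ≤ (1 / (l * X)) * (l / (n / (d * e))) := by
            gcongr
            · exact min_le_right _ _
            · rw [le_div_iff₀ (by positivity), mul_comm]; exact hll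
        _ = _ := by field_simp
  rw [mul_assoc]
  calc _ ≤ (1 / m) * (2 * H / (e : ℝ) ^ 2) * (d * e / (n * X)) := by
        gcongr
        · exact abs_sawCoef_le_one_div hm
        · exact abs_sawCoef_le hH he hn
    _ = _ := by field_simp

/-- The diagonal contribution to the mean square of `shortTrunc`. -/
noncomputable def diagSum (D N : ℕ) (H : ℝ) : ℝ :=
  ∑ p ∈ Finset.Icc 1 D ×ˢ Finset.Icc 1 N, ∑ q ∈ Finset.Icc 1 D ×ˢ Finset.Icc 1 N,
    if p.2 * q.1 ^ 2 = q.2 * p.1 ^ 2 then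
      ((ArithmeticFunction.moebius p.1 : ℝ) * sawCoef H p.1 p.2) *
        ((ArithmeticFunction.moebius q.1 : ℝ) * sawCoef H q.1 q.2)
    else 0

lemma sum_prod_prod_comm (A B : Finset ℕ) (f : ℕ × ℕ → ℕ × ℕ → ℝ) :
    ∑ p ∈ A ×ˢ B, ∑ q ∈ A ×ˢ B, f p q
      = ∑ m ∈ B, ∑ n ∈ B, ∑ r ∈ A ×ˢ A, f (r.1, m) (r.2, n) := by
  simp_rw [Finset.sum_product]
  rw [Finset.sum_comm]
  refine Finset.sum_congr rfl fun m _ => ?_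
  exact (Finset.sum_congr rfl fun d _ => Finset.sum_comm).trans Finset.sum_comm

lemma sum_minus_le {D N J : ℕ} {H X : ℝ} (hD : 1 ≤ D) (hH : 0 ≤ H) (hX : 0 < X)
    (hJ : 4 * D ^ 2 * (D + N) ≤ J) :
    (∑ p ∈ Finset.Icc 1 D ×ˢ Finset.Icc 1 N, ∑ q ∈ Finset.Icc 1 D ×ˢ Finset.Icc 1 N,
      if p.2 * q.1 ^ 2 = q.2 * p.1 ^ 2 then 0 else |sawCoef H p.1 p.2| * |sawCoef H q.1 q.2| *
        min 1 (1 / (|(p.2 : ℝ) / (p.1 : ℝ) ^ 2 - (q.2 : ℝ) / (q.1 : ℝ) ^ 2| * X)))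
      ≤ harm N ^ 2 * (harm D * (8 * D ^ 2 * (1 / Real.sqrt X)
          + 16 * D ^ 2 * (2 * H / X) * harm J)) := by
  rw [sum_prod_prod_comm]
  have : ∀ m ∈ Finset.Icc 1 N, ∀ n ∈ Finset.Icc 1 N,
      (∑ r ∈ Finset.Icc 1 D ×ˢ Finset.Icc 1 D,
      if m * r.2 ^ 2 = n * r.1 ^ 2 then 0 else |sawCoef H r.1 m| * |sawCoef H r.2 n| *
        min 1 (1 / (|(m : ℝ) / (r.1 : ℝ) ^ 2 - (n : ℝ) / (r.2 : ℝ) ^ 2| * X)))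
      ≤ (1 / m * (1 / n)) * (harm D * (8 * D ^ 2 * (1 / Real.sqrt X)
          + 16 * D ^ 2 * (2 * H / X) * harm J)) := by
    intro m hm n hn
    rw [Finset.mem_Icc] at hm hn
    have hm' : (1 : ℝ) ≤ m := by exact_mod_cast hm.1
    have hn' : (1 : ℝ) ≤ n := by exact_mod_cast hn.1
    rw [Finset.sum_ite, Finset.sum_const_zero, zero_add]
    have key := sum_offdiag_le hD hJ (ρ := Real.sqrt (m / n))
      (P := (1 / m * (1 / n)) * (1 / Real.sqrt X)) (Q := (1 / m * (1 / n)) * (2 * H / X))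
      (by positivity) (by positivity) (Real.sqrt_nonneg _) ?_
      ((Finset.Icc 1 D ×ˢ Finset.Icc 1 D).filter (fun r => ¬ m * r.2 ^ 2 = n * r.1 ^ 2))
      (Finset.filter_subset _ _)
      (fun r => |sawCoef H r.1 m| * |sawCoef H r.2 n| *
        min 1 (1 / (|(m : ℝ) / (r.1 : ℝ) ^ 2 - (n : ℝ) / (r.2 : ℝ) ^ 2| * X))) ?_ ?_
    · refine key.trans (le_of_eq ?_)
      ring
    · rw [Real.sqrt_le_left (by positivity), div_le_iff₀ (by positivity)]
      have : (m : ℝ) ≤ N := by exact_mod_cast hm.2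
      nlinarith [mul_le_mul this this (by positivity) (by positivity)]
    · intro r hr
      simp only [Finset.mem_filter, Finset.mem_product, Finset.mem_Icc] at hr
      exact sawCoef_minus_le_gcd hX hr.1.1.1 hr.1.2.1 hm.1 hn.1 hr.2
    · intro r hr
      simp only [Finset.mem_filter, Finset.mem_product, Finset.mem_Icc] at hr
      exact sawCoef_minus_mul_le hH hX hr.1.1.1 hr.1.2.1 hm.1 hn.1
  refine (Finset.sum_le_sum fun m hm => Finset.sum_le_sum fun n hn => this m hm n hn).trans
    (le_of_eq ?_)
  simp_rw [← Finset.sum_mul, ← Finset.mul_sum]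
  rw [← Finset.sum_mul]
  simp only [harm]
  ring

lemma sum_plus_le {D N : ℕ} {H X : ℝ} (hH : 0 ≤ H) (hX : 0 < X) :
    (∑ p ∈ Finset.Icc 1 D ×ˢ Finset.Icc 1 N, ∑ q ∈ Finset.Icc 1 D ×ˢ Finset.Icc 1 N,
      |sawCoef H p.1 p.2| * |sawCoef H q.1 q.2| *
        (1 / (((p.2 : ℝ) / (p.1 : ℝ) ^ 2 + (q.2 : ℝ) / (q.1 : ℝ) ^ 2) * X)))
      ≤ harm N ^ 2 * (D ^ 2 * (H / X)) := by
  rw [sum_prod_prod_comm]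
  have : ∀ m ∈ Finset.Icc 1 N, ∀ n ∈ Finset.Icc 1 N,
      (∑ r ∈ Finset.Icc 1 D ×ˢ Finset.Icc 1 D, |sawCoef H r.1 m| * |sawCoef H r.2 n| *
        (1 / (((m : ℝ) / (r.1 : ℝ) ^ 2 + (n : ℝ) / (r.2 : ℝ) ^ 2) * X)))
      ≤ (1 / m * (1 / n)) * (D ^ 2 * (H / X)) := by
    intro m hm n hn
    rw [Finset.mem_Icc] at hm hn
    refine (Finset.sum_le_sum (g := fun _ => H / X * (1 / m * (1 / n))) fun r hr => ?_).trans
      (le_of_eq ?_)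
    · simp only [Finset.mem_product, Finset.mem_Icc] at hr
      exact sawCoef_plus_le hH hX hr.1.1 hr.2.1 hm.1 hn.1
    · simp
      ring
  refine (Finset.sum_le_sum fun m hm => Finset.sum_le_sum fun n hn => this m hm n hn).trans
    (le_of_eq ?_)
  simp_rw [← Finset.sum_mul, ← Finset.mul_sum]
  rw [← Finset.sum_mul]
  simp only [harm]
  ring

lemma abs_mean_sq_shortTrunc_sub_le {D N J : ℕ} {H X : ℝ} (hD : 1 ≤ D) (hH : 0 ≤ H) (hX : 0 < X)
    (hJ : 4 * D ^ 2 * (D + N) ≤ J) :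
    |(1 / X) * (∫ x in X..(2 * X), shortTrunc D N H x ^ 2) - (1 / 2) * diagSum D N H|
      ≤ harm N ^ 2 * (harm D * (4 * D ^ 2 * (1 / Real.sqrt X) + 16 * D ^ 2 * (H / X) * harm J))
        + harm N ^ 2 * (D ^ 2 * (H / X)) := by
  simp_rw [shortTrunc_eq]
  have hpos : ∀ p ∈ Finset.Icc 1 D ×ˢ Finset.Icc 1 N, (0 : ℝ) < p.1 ∧ (0 : ℝ) < p.2 := by
    intro p hp
    simp only [Finset.mem_product, Finset.mem_Icc] at hp
    exact ⟨by exact_mod_cast hp.1.1, by exact_mod_cast hp.2.1⟩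
  have h := abs_mean_sq_sum_cos_sub_le (Finset.Icc 1 D ×ˢ Finset.Icc 1 N)
    (fun p => (ArithmeticFunction.moebius p.1 : ℝ) * sawCoef H p.1 p.2)
    (fun p => (p.2 : ℝ) / (p.1 : ℝ) ^ 2) hX (H / 2)
    (fun p q => p.2 * q.1 ^ 2 = q.2 * p.1 ^ 2) ?_ ?_
  · refine h.trans ?_
    have hc : ∀ p : ℕ × ℕ, |(ArithmeticFunction.moebius p.1 : ℝ) * sawCoef H p.1 p.2|
        ≤ |sawCoef H p.1 p.2| := fun p => by
      rw [abs_mul]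
      exact mul_le_of_le_one_left (abs_nonneg _) (abs_moebius_cast_le_one _)
    have h1 := sum_minus_le (N := N) hD hH hX hJ
    have h2 := sum_plus_le (D := D) (N := N) hH hX
    have hN := harm_nonneg N
    have hDD := harm_nonneg D
    have hJJ := harm_nonneg J
    have h3 : 0 ≤ harm N ^ 2 * (D ^ 2 * (H / X)) := by positivity
    calc _ ≤ (1 / 2) * (harm N ^ 2 * (harm D * (8 * D ^ 2 * (1 / Real.sqrt X)
          + 16 * D ^ 2 * (2 * H / X) * harm J))) + (1 / 2) * (harm N ^ 2 * (D ^ 2 * (H / X))) := by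
          gcongr
          · refine le_trans (Finset.sum_le_sum fun p _ => Finset.sum_le_sum fun q _ => ?_) h1
            split_ifs with hpq
            · exact le_rfl
            · refine mul_le_mul_of_nonneg_right (mul_le_mul (hc p) (hc q) (abs_nonneg _)
                (abs_nonneg _)) (le_min zero_le_one (by positivity))
          · refine le_trans (Finset.sum_le_sum fun p hp => Finset.sum_le_sum fun q hq => ?_) h2
            have hp' := hpos p hp
            have hq' := hpos q hq
            have := hp'.1
            have := hp'.2
            have := hq'.1
            have := hq'.2
            exact mul_le_mul_of_nonneg_right (mul_le_mul (hc p) (hc q) (abs_nonneg _)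
                (abs_nonneg _)) (by positivity)
      _ ≤ _ := by
          have e : (1 / 2) * (harm N ^ 2 * (harm D * (8 * D ^ 2 * (1 / Real.sqrt X)
            + 16 * D ^ 2 * (2 * H / X) * harm J))) = harm N ^ 2 * (harm D *
            (4 * D ^ 2 * (1 / Real.sqrt X) + 16 * D ^ 2 * (H / X) * harm J)) := by ring
          rw [e]
          linarith
  · intro p hp q hq
    have hp' := (hpos p hp).1
    have hq' := (hpos q hq).1
    rw [div_eq_div_iff (by positivity) (by positivity)]
    exact_mod_cast Iff.rfl
  · intro p hp
    have h1 := (hpos p hp).1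
    have h2 := (hpos p hp).2
    positivity

lemma abs_sum_sub_sawSq_le (h : ℝ) {M : ℕ} (hM : M ≠ 0) :
    |(∑ n ∈ Finset.Icc 1 M, (1 / Real.pi ^ 2) * ((1 - Real.cos (2 * Real.pi * n * h)) / (n : ℝ) ^ 2))
      - sawSq h| ≤ 1 / M := by
  have hs := hasSum_sawSq h
  set T : ℕ → ℝ := fun n => (1 / Real.pi ^ 2) * ((1 - Real.cos (2 * Real.pi * n * h)) / (n : ℝ) ^ 2)
    with hT
  have hT0 : ∀ n, 0 ≤ T n := fun n => by
    have := Real.cos_le_one (2 * Real.pi * n * h)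
    exact mul_nonneg (by positivity) (div_nonneg (by linarith) (by positivity))
  have hpi := Real.pi_gt_three
  have hT1 : ∀ n, T n ≤ ((n : ℝ) ^ 2)⁻¹ := fun n => by
    have h1 := Real.neg_one_le_cos (2 * Real.pi * n * h)
    calc T n ≤ (1 / Real.pi ^ 2) * (2 / (n : ℝ) ^ 2) := by
          simp only [hT]
          gcongr
          linarith
      _ = (2 / Real.pi ^ 2) * ((n : ℝ) ^ 2)⁻¹ := by ring
      _ ≤ 1 * ((n : ℝ) ^ 2)⁻¹ := by
          gcongr
          rw [div_le_one (by positivity)]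
          nlinarith
      _ = _ := one_mul _
  have hle : sawSq h ≤ (∑ n ∈ Finset.Icc 1 M, T n) + 1 / M := by
    refine le_of_tendsto hs.tendsto_sum_nat ?_
    filter_upwards [Filter.eventually_gt_atTop M] with K hK
    have h1 := sum_Ioc_inv_sq_le_sub (α := ℝ) hM (show M ≤ K - 1 by omega)
    have h2 : ∑ i ∈ Finset.range K, T i
        = ∑ n ∈ Finset.Icc 1 M, T n + ∑ i ∈ Finset.Ioc M (K - 1), T i := by
      rw [show Finset.Icc 1 M = Finset.Ioc 0 M from rfl,
        Finset.sum_Ioc_consecutive _ (Nat.zero_le _) (by omega), Finset.range_eq_Ico,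
        Finset.sum_eq_sum_Ico_succ_bot (by omega)]
      have : T 0 = 0 := by simp [hT]
      rw [this, zero_add]
      refine Finset.sum_congr ?_ fun _ _ => rfl
      ext i; simp; omega
    rw [h2]
    have h3 : ∑ i ∈ Finset.Ioc M (K - 1), T i ≤ ∑ i ∈ Finset.Ioc M (K - 1), ((i : ℝ) ^ 2)⁻¹ :=
      Finset.sum_le_sum fun i _ => hT1 i
    have : (0 : ℝ) ≤ ((K - 1 : ℕ) : ℝ)⁻¹ := by positivity
    rw [one_div]
    linarith
  have hge : ∑ n ∈ Finset.Icc 1 M, T n ≤ sawSq h := sum_le_hasSum _ (fun n _ => hT0 n) hs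
  rw [abs_le]
  constructor
  · linarith
  · have : (0 : ℝ) ≤ 1 / M := by positivity
    linarith

/-- The weight attached to a pair of moduli in the main term. -/
noncomputable def pairWeight (H : ℝ) (d e : ℕ) : ℝ :=
  (Nat.gcd d e : ℝ) ^ 4 / ((d : ℝ) * e) ^ 2 * sawSq (H / (Nat.gcd d e : ℝ) ^ 2)

lemma filter_mul_sq_eq_image {a b N : ℕ} (ha : 1 ≤ a) (hb : 1 ≤ b) (hab : Nat.Coprime a b) :
    (Finset.Icc 1 N ×ˢ Finset.Icc 1 N).filter (fun r => r.1 * b ^ 2 = r.2 * a ^ 2)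
      = (Finset.Icc 1 (N / max a b ^ 2)).image (fun k => (k * a ^ 2, k * b ^ 2)) := by
  have hm : 0 < max a b ^ 2 := Nat.pow_pos (by omega)
  ext ⟨m, n⟩
  simp only [Finset.mem_filter, Finset.mem_product, Finset.mem_Icc, Finset.mem_image, Prod.mk.injEq]
  constructor
  · rintro ⟨⟨⟨hm1, hmN⟩, hn1, hnN⟩, he⟩
    have hdvd : a ^ 2 ∣ m :=
      (Nat.Coprime.pow 2 2 hab).dvd_of_dvd_mul_right (Dvd.intro_left n he.symm)
    obtain ⟨k, rfl⟩ := hdvd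
    have hn : n = b ^ 2 * k := by
      have : a ^ 2 * (b ^ 2 * k) = a ^ 2 * n := by rw [mul_comm _ n, ← he]; ring
      exact (Nat.eq_of_mul_eq_mul_left (by positivity) this).symm
    subst hn
    refine ⟨k, ⟨?_, ?_⟩, mul_comm _ _, mul_comm _ _⟩
    · rcases Nat.eq_zero_or_pos k with h | h
      · subst h; simp at hm1
      · exact h
    · rw [Nat.le_div_iff_mul_le hm]
      rcases max_cases a b with ⟨h, -⟩ | ⟨h, -⟩ <;> rw [h, mul_comm] <;> assumption
  · rintro ⟨k, ⟨hk1, hk⟩, rfl, rfl⟩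
    rw [Nat.le_div_iff_mul_le hm] at hk
    have h1 : k * a ^ 2 ≤ k * max a b ^ 2 := by gcongr; exact le_max_left _ _
    have h2 : k * b ^ 2 ≤ k * max a b ^ 2 := by gcongr; exact le_max_right _ _
    have h3 : 0 < k * a ^ 2 := by positivity
    have h4 : 0 < k * b ^ 2 := by positivity
    refine ⟨⟨⟨h3, h1.trans hk⟩, h4, h2.trans hk⟩, by ring⟩

lemma abs_diag_pair_sub_le {D d e : ℕ} (H : ℝ) (hd : 1 ≤ d) (hdD : d ≤ D) (he : 1 ≤ e)
    (heD : e ≤ D) :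
    |(1 / 2) * (∑ m ∈ Finset.Icc 1 (D ^ 4), ∑ n ∈ Finset.Icc 1 (D ^ 4),
        if m * e ^ 2 = n * d ^ 2 then sawCoef H d m * sawCoef H e n else 0) - pairWeight H d e|
      ≤ 1 / (D : ℝ) ^ 2 := by
  have hD : 1 ≤ D := hd.trans hdD
  obtain ⟨g, a, b, hg, hab, hda, heb⟩ := Nat.exists_coprime' (m := d) (n := e)
    (Nat.gcd_pos_of_pos_left _ hd)
  have hgg : Nat.gcd d e = g := by
    rw [hda, heb, Nat.gcd_mul_right, hab.gcd_eq_one, one_mul]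
  have ha : 1 ≤ a := by
    rcases Nat.eq_zero_or_pos a with h | h
    · subst h; omega
    · exact h
  have hb : 1 ≤ b := by
    rcases Nat.eq_zero_or_pos b with h | h
    · subst h; omega
    · exact h
  have ha' : (0 : ℝ) < a := by exact_mod_cast ha
  have hb' : (0 : ℝ) < b := by exact_mod_cast hb
  have hg' : (0 : ℝ) < g := by exact_mod_cast hg
  have hcond : ∀ m n : ℕ, m * e ^ 2 = n * d ^ 2 ↔ m * b ^ 2 = n * a ^ 2 := by
    intro m n
    rw [hda, heb, mul_pow, mul_pow, ← mul_assoc, ← mul_assoc]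
    exact Nat.mul_left_inj (by positivity)
  set M := D ^ 4 / max a b ^ 2 with hM
  have haD : a ≤ D := by
    have : a * 1 ≤ a * g := Nat.mul_le_mul_left _ hg
    omega
  have hbD : b ≤ D := by
    have : b * 1 ≤ b * g := Nat.mul_le_mul_left _ hg
    omega
  have hMD : D ^ 2 ≤ M := by
    rw [hM, Nat.le_div_iff_mul_le (Nat.pow_pos (by omega))]
    have h1 : max a b ^ 2 ≤ D ^ 2 := Nat.pow_le_pow_left (max_le haD hbD) 2
    calc D ^ 2 * max a b ^ 2 ≤ D ^ 2 * D ^ 2 := Nat.mul_le_mul_left _ h1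
      _ = D ^ 4 := by ring
  have hsum : (1 / 2) * (∑ m ∈ Finset.Icc 1 (D ^ 4), ∑ n ∈ Finset.Icc 1 (D ^ 4),
        if m * e ^ 2 = n * d ^ 2 then sawCoef H d m * sawCoef H e n else 0)
      = 1 / ((a : ℝ) * b) ^ 2 * ∑ k ∈ Finset.Icc 1 M,
        (1 / Real.pi ^ 2) * ((1 - Real.cos (2 * Real.pi * k * (H / (g : ℝ) ^ 2))) / (k : ℝ) ^ 2) := by
    simp_rw [hcond]
    rw [← Finset.sum_product', ← Finset.sum_filter (fun r : ℕ × ℕ => r.1 * b ^ 2 = r.2 * a ^ 2)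
      (fun r => sawCoef H d r.1 * sawCoef H e r.2), filter_mul_sq_eq_image ha hb hab,
      Finset.sum_image, Finset.mul_sum, Finset.mul_sum]
    · refine Finset.sum_congr rfl fun k hk => ?_
      have hk1 : (0 : ℝ) < k := by exact_mod_cast (Finset.mem_Icc.1 hk).1
      rw [sawCoef, sawCoef, hda, heb]
      push_cast
      rw [show Real.pi * (k * (a : ℝ) ^ 2) * H / ((a : ℝ) * g) ^ 2 = Real.pi * k * (H / (g : ℝ) ^ 2) by
          field_simp,
        show Real.pi * (k * (b : ℝ) ^ 2) * H / ((b : ℝ) * g) ^ 2 = Real.pi * k * (H / (g : ℝ) ^ 2) by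
          field_simp,
        show 2 * Real.pi * k * (H / (g : ℝ) ^ 2) = 2 * (Real.pi * k * (H / (g : ℝ) ^ 2)) by ring,
        Real.cos_two_mul, Real.cos_sq']
      field_simp
      ring
    · intro k _ k' _ h
      simp only [Prod.mk.injEq] at h
      exact Nat.eq_of_mul_eq_mul_right (by positivity) h.1
  have hw : pairWeight H d e = 1 / ((a : ℝ) * b) ^ 2 * sawSq (H / (g : ℝ) ^ 2) := by
    rw [pairWeight, hgg, hda, heb]
    push_cast
    congr 1
    field_simp
  have hab1 : 1 / ((a : ℝ) * b) ^ 2 ≤ 1 := by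
    have h1 : (1 : ℝ) ≤ a := by exact_mod_cast ha
    have h2 : (1 : ℝ) ≤ b := by exact_mod_cast hb
    rw [div_le_one (by positivity)]
    exact one_le_pow₀ (by nlinarith)
  have hM0 : M ≠ 0 := by
    have : 0 < D ^ 2 := Nat.pow_pos hD
    omega
  have hDr : (0 : ℝ) < D := by exact_mod_cast hD
  have hMr : (D : ℝ) ^ 2 ≤ M := by exact_mod_cast hMD
  rw [hsum, hw, ← mul_sub, abs_mul, abs_of_pos (by positivity : 0 < 1 / ((a : ℝ) * b) ^ 2)]
  calc _ ≤ 1 * (1 / (M : ℝ)) := by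
        gcongr
        exact abs_sum_sub_sawSq_le _ hM0
    _ ≤ _ := by rw [one_mul]; gcongr

/-- The main term as a sum over pairs of moduli. -/
noncomputable def pairMain (D : ℕ) (H : ℝ) : ℝ :=
  ∑ d ∈ Finset.Icc 1 D, ∑ e ∈ Finset.Icc 1 D,
    (ArithmeticFunction.moebius d : ℝ) * (ArithmeticFunction.moebius e : ℝ) * pairWeight H d e

lemma abs_diagSum_sub_pairMain_le {D : ℕ} (hD : 1 ≤ D) (H : ℝ) :
    |(1 / 2) * diagSum D (D ^ 4) H - pairMain D H| ≤ 1 := by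
  have e1 : (1 / 2) * diagSum D (D ^ 4) H = ∑ d ∈ Finset.Icc 1 D, ∑ e ∈ Finset.Icc 1 D,
      (ArithmeticFunction.moebius d : ℝ) * (ArithmeticFunction.moebius e : ℝ) *
      ((1 / 2) * (∑ m ∈ Finset.Icc 1 (D ^ 4), ∑ n ∈ Finset.Icc 1 (D ^ 4),
        if m * e ^ 2 = n * d ^ 2 then sawCoef H d m * sawCoef H e n else 0)) := by
    rw [diagSum, Finset.sum_product, Finset.mul_sum]
    refine Finset.sum_congr rfl fun d _ => ?_
    simp_rw [Finset.sum_product]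
    rw [Finset.sum_comm, Finset.mul_sum]
    refine Finset.sum_congr rfl fun e _ => ?_
    simp_rw [Finset.mul_sum]
    refine Finset.sum_congr rfl fun m _ => Finset.sum_congr rfl fun n _ => ?_
    split_ifs
    · ring
    · simp
  have hDr : (0 : ℝ) < D := by exact_mod_cast hD
  rw [e1, pairMain, ← Finset.sum_sub_distrib]
  refine (Finset.abs_sum_le_sum_abs _ _).trans ?_
  refine (Finset.sum_le_sum (g := fun _ => (D : ℝ) * (1 / (D : ℝ) ^ 2)) fun d hd => ?_).trans ?_
  · rw [← Finset.sum_sub_distrib]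
    refine (Finset.abs_sum_le_sum_abs _ _).trans ?_
    refine (Finset.sum_le_sum (g := fun _ => (1 / (D : ℝ) ^ 2)) fun e he => ?_).trans (by simp)
    rw [Finset.mem_Icc] at hd he
    rw [← mul_sub, abs_mul, abs_mul]
    have h1 := abs_diag_pair_sub_le H hd.1 hd.2 he.1 he.2
    have h2 : |(ArithmeticFunction.moebius d : ℝ)| * |(ArithmeticFunction.moebius e : ℝ)| ≤ 1 :=
      mul_le_one₀ (abs_moebius_cast_le_one d) (abs_nonneg _) (abs_moebius_cast_le_one e)
    exact (mul_le_of_le_one_left (abs_nonneg _) h2).trans h1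
  · simp
    field_simp
    exact le_refl _

/-- `φ(n)/n` as a product over primes. -/
noncomputable def phiRatio (n : ℕ) : ℝ := ∏ p ∈ n.primeFactors, (1 - 1 / (p : ℝ))

lemma phiRatio_nonneg (n : ℕ) : 0 ≤ phiRatio n := by
  refine Finset.prod_nonneg fun p hp => ?_
  have : (1 : ℝ) ≤ p := by exact_mod_cast (Nat.prime_of_mem_primeFactors hp).one_lt.le
  rw [sub_nonneg, div_le_one (by positivity)]
  exact this

lemma phiRatio_le_one (n : ℕ) : phiRatio n ≤ 1 := by
  refine Finset.prod_le_one (fun p hp => ?_) fun p hp => ?_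
  · have : (1 : ℝ) ≤ p := by exact_mod_cast (Nat.prime_of_mem_primeFactors hp).one_lt.le
    rw [sub_nonneg, div_le_one (by positivity)]
    exact this
  · have : (0 : ℝ) ≤ 1 / (p : ℝ) := by positivity
    linarith

lemma phiRatio_mul {m n : ℕ} (h : Nat.Coprime m n) :
    phiRatio (m * n) = phiRatio m * phiRatio n := by
  rw [phiRatio, h.primeFactors_mul, Finset.prod_union h.disjoint_primeFactors, phiRatio, phiRatio]

/-- `n ↦ 1/n` as an arithmetic function. -/
noncomputable def recipFun : ArithmeticFunction ℝ := ⟨fun k => 1 / (k : ℝ), by simp⟩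

lemma recipFun_apply (n : ℕ) : recipFun n = 1 / (n : ℝ) := rfl

lemma isMultiplicative_recipFun : recipFun.IsMultiplicative := by
  refine ⟨by simp [recipFun_apply], ?_⟩
  intro m n _
  rw [recipFun_apply, recipFun_apply, recipFun_apply, one_div_mul_one_div]
  push_cast
  rfl

lemma sum_moebius_div_eq_phiRatio {n : ℕ} (hn : Squarefree n) :
    ∑ e ∈ n.divisors, (ArithmeticFunction.moebius e : ℝ) / e = phiRatio n := by
  have := isMultiplicative_recipFun.prodPrimeFactors_one_sub_of_squarefree _ hn
  simp only [recipFun_apply] at this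
  rw [phiRatio, this]
  refine Finset.sum_congr rfl fun e _ => ?_
  ring

lemma mul_apply_prime (f g : ArithmeticFunction ℝ) {p : ℕ} (hp : p.Prime) :
    (f * g) p = f p * g 1 + f 1 * g p := by
  rw [ArithmeticFunction.mul_apply, Nat.sum_divisorsAntidiagonal (fun i j => f i * g j),
    hp.sum_divisors, Nat.div_self hp.pos, Nat.div_one]

/-- `n ↦ μ(n) φ(n)/n³`. -/
noncomputable def moebPhi : ArithmeticFunction ℝ :=
  ⟨fun n => (ArithmeticFunction.moebius n : ℝ) * phiRatio n / (n : ℝ) ^ 2, by simp⟩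

/-- `n ↦ μ(n)/n²`. -/
noncomputable def moebSq : ArithmeticFunction ℝ :=
  ⟨fun n => (ArithmeticFunction.moebius n : ℝ) / (n : ℝ) ^ 2, by simp⟩

/-- The indicator function of squarefree integers. -/
noncomputable def sqfInd : ArithmeticFunction ℝ :=
  ⟨fun n => (ArithmeticFunction.moebius n : ℝ) ^ 2, by simp⟩

lemma moebPhi_apply (n : ℕ) :
    moebPhi n = (ArithmeticFunction.moebius n : ℝ) * phiRatio n / (n : ℝ) ^ 2 := rfl

lemma moebSq_apply (n : ℕ) : moebSq n = (ArithmeticFunction.moebius n : ℝ) / (n : ℝ) ^ 2 := rfl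

lemma sqfInd_apply (n : ℕ) : sqfInd n = (ArithmeticFunction.moebius n : ℝ) ^ 2 := rfl

lemma moebius_cast_mul {m n : ℕ} (h : Nat.Coprime m n) :
    (ArithmeticFunction.moebius (m * n) : ℝ)
      = ArithmeticFunction.moebius m * ArithmeticFunction.moebius n := by
  rw [ArithmeticFunction.isMultiplicative_moebius.map_mul_of_coprime h]
  push_cast
  rfl

lemma isMultiplicative_moebPhi : moebPhi.IsMultiplicative := by
  refine ⟨by simp [moebPhi_apply, phiRatio], ?_⟩
  intro m n h
  rw [moebPhi_apply, moebPhi_apply, moebPhi_apply, moebius_cast_mul h, phiRatio_mul h]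
  push_cast
  ring

lemma isMultiplicative_moebSq : moebSq.IsMultiplicative := by
  refine ⟨by simp [moebSq_apply], ?_⟩
  intro m n h
  rw [moebSq_apply, moebSq_apply, moebSq_apply, moebius_cast_mul h]
  push_cast
  ring

lemma isMultiplicative_sqfInd : sqfInd.IsMultiplicative := by
  refine ⟨by simp [sqfInd_apply], ?_⟩
  intro m n h
  rw [sqfInd_apply, sqfInd_apply, sqfInd_apply, moebius_cast_mul h]
  ring

/-- The multiplicative function whose sum is the Euler product in `sqfConst`. -/
noncomputable def eulerFun : ArithmeticFunction ℝ :=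
  sqfInd.pmul (moebPhi * moebPhi * moebSq)

lemma isMultiplicative_eulerFun : eulerFun.IsMultiplicative :=
  isMultiplicative_sqfInd.pmul
    ((isMultiplicative_moebPhi.mul isMultiplicative_moebPhi).mul isMultiplicative_moebSq)

/-- The summand of the triple sum for the singular series. -/
noncomputable def tripleTerm (t : ℕ × ℕ × ℕ) : ℝ :=
  (ArithmeticFunction.moebius (t.1 * t.2.1 * t.2.2) : ℝ) ^ 2 *
    (moebPhi t.1 * moebPhi t.2.1 * moebSq t.2.2)

/-- The box `[1, D]³`. -/
def tripleBox (D : ℕ) : Finset (ℕ × ℕ × ℕ) := Finset.Icc 1 D ×ˢ Finset.Icc 1 D ×ˢ Finset.Icc 1 D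

lemma mem_tripleBox {D : ℕ} {t : ℕ × ℕ × ℕ} : t ∈ tripleBox D ↔
    (1 ≤ t.1 ∧ t.1 ≤ D) ∧ (1 ≤ t.2.1 ∧ t.2.1 ≤ D) ∧ (1 ≤ t.2.2 ∧ t.2.2 ≤ D) := by
  simp [tripleBox, Finset.mem_product]

lemma eulerFun_eq_sum {N n : ℕ} (hn : 1 ≤ n) (hnN : n ≤ N) :
    eulerFun n = ∑ t ∈ (tripleBox N).filter (fun t => t.1 * t.2.1 * t.2.2 = n), tripleTerm t := by
  rw [eulerFun, ArithmeticFunction.pmul_apply, ArithmeticFunction.mul_apply, Finset.mul_sum]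
  simp_rw [ArithmeticFunction.mul_apply, Finset.sum_mul, Finset.mul_sum]
  rw [Finset.sum_sigma']
  refine Finset.sum_bij' (fun u _ => (u.2.1, u.2.2, u.1.2))
    (fun t _ => ⟨(t.1 * t.2.1, t.2.2), (t.1, t.2.1)⟩) ?_ ?_ ?_ ?_ ?_
  · rintro ⟨⟨u, s⟩, ⟨a, b⟩⟩ h
    simp only [Finset.mem_sigma, Nat.mem_divisorsAntidiagonal] at h
    obtain ⟨⟨h1, h2⟩, h3, h4⟩ := h
    subst h3
    subst h1
    simp only [Finset.mem_filter, mem_tripleBox, and_true]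
    have ha : a ≠ 0 := by rintro rfl; simp at h2
    have hb : b ≠ 0 := by rintro rfl; simp at h2
    have hs : s ≠ 0 := by rintro rfl; simp at h2
    refine ⟨⟨by omega, ?_⟩, ⟨by omega, ?_⟩, by omega, ?_⟩
    · exact (Nat.le_of_dvd hn (Dvd.intro (b * s) (by ring))).trans hnN
    · exact (Nat.le_of_dvd hn (Dvd.intro (a * s) (by ring))).trans hnN
    · exact (Nat.le_of_dvd hn (Dvd.intro_left (a * b) rfl)).trans hnN
  · rintro ⟨a, b, s⟩ h
    simp only [Finset.mem_filter, mem_tripleBox] at h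
    obtain ⟨⟨h1, h2, h3⟩, h4⟩ := h
    simp only [Finset.mem_sigma, Nat.mem_divisorsAntidiagonal]
    refine ⟨⟨h4, by omega⟩, by simp, ?_⟩
    have := h1.1
    have := h2.1
    positivity
  · rintro ⟨⟨u, s⟩, ⟨a, b⟩⟩ h
    simp only [Finset.mem_sigma, Nat.mem_divisorsAntidiagonal] at h
    obtain ⟨⟨h1, h2⟩, h3, h4⟩ := h
    subst h3
    rfl
  · rintro ⟨a, b, s⟩ h
    rfl
  · rintro ⟨⟨u, s⟩, ⟨a, b⟩⟩ h
    simp only [Finset.mem_sigma, Nat.mem_divisorsAntidiagonal] at h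
    obtain ⟨⟨h1, h2⟩, h3, h4⟩ := h
    subst h3
    subst h1
    rfl

lemma sum_eulerFun_eq (N : ℕ) :
    ∑ n ∈ Finset.Icc 1 N, eulerFun n
      = ∑ t ∈ (tripleBox N).filter (fun t => t.1 * t.2.1 * t.2.2 ≤ N), tripleTerm t := by
  have hmaps : ∀ t ∈ (tripleBox N).filter (fun t => t.1 * t.2.1 * t.2.2 ≤ N),
      t.1 * t.2.1 * t.2.2 ∈ Finset.Icc 1 N := by
    intro t ht
    rw [Finset.mem_filter, mem_tripleBox] at ht
    rw [Finset.mem_Icc]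
    have := ht.1.1.1
    have := ht.1.2.1.1
    have := ht.1.2.2.1
    have : 0 < t.1 * t.2.1 * t.2.2 := by positivity
    exact ⟨this, ht.2⟩
  rw [← Finset.sum_fiberwise_of_maps_to hmaps]
  refine Finset.sum_congr rfl fun n hn => ?_
  rw [Finset.mem_Icc] at hn
  rw [eulerFun_eq_sum hn.1 hn.2, Finset.filter_filter]
  refine Finset.sum_congr (Finset.filter_congr fun t _ => ?_) fun _ _ => rfl
  constructor
  · intro h; exact ⟨h ▸ hn.2, h⟩
  · exact fun h => h.2

lemma sum_abs_eulerFun_le (N : ℕ) :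
    ∑ n ∈ Finset.Icc 1 N, |eulerFun n| ≤ ∑ t ∈ tripleBox N, |tripleTerm t| := by
  have h1 : ∀ n ∈ Finset.Icc 1 N, |eulerFun n|
      ≤ ∑ t ∈ (tripleBox N).filter (fun t => t.1 * t.2.1 * t.2.2 = n), |tripleTerm t| := by
    intro n hn
    rw [Finset.mem_Icc] at hn
    rw [eulerFun_eq_sum hn.1 hn.2]
    exact Finset.abs_sum_le_sum_abs _ _
  refine (Finset.sum_le_sum h1).trans ?_
  exact Finset.sum_fiberwise_le_sum_of_sum_fiber_nonneg
    fun n _ => Finset.sum_nonneg fun _ _ => abs_nonneg _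

lemma abs_tripleTerm_le (t : ℕ × ℕ × ℕ) : |tripleTerm t| ≤ 1 / ((t.1 : ℝ) * t.2.1 * t.2.2) ^ 2 := by
  have h1 : ∀ n : ℕ, |moebPhi n| ≤ 1 / (n : ℝ) ^ 2 := fun n => by
    rw [moebPhi_apply, abs_div, abs_mul, abs_of_nonneg (phiRatio_nonneg n),
      abs_of_nonneg (by positivity : (0 : ℝ) ≤ (n : ℝ) ^ 2)]
    gcongr
    exact mul_le_one₀ (abs_moebius_cast_le_one n) (phiRatio_nonneg n) (phiRatio_le_one n)
  have h2 : ∀ n : ℕ, |moebSq n| ≤ 1 / (n : ℝ) ^ 2 := fun n => by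
    rw [moebSq_apply, abs_div, abs_of_nonneg (by positivity : (0 : ℝ) ≤ (n : ℝ) ^ 2)]
    gcongr
    exact abs_moebius_cast_le_one n
  rw [tripleTerm, abs_mul, abs_mul, abs_mul, abs_of_nonneg (sq_nonneg _)]
  calc _ ≤ 1 * (1 / (t.1 : ℝ) ^ 2 * (1 / (t.2.1 : ℝ) ^ 2) * (1 / (t.2.2 : ℝ) ^ 2)) := by
        gcongr
        · exact moebius_cast_sq_le_one _
        · exact h1 _
        · exact h1 _
        · exact h2 _
    _ = _ := by rw [one_mul, mul_pow, mul_pow]; simp only [one_div, mul_inv]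

/-- `ζ(3/2)` as a real series. -/
noncomputable def zetaThreeHalves : ℝ := ∑' n : ℕ, 1 / (n : ℝ) ^ (3 / 2 : ℝ)

lemma sum_Icc_le_zetaThreeHalves (N : ℕ) :
    ∑ n ∈ Finset.Icc 1 N, 1 / (n : ℝ) ^ (3 / 2 : ℝ) ≤ zetaThreeHalves :=
  (Real.summable_one_div_nat_rpow.2 (by norm_num)).sum_le_tsum _ fun n _ => by positivity

lemma sum_tripleBox_rpow_le (N : ℕ) :
    ∑ t ∈ tripleBox N, 1 / ((t.1 : ℝ) * t.2.1 * t.2.2) ^ (3 / 2 : ℝ) ≤ zetaThreeHalves ^ 3 := by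
  have e : ∑ t ∈ tripleBox N, 1 / ((t.1 : ℝ) * t.2.1 * t.2.2) ^ (3 / 2 : ℝ)
      = (∑ n ∈ Finset.Icc 1 N, 1 / (n : ℝ) ^ (3 / 2 : ℝ)) ^ 3 := by
    rw [pow_three, Finset.sum_mul_sum, Finset.sum_mul_sum, tripleBox, Finset.sum_product]
    refine Finset.sum_congr rfl fun a _ => ?_
    rw [Finset.sum_product]
    refine Finset.sum_congr rfl fun b _ => ?_
    rw [Finset.mul_sum]
    refine Finset.sum_congr rfl fun s _ => ?_
    rw [Real.mul_rpow (by positivity) (by positivity), Real.mul_rpow (by positivity) (by positivity)]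
    simp only [one_div, mul_inv]
    ring
  rw [e]
  exact pow_le_pow_left₀ (Finset.sum_nonneg fun n _ => by positivity) (sum_Icc_le_zetaThreeHalves N) 3

lemma abs_tripleTerm_le_rpow {N : ℕ} {t : ℕ × ℕ × ℕ} (ht : t ∈ tripleBox N) :
    |tripleTerm t| ≤ 1 / ((t.1 : ℝ) * t.2.1 * t.2.2) ^ (3 / 2 : ℝ) := by
  rw [mem_tripleBox] at ht
  have h1 : (1 : ℝ) ≤ (t.1 * t.2.1 * t.2.2 : ℕ) := by
    have := ht.1.1
    have := ht.2.1.1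
    have := ht.2.2.1
    have : 0 < t.1 * t.2.1 * t.2.2 := by positivity
    exact_mod_cast this
  push_cast at h1
  refine (abs_tripleTerm_le t).trans ?_
  gcongr
  rw [← Real.rpow_natCast]
  exact Real.rpow_le_rpow_of_exponent_le h1 (by norm_num)

lemma summable_abs_eulerFun : Summable fun n => ‖eulerFun n‖ := by
  refine summable_of_sum_range_le (c := zetaThreeHalves ^ 3) (fun n => norm_nonneg _) fun N => ?_
  have h : ∑ n ∈ Finset.range N, ‖eulerFun n‖ ≤ ∑ n ∈ Finset.Icc 1 N, |eulerFun n| := by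
    rw [Finset.sum_congr rfl (fun n _ => Real.norm_eq_abs (eulerFun n))]
    rcases Nat.eq_zero_or_pos N with h | h
    · subst h; simp
    · rw [Finset.range_eq_Ico, Finset.sum_eq_sum_Ico_succ_bot h]
      simp only [ArithmeticFunction.map_zero, abs_zero, zero_add]
      refine Finset.sum_le_sum_of_subset_of_nonneg (fun i hi => ?_) fun _ _ _ => abs_nonneg _
      simp at hi ⊢
      omega
  refine h.trans ((sum_abs_eulerFun_le N).trans ?_)
  exact (Finset.sum_le_sum fun t ht => abs_tripleTerm_le_rpow ht).trans (sum_tripleBox_rpow_le N)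

lemma tsum_eulerFun_eq_tprod : ∑' n, eulerFun n
    = ∏' p : Nat.Primes, (1 - 3 / ((p : ℕ) : ℝ) ^ 2 + 2 / ((p : ℕ) : ℝ) ^ 3) := by
  have h := isMultiplicative_eulerFun.eulerProduct_hasProd summable_abs_eulerFun
  rw [← h.tprod_eq]
  refine tprod_congr fun p => ?_
  have hp := p.2
  have hp0 : ((p : ℕ) : ℝ) ≠ 0 := by exact_mod_cast hp.ne_zero
  rw [tsum_eq_sum (s := Finset.range 2)]
  · rw [Finset.sum_range_succ, Finset.sum_range_one, pow_zero, pow_one,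
      isMultiplicative_eulerFun.map_one, eulerFun, ArithmeticFunction.pmul_apply,
      mul_apply_prime _ _ hp, mul_apply_prime _ _ hp,
      (isMultiplicative_moebPhi.mul isMultiplicative_moebPhi).map_one,
      isMultiplicative_moebPhi.map_one, isMultiplicative_moebSq.map_one,
      moebPhi_apply, moebSq_apply, sqfInd_apply, ArithmeticFunction.moebius_apply_prime hp, phiRatio,
      hp.primeFactors, Finset.prod_singleton]
    push_cast
    field_simp
    ring
  · intro e he
    have he2 : 2 ≤ e := by simp at he; omega
    rw [eulerFun, ArithmeticFunction.pmul_apply, sqfInd_apply,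
      ArithmeticFunction.moebius_eq_zero_of_not_squarefree]
    · simp
    · intro hsq
      have := (Nat.squarefree_pow_iff hp.ne_one (by omega)).1 hsq
      omega

lemma abs_sum_tripleBox_sub_le {D : ℕ} (hD : 1 ≤ D) :
    |∑ t ∈ tripleBox D, tripleTerm t - ∑' n, eulerFun n|
      ≤ zetaThreeHalves ^ 3 / Real.sqrt D := by
  have hDr : (1 : ℝ) ≤ D := by exact_mod_cast hD
  have hs : 0 < Real.sqrt D := Real.sqrt_pos.2 (by linarith)
  have hlim : Filter.Tendsto (fun N => |∑ t ∈ tripleBox D, tripleTerm t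
      - ∑ n ∈ Finset.range N, eulerFun n|) Filter.atTop
      (nhds |∑ t ∈ tripleBox D, tripleTerm t - ∑' n, eulerFun n|) :=
    (tendsto_const_nhds.sub summable_abs_eulerFun.of_norm.hasSum.tendsto_sum_nat).abs
  refine le_of_tendsto hlim ?_
  filter_upwards [Filter.eventually_gt_atTop (D ^ 3)] with K hK
  obtain ⟨N, rfl⟩ : ∃ N, K = N + 1 := ⟨K - 1, by omega⟩
  have hND : D ^ 3 ≤ N := by omega
  have hDN : D ≤ N := (Nat.le_self_pow (by norm_num) D).trans hND
  have e1 : ∑ n ∈ Finset.range (N + 1), eulerFun n = ∑ n ∈ Finset.Icc 1 N, eulerFun n := by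
    rw [Finset.range_eq_Ico, Finset.sum_eq_sum_Ico_succ_bot (by omega)]
    simp only [ArithmeticFunction.map_zero, zero_add]
    rfl
  have hsub : tripleBox D ⊆ (tripleBox N).filter (fun t => t.1 * t.2.1 * t.2.2 ≤ N) := by
    intro t ht
    rw [mem_tripleBox] at ht
    rw [Finset.mem_filter, mem_tripleBox]
    refine ⟨⟨⟨ht.1.1, ht.1.2.trans hDN⟩, ⟨ht.2.1.1, ht.2.1.2.trans hDN⟩,
      ht.2.2.1, ht.2.2.2.trans hDN⟩, le_trans ?_ hND⟩
    calc t.1 * t.2.1 * t.2.2 ≤ D * D * D :=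
          Nat.mul_le_mul (Nat.mul_le_mul ht.1.2 ht.2.1.2) ht.2.2.2
      _ = D ^ 3 := by ring
  rw [e1, sum_eulerFun_eq, ← Finset.sum_sdiff hsub, abs_sub_comm, add_sub_cancel_right]
  refine (Finset.abs_sum_le_sum_abs _ _).trans ?_
  have hb : ∀ t ∈ (tripleBox N).filter (fun t => t.1 * t.2.1 * t.2.2 ≤ N) \ tripleBox D,
      |tripleTerm t| ≤ 1 / ((t.1 : ℝ) * t.2.1 * t.2.2) ^ (3 / 2 : ℝ) * (1 / Real.sqrt D) := by
    intro t ht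
    rw [Finset.mem_sdiff, Finset.mem_filter] at ht
    have ht1 := mem_tripleBox.1 ht.1.1
    have hp : D < t.1 * t.2.1 * t.2.2 := by
      by_contra hcon
      push Not at hcon
      have h0 : 0 < t.1 * t.2.1 * t.2.2 := by
        have := ht1.1.1
        have := ht1.2.1.1
        have := ht1.2.2.1
        positivity
      refine ht.2 (mem_tripleBox.2 ⟨⟨ht1.1.1, ?_⟩, ⟨ht1.2.1.1, ?_⟩, ht1.2.2.1, ?_⟩)
      · exact (Nat.le_of_dvd h0 (Dvd.intro (t.2.1 * t.2.2) (by ring))).trans hcon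
      · exact (Nat.le_of_dvd h0 (Dvd.intro (t.1 * t.2.2) (by ring))).trans hcon
      · exact (Nat.le_of_dvd h0 (Dvd.intro_left (t.1 * t.2.1) rfl)).trans hcon
    have hpr : (D : ℝ) ≤ (t.1 : ℝ) * t.2.1 * t.2.2 := by exact_mod_cast hp.le
    refine (abs_tripleTerm_le t).trans ?_
    set w : ℝ := (t.1 : ℝ) * t.2.1 * t.2.2
    have hw : 0 < w := by linarith
    have e2 : w ^ 2 = w ^ (3 / 2 : ℝ) * Real.sqrt w := by
      rw [Real.sqrt_eq_rpow, ← Real.rpow_add hw, ← Real.rpow_natCast]; norm_num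
    rw [e2, one_div_mul_one_div]
    gcongr
  refine (Finset.sum_le_sum hb).trans ?_
  rw [← Finset.sum_mul, div_eq_mul_one_div (zetaThreeHalves ^ 3)]
  refine mul_le_mul_of_nonneg_right ?_ (by positivity : (0 : ℝ) ≤ 1 / Real.sqrt D)
  refine le_trans (Finset.sum_le_sum_of_subset_of_nonneg
    (Finset.sdiff_subset.trans (Finset.filter_subset _ _)) fun t _ _ => by positivity)
    (sum_tripleBox_rpow_le N)

lemma sum_divisors_moebius_cast (n : ℕ) :
    ∑ e ∈ n.divisors, (ArithmeticFunction.moebius e : ℝ) = if n = 1 then 1 else 0 := by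
  have h := congrArg (fun f : ArithmeticFunction ℤ => f n) ArithmeticFunction.coe_zeta_mul_moebius
  simp only [ArithmeticFunction.coe_zeta_mul_apply, ArithmeticFunction.one_apply] at h
  exact_mod_cast h

lemma sq_dvd_sq_mul_iff {s b a : ℕ} (ha : Squarefree a) (hb : 0 < b) : s ^ 2 ∣ b ^ 2 * a ↔ s ∣ b := by
  constructor
  · intro h
    obtain ⟨g, s', b', hg, hc, hs, hb'⟩ := Nat.exists_coprime' (Nat.gcd_pos_of_pos_right s hb)
    subst hs
    subst hb'
    have hg2 : 0 < g ^ 2 := by positivity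
    have h2 : s' ^ 2 ∣ b' ^ 2 * a := by
      refine Nat.dvd_of_mul_dvd_mul_right hg2 ?_
      convert h using 1 <;> ring
    have h3 : s' ^ 2 ∣ a := (Nat.Coprime.pow 2 2 hc).dvd_of_dvd_mul_left h2
    have h4 : s' = 1 := by
      rw [sq] at h3
      exact Nat.isUnit_iff.1 (ha s' h3)
    subst h4
    simp
  · intro h
    exact (pow_dvd_pow_of_dvd h 2).mul_right a

lemma sum_moebius_sq_dvd {g D : ℕ} (hg : 1 ≤ g) (hgD : g ≤ D) :
    ∑ s ∈ (Finset.Icc 1 D).filter (fun s => s ^ 2 ∣ g), (ArithmeticFunction.moebius s : ℝ)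
      = (ArithmeticFunction.moebius g : ℝ) ^ 2 := by
  obtain ⟨a, b, ha, hb, rfl, hsq⟩ := Nat.sq_mul_squarefree_of_pos hg
  have e : (Finset.Icc 1 D).filter (fun s => s ^ 2 ∣ b ^ 2 * a) = b.divisors := by
    ext s
    rw [Finset.mem_filter, Nat.mem_divisors, sq_dvd_sq_mul_iff hsq hb, Finset.mem_Icc]
    constructor
    · exact fun h => ⟨h.2, hb.ne'⟩
    · intro h
      have h1 : s ≤ b := Nat.le_of_dvd hb h.1
      have h2 : b ≤ b ^ 2 * a := by nlinarith [Nat.mul_le_mul (Nat.mul_le_mul_left b hb) ha]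
      exact ⟨⟨Nat.pos_of_dvd_of_pos h.1 hb, by omega⟩, h.1⟩
  rw [e, sum_divisors_moebius_cast]
  split_ifs with h1
  · subst h1
    rw [one_pow, one_mul]
    have := ArithmeticFunction.moebius_sq_eq_one_of_squarefree hsq
    exact_mod_cast this.symm
  · rw [ArithmeticFunction.moebius_eq_zero_of_not_squarefree]
    · simp
    · intro h
      refine h1 (Nat.isUnit_iff.1 (h b ?_))
      rw [sq]
      exact Dvd.intro a rfl

/-- The indicator of squarefree `g` coprime to `c`, opened by Möbius inversion. -/
lemma moebius_sq_coprime_eq {g c D : ℕ} (hg : 1 ≤ g) (hgD : g ≤ D) (hc : 1 ≤ c) :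
    (if Nat.Coprime g c then (ArithmeticFunction.moebius g : ℝ) ^ 2 else 0)
      = ∑ s ∈ (Finset.Icc 1 D).filter (fun s => Nat.Coprime s c), ∑ e ∈ c.divisors,
          if e * s ^ 2 ∣ g then
            (ArithmeticFunction.moebius s : ℝ) * ArithmeticFunction.moebius e else 0 := by
  have h1 : ∀ s ∈ (Finset.Icc 1 D).filter (fun s => Nat.Coprime s c),
      (∑ e ∈ c.divisors, if e * s ^ 2 ∣ g then
            (ArithmeticFunction.moebius s : ℝ) * ArithmeticFunction.moebius e else 0)
      = if s ^ 2 ∣ g then (ArithmeticFunction.moebius s : ℝ) *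
          (if Nat.Coprime g c then 1 else 0) else 0 := by
    intro s hs
    rw [Finset.mem_filter] at hs
    have hdiv : s ^ 2 ∣ g → c.divisors.filter (fun e => e * s ^ 2 ∣ g) = (Nat.gcd g c).divisors := by
      intro h2
      ext e
      rw [Finset.mem_filter, Nat.mem_divisors, Nat.mem_divisors, Nat.dvd_gcd_iff]
      have hg0 : Nat.gcd g c ≠ 0 := (Nat.gcd_pos_of_pos_left c hg).ne'
      constructor
      · exact fun h => ⟨⟨(Dvd.intro _ rfl).trans h.2, h.1.1⟩, hg0⟩
      · intro h
        refine ⟨⟨h.1.2, by omega⟩, ?_⟩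
        refine Nat.Coprime.mul_dvd_of_dvd_of_dvd ?_ h.1.1 h2
        exact ((hs.2.coprime_dvd_right h.1.2).symm).pow_right 2
    split_ifs with h2 h3
    · rw [← Finset.sum_filter, ← Finset.mul_sum, hdiv h2, sum_divisors_moebius_cast, if_pos h3]
    · rw [← Finset.sum_filter, ← Finset.mul_sum, hdiv h2, sum_divisors_moebius_cast, if_neg h3]
    · refine Finset.sum_eq_zero fun e _ => if_neg fun h => h2 ((Dvd.intro_left e rfl).trans h)
  rw [Finset.sum_congr rfl h1]
  split_ifs with h3
  · rw [← Finset.sum_filter, Finset.filter_filter, ← sum_moebius_sq_dvd hg hgD]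
    simp only [mul_one]
    refine Finset.sum_congr (Finset.filter_congr fun s _ => ?_) fun _ _ => rfl
    constructor
    · intro h
      exact ⟨((h3.coprime_dvd_left h).coprime_dvd_left (dvd_pow_self s two_ne_zero)), h⟩
    · exact fun h => h.2
  · simp

lemma sum_Icc_multiples (f : ℕ → ℝ) (T : ℕ) {k : ℕ} (hk : 1 ≤ k) :
    ∑ g ∈ (Finset.Icc 1 T).filter (fun g => k ∣ g), f g
      = ∑ m ∈ Finset.Icc 1 (T / k), f (k * m) := by
  symm
  refine Finset.sum_bij (fun m _ => k * m) ?_ ?_ ?_ ?_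
  · intro m hm
    rw [Finset.mem_Icc] at hm
    rw [Finset.mem_filter, Finset.mem_Icc]
    refine ⟨⟨Nat.mul_pos hk hm.1, ?_⟩, Dvd.intro m rfl⟩
    rw [mul_comm]
    exact (Nat.le_div_iff_mul_le hk).1 hm.2
  · intro a _ b _ h
    exact Nat.eq_of_mul_eq_mul_left hk h
  · intro g hg
    rw [Finset.mem_filter, Finset.mem_Icc] at hg
    obtain ⟨⟨h1, h2⟩, m, rfl⟩ := hg
    refine ⟨m, ?_, rfl⟩
    rw [Finset.mem_Icc]
    refine ⟨Nat.pos_of_mul_pos_left h1, ?_⟩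
    rw [Nat.le_div_iff_mul_le hk, mul_comm]
    exact h2
  · intros; rfl

lemma sum_moebius_sq_coprime_mul (f : ℕ → ℝ) {T c D : ℕ} (hT : T ≤ D) (hc : 1 ≤ c) :
    ∑ g ∈ Finset.Icc 1 T,
        (if Nat.Coprime g c then (ArithmeticFunction.moebius g : ℝ) ^ 2 else 0) * f g
      = ∑ s ∈ (Finset.Icc 1 D).filter (fun s => Nat.Coprime s c), ∑ e ∈ c.divisors,
          (ArithmeticFunction.moebius s : ℝ) * ArithmeticFunction.moebius e *
            ∑ m ∈ Finset.Icc 1 (T / (e * s ^ 2)), f (e * s ^ 2 * m) := by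
  have h1 : ∀ g ∈ Finset.Icc 1 T,
      (if Nat.Coprime g c then (ArithmeticFunction.moebius g : ℝ) ^ 2 else 0) * f g
      = ∑ s ∈ (Finset.Icc 1 D).filter (fun s => Nat.Coprime s c), ∑ e ∈ c.divisors,
          if e * s ^ 2 ∣ g then
            (ArithmeticFunction.moebius s : ℝ) * ArithmeticFunction.moebius e * f g else 0 := by
    intro g hg
    rw [Finset.mem_Icc] at hg
    rw [moebius_sq_coprime_eq hg.1 (hg.2.trans hT) hc, Finset.sum_mul]
    simp_rw [Finset.sum_mul, ite_mul, zero_mul]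
  rw [Finset.sum_congr rfl h1, Finset.sum_comm]
  refine Finset.sum_congr rfl fun s hs => ?_
  rw [Finset.sum_comm]
  refine Finset.sum_congr rfl fun e he => ?_
  rw [Finset.mem_filter, Finset.mem_Icc] at hs
  have hs0 := hs.1.1
  have he0 := Nat.pos_of_mem_divisors he
  rw [← Finset.sum_filter, ← Finset.mul_sum, sum_Icc_multiples f T (by
    have : 0 < e * s ^ 2 := by positivity
    exact this)]

lemma abs_sum_moebius_sq_coprime_sawSq_sub_le {H : ℝ} (hH : 0 < H) {T c D : ℕ} (hT : T ≤ D)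
    (hc : 1 ≤ c) :
    |∑ g ∈ Finset.Icc 1 T,
        (if Nat.Coprime g c then (ArithmeticFunction.moebius g : ℝ) ^ 2 else 0) *
          sawSq (H / (g : ℝ) ^ 2)
      - Real.sqrt H * sawInt * ∑ s ∈ (Finset.Icc 1 D).filter (fun s => Nat.Coprime s c),
          moebSq s * ∑ e ∈ c.divisors, (ArithmeticFunction.moebius e : ℝ) / e|
      ≤ harm D * (c.divisors.card *
          ((sawInt + 4) * H ^ (3 / 8 : ℝ) + 2 * (H / ((T : ℝ) + 1)))) := by
  have hsI := sawInt_pos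
  rw [sum_moebius_sq_coprime_mul (fun g => sawSq (H / (g : ℝ) ^ 2)) hT hc, Finset.mul_sum,
    ← Finset.sum_sub_distrib]
  simp_rw [Finset.mul_sum]
  simp_rw [← Finset.sum_sub_distrib]
  have key : ∀ s ∈ (Finset.Icc 1 D).filter (fun s => Nat.Coprime s c), ∀ e ∈ c.divisors,
      |∑ m ∈ Finset.Icc 1 (T / (e * s ^ 2)), (ArithmeticFunction.moebius s : ℝ) *
          ArithmeticFunction.moebius e * sawSq (H / ((e * s ^ 2 * m : ℕ) : ℝ) ^ 2)
        - Real.sqrt H * sawInt * (moebSq s * ((ArithmeticFunction.moebius e : ℝ) / e))|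
      ≤ 1 / (s : ℝ) * ((sawInt + 4) * H ^ (3 / 8 : ℝ) + 2 * (H / ((T : ℝ) + 1))) := by
    intro s hs e he
    rw [Finset.mem_filter, Finset.mem_Icc] at hs
    have hs0 := hs.1.1
    have he0 := Nat.pos_of_mem_divisors he
    have hs1 : (1 : ℝ) ≤ s := by exact_mod_cast hs0
    have he1 : (1 : ℝ) ≤ e := by exact_mod_cast he0
    set k : ℕ := e * s ^ 2 with hk
    have hk0 : 0 < k := by positivity
    have hkr : (k : ℝ) = e * (s : ℝ) ^ 2 := by rw [hk]; push_cast; ring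
    have hks : (s : ℝ) ^ 2 ≤ k := by rw [hkr]; nlinarith [sq_nonneg (s : ℝ)]
    have hks1 : (s : ℝ) ≤ k := by nlinarith
    have hkp : (0 : ℝ) < k := by exact_mod_cast hk0
    have hy : 0 < Real.sqrt H / k := by positivity
    have hsaw := abs_sum_sawSq_sub_le hy (T / k)
    have e1 : ∀ m : ℕ, (Real.sqrt H / k) ^ 2 / (m : ℝ) ^ 2 = H / ((k * m : ℕ) : ℝ) ^ 2 := by
      intro m
      rw [div_pow, Real.sq_sqrt hH.le, div_div]
      push_cast
      rw [mul_pow]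
    simp_rw [e1] at hsaw
    rw [← Finset.mul_sum, moebSq_apply]
    have e2 : Real.sqrt H * sawInt * ((ArithmeticFunction.moebius s : ℝ) / (s : ℝ) ^ 2 *
        ((ArithmeticFunction.moebius e : ℝ) / e))
        = (ArithmeticFunction.moebius s : ℝ) * ArithmeticFunction.moebius e *
          (Real.sqrt H / k * sawInt) := by
      rw [hkr]
      field_simp
    rw [e2, ← mul_sub, abs_mul, abs_mul]
    have e3 : (Real.sqrt H / k) ^ (3 / 4 : ℝ) ≤ 1 / (s : ℝ) * H ^ (3 / 8 : ℝ) := by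
      rw [Real.div_rpow (by positivity) (by positivity), Real.sqrt_eq_rpow,
        ← Real.rpow_mul hH.le, show (1 / 2 * (3 / 4) : ℝ) = 3 / 8 by norm_num, div_eq_mul_one_div,
        mul_comm]
      gcongr
      calc (s : ℝ) = (s : ℝ) ^ (1 : ℝ) := (Real.rpow_one _).symm
        _ ≤ (s : ℝ) ^ (2 * (3 / 4) : ℝ) := Real.rpow_le_rpow_of_exponent_le hs1 (by norm_num)
        _ = ((s : ℝ) ^ 2) ^ (3 / 4 : ℝ) := by rw [Real.rpow_mul (by positivity)]; norm_num
        _ ≤ (k : ℝ) ^ (3 / 4 : ℝ) := by gcongr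
    have e4 : (Real.sqrt H / k) ^ 2 / (((T / k : ℕ) : ℝ) + 1) ≤ 1 / (s : ℝ) * (H / ((T : ℝ) + 1)) := by
      rw [div_pow, Real.sq_sqrt hH.le]
      have h1 : T + 1 ≤ k * (T / k + 1) := Nat.lt_mul_div_succ T hk0
      have h2 : (T : ℝ) + 1 ≤ k * (((T / k : ℕ) : ℝ) + 1) := by exact_mod_cast h1
      rw [div_div, one_div_mul_eq_div, div_div]
      refine div_le_div_of_nonneg_left hH.le (by positivity) ?_
      have h3 : (0 : ℝ) ≤ T := by positivity
      calc ((T : ℝ) + 1) * s ≤ (k * (((T / k : ℕ) : ℝ) + 1)) * k := by gcongr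
        _ = _ := by ring
    calc |(ArithmeticFunction.moebius s : ℝ)| * |(ArithmeticFunction.moebius e : ℝ)| * _
        ≤ 1 * 1 * ((sawInt + 4) * (Real.sqrt H / k) ^ (3 / 4 : ℝ)
          + 2 * ((Real.sqrt H / k) ^ 2 / (((T / k : ℕ) : ℝ) + 1))) := by
          gcongr
          · exact abs_moebius_cast_le_one s
          · exact abs_moebius_cast_le_one e
      _ ≤ 1 * 1 * ((sawInt + 4) * (1 / (s : ℝ) * H ^ (3 / 8 : ℝ))
          + 2 * (1 / (s : ℝ) * (H / ((T : ℝ) + 1)))) := by gcongr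
      _ = _ := by ring
  refine (Finset.abs_sum_le_sum_abs _ _).trans ?_
  have hE : 0 ≤ (sawInt + 4) * H ^ (3 / 8 : ℝ) + 2 * (H / ((T : ℝ) + 1)) := by positivity
  calc _ ≤ ∑ s ∈ (Finset.Icc 1 D).filter (fun s => Nat.Coprime s c), ∑ _e ∈ c.divisors,
        1 / (s : ℝ) * ((sawInt + 4) * H ^ (3 / 8 : ℝ) + 2 * (H / ((T : ℝ) + 1))) :=
        Finset.sum_le_sum fun s hs => (Finset.abs_sum_le_sum_abs _ _).trans
          (Finset.sum_le_sum fun e he => key s hs e he)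
    _ ≤ ∑ s ∈ Finset.Icc 1 D, ∑ _e ∈ c.divisors,
        1 / (s : ℝ) * ((sawInt + 4) * H ^ (3 / 8 : ℝ) + 2 * (H / ((T : ℝ) + 1))) :=
        Finset.sum_le_sum_of_subset_of_nonneg (Finset.filter_subset _ _) fun s _ _ =>
          Finset.sum_nonneg fun e _ => mul_nonneg (by positivity) hE
    _ = _ := by
        rw [harm, Finset.sum_mul]
        refine Finset.sum_congr rfl fun s _ => ?_
        rw [Finset.sum_const, nsmul_eq_mul]
        ring

lemma moebius_mul_moebius_eq (a b g : ℕ) :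
    (ArithmeticFunction.moebius (g * a) : ℝ) * ArithmeticFunction.moebius (g * b)
      = (ArithmeticFunction.moebius a : ℝ) * ArithmeticFunction.moebius b *
        (if Nat.Coprime g (a * b) then (ArithmeticFunction.moebius g : ℝ) ^ 2 else 0) := by
  split_ifs with h
  · rw [Nat.coprime_mul_iff_right] at h
    rw [moebius_cast_mul h.1, moebius_cast_mul h.2]
    ring
  · rw [Nat.coprime_mul_iff_right, not_and_or] at h
    rcases h with h | h
    · rw [ArithmeticFunction.moebius_eq_zero_of_not_squarefree (n := g * a)
        (fun hs => h (Nat.squarefree_mul_iff.1 hs).1)]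
      simp
    · rw [ArithmeticFunction.moebius_eq_zero_of_not_squarefree (n := g * b)
        (fun hs => h (Nat.squarefree_mul_iff.1 hs).1)]
      simp

/-- Pairs of coprime integers in `[1, D]`. -/
def coprimePairs (D : ℕ) : Finset (ℕ × ℕ) :=
  (Finset.Icc 1 D ×ˢ Finset.Icc 1 D).filter fun q => Nat.Coprime q.1 q.2

lemma mem_coprimePairs {D : ℕ} {q : ℕ × ℕ} : q ∈ coprimePairs D ↔
    ((1 ≤ q.1 ∧ q.1 ≤ D) ∧ 1 ≤ q.2 ∧ q.2 ≤ D) ∧ Nat.Coprime q.1 q.2 := by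
  simp [coprimePairs, Finset.mem_product]

lemma sum_pairs_eq_sum_coprimePairs (F : ℕ → ℕ → ℝ) (D : ℕ) :
    ∑ d ∈ Finset.Icc 1 D, ∑ e ∈ Finset.Icc 1 D, F d e
      = ∑ q ∈ coprimePairs D, ∑ g ∈ Finset.Icc 1 (D / max q.1 q.2), F (g * q.1) (g * q.2) := by
  rw [← Finset.sum_product', Finset.sum_sigma']
  symm
  refine Finset.sum_bij' (fun u _ => (u.2 * u.1.1, u.2 * u.1.2))
    (fun p _ => ⟨(p.1 / Nat.gcd p.1 p.2, p.2 / Nat.gcd p.1 p.2), Nat.gcd p.1 p.2⟩) ?_ ?_ ?_ ?_ ?_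
  · rintro ⟨⟨a, b⟩, g⟩ h
    simp only [Finset.mem_sigma, mem_coprimePairs, Finset.mem_Icc] at h
    obtain ⟨⟨⟨ha, hb⟩, hc⟩, hg1, hg2⟩ := h
    rw [Nat.le_div_iff_mul_le (by omega)] at hg2
    simp only [Finset.mem_product, Finset.mem_Icc]
    have h1 : g * a ≤ g * max a b := Nat.mul_le_mul_left _ (le_max_left _ _)
    have h2 : g * b ≤ g * max a b := Nat.mul_le_mul_left _ (le_max_right _ _)
    exact ⟨⟨Nat.mul_pos hg1 ha.1, h1.trans hg2⟩, Nat.mul_pos hg1 hb.1, h2.trans hg2⟩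
  · rintro ⟨d, e⟩ h
    simp only [Finset.mem_product, Finset.mem_Icc] at h
    obtain ⟨⟨hd1, hd2⟩, he1, he2⟩ := h
    have hg : 0 < Nat.gcd d e := Nat.gcd_pos_of_pos_left e hd1
    simp only [Finset.mem_sigma, mem_coprimePairs, Finset.mem_Icc]
    refine ⟨⟨⟨⟨Nat.div_pos (Nat.gcd_le_left e hd1) hg, (Nat.div_le_self _ _).trans hd2⟩,
      Nat.div_pos (Nat.gcd_le_right d he1) hg, (Nat.div_le_self _ _).trans he2⟩,
      Nat.coprime_div_gcd_div_gcd hg⟩, hg, ?_⟩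
    rw [Nat.le_div_iff_mul_le (lt_of_lt_of_le (Nat.div_pos (Nat.gcd_le_left e hd1) hg)
      (le_max_left _ _))]
    rcases max_choice (d / Nat.gcd d e) (e / Nat.gcd d e) with h | h <;> rw [h]
    · rw [Nat.mul_div_cancel' (Nat.gcd_dvd_left d e)]
      exact hd2
    · rw [Nat.mul_div_cancel' (Nat.gcd_dvd_right d e)]
      exact he2
  · rintro ⟨⟨a, b⟩, g⟩ h
    simp only [Finset.mem_sigma, mem_coprimePairs, Finset.mem_Icc] at h
    obtain ⟨⟨⟨ha, hb⟩, hc⟩, hg1, hg2⟩ := h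
    have e1 : Nat.gcd (g * a) (g * b) = g := by rw [Nat.gcd_mul_left, hc.gcd_eq_one, mul_one]
    simp only [e1, Nat.mul_div_cancel_left _ (show 0 < g from hg1)]
  · rintro ⟨d, e⟩ h
    simp only [Nat.mul_div_cancel' (Nat.gcd_dvd_left d e), Nat.mul_div_cancel' (Nat.gcd_dvd_right d e)]
  · rintro ⟨⟨a, b⟩, g⟩ h
    rfl

lemma pairWeight_mul_left (H : ℝ) {a b g : ℕ} (hab : Nat.Coprime a b) (hg : 1 ≤ g) :
    pairWeight H (g * a) (g * b) = 1 / ((a : ℝ) * b) ^ 2 * sawSq (H / (g : ℝ) ^ 2) := by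
  have hg0 : (g : ℝ) ≠ 0 := by exact_mod_cast (by omega : g ≠ 0)
  rw [pairWeight, Nat.gcd_mul_left, hab.gcd_eq_one, mul_one]
  congr 1
  push_cast
  rw [show (g : ℝ) * a * (g * b) = (g : ℝ) ^ 2 * (a * b) by ring, mul_pow, ← pow_mul]
  rw [div_mul_eq_div_div, div_self (by positivity)]

lemma pairMain_eq_sum_coprimePairs (D : ℕ) (H : ℝ) :
    pairMain D H = ∑ q ∈ coprimePairs D, moebSq q.1 * moebSq q.2 *
      ∑ g ∈ Finset.Icc 1 (D / max q.1 q.2),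
        (if Nat.Coprime g (q.1 * q.2) then (ArithmeticFunction.moebius g : ℝ) ^ 2 else 0) *
          sawSq (H / (g : ℝ) ^ 2) := by
  rw [pairMain, sum_pairs_eq_sum_coprimePairs (fun d e => (ArithmeticFunction.moebius d : ℝ) *
    ArithmeticFunction.moebius e * pairWeight H d e)]
  refine Finset.sum_congr rfl fun q hq => ?_
  rw [mem_coprimePairs] at hq
  rw [Finset.mul_sum]
  refine Finset.sum_congr rfl fun g hg => ?_
  rw [moebius_mul_moebius_eq, pairWeight_mul_left H hq.2 (Finset.mem_Icc.1 hg).1,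
    moebSq_apply, moebSq_apply, mul_pow]
  simp only [mul_inv, div_eq_mul_inv]
  ring

lemma moebius_cast_pow_three (n : ℕ) :
    (ArithmeticFunction.moebius n : ℝ) ^ 2 * ArithmeticFunction.moebius n
      = ArithmeticFunction.moebius n := by
  rcases ArithmeticFunction.moebius_eq_or n with h | h | h <;> rw [h] <;> norm_num

lemma tripleTerm_of_coprime {a b s : ℕ} (hab : Nat.Coprime a b) (hs : Nat.Coprime s (a * b)) :
    tripleTerm (a, b, s) = moebSq a * moebSq b *
      (moebSq s * ∑ e ∈ (a * b).divisors, (ArithmeticFunction.moebius e : ℝ) / e) := by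
  have h1 : tripleTerm (a, b, s) = moebPhi a * moebPhi b * moebSq s := by
    rw [tripleTerm, moebius_cast_mul hs.symm, moebius_cast_mul hab, moebPhi_apply, moebPhi_apply,
      moebSq_apply]
    rw [← moebius_cast_pow_three a, ← moebius_cast_pow_three b, ← moebius_cast_pow_three s]
    rcases ArithmeticFunction.moebius_eq_or a with h | h | h <;>
    rcases ArithmeticFunction.moebius_eq_or b with h' | h' | h' <;>
    rcases ArithmeticFunction.moebius_eq_or s with h'' | h'' | h'' <;>
    rw [h, h', h''] <;> norm_num
  rw [h1]
  by_cases hsq : Squarefree (a * b)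
  · rw [sum_moebius_div_eq_phiRatio hsq, phiRatio_mul hab, moebPhi_apply, moebPhi_apply,
      moebSq_apply a, moebSq_apply b]
    ring
  · rw [Nat.squarefree_mul hab, not_and_or] at hsq
    rcases hsq with h | h
    · rw [moebPhi_apply a, moebSq_apply a, ArithmeticFunction.moebius_eq_zero_of_not_squarefree h]
      simp
    · rw [moebPhi_apply b, moebSq_apply b, ArithmeticFunction.moebius_eq_zero_of_not_squarefree h]
      simp

lemma tripleTerm_of_not_coprime {a b s : ℕ} (h : ¬ (Nat.Coprime a b ∧ Nat.Coprime s (a * b))) :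
    tripleTerm (a, b, s) = 0 := by
  rw [tripleTerm, ArithmeticFunction.moebius_eq_zero_of_not_squarefree]
  · simp
  · intro hsq
    have h1 := Nat.squarefree_mul_iff.1 hsq
    have h2 := Nat.squarefree_mul_iff.1 h1.2.1
    exact h ⟨h2.1, h1.1.symm⟩

lemma sum_tripleBox_tripleTerm_eq (D : ℕ) :
    ∑ t ∈ tripleBox D, tripleTerm t = ∑ q ∈ coprimePairs D, moebSq q.1 * moebSq q.2 *
      ∑ s ∈ (Finset.Icc 1 D).filter (fun s => Nat.Coprime s (q.1 * q.2)),
        moebSq s * ∑ e ∈ (q.1 * q.2).divisors, (ArithmeticFunction.moebius e : ℝ) / e := by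
  have e1 : ∑ t ∈ tripleBox D, tripleTerm t
      = ∑ q ∈ Finset.Icc 1 D ×ˢ Finset.Icc 1 D, ∑ s ∈ Finset.Icc 1 D, tripleTerm (q.1, q.2, s) := by
    rw [tripleBox, Finset.sum_product, Finset.sum_product]
    refine Finset.sum_congr rfl fun a _ => ?_
    rw [Finset.sum_product]
  rw [e1, coprimePairs, Finset.sum_filter]
  refine Finset.sum_congr rfl fun q _ => ?_
  split_ifs with h
  · rw [Finset.mul_sum, Finset.sum_filter]
    refine Finset.sum_congr rfl fun s _ => ?_
    split_ifs with hs
    · exact tripleTerm_of_coprime h hs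
    · exact tripleTerm_of_not_coprime fun hh => hs hh.2
  · exact Finset.sum_eq_zero fun s _ => tripleTerm_of_not_coprime fun hh => h hh.1

lemma sum_card_divisors_div_le (D : ℕ) :
    ∑ a ∈ Finset.Icc 1 D, (a.divisors.card : ℝ) / a ≤ harm D ^ 2 := by
  have h1 : ∀ a ∈ Finset.Icc 1 D, (a.divisors.card : ℝ) / a
      = ∑ u ∈ Finset.Icc 1 D, if u ∣ a then 1 / (a : ℝ) else 0 := by
    intro a ha
    rw [Finset.mem_Icc] at ha
    rw [← Finset.sum_filter, Finset.sum_const, nsmul_eq_mul, mul_one_div]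
    congr 3
    ext u
    rw [Nat.mem_divisors, Finset.mem_filter, Finset.mem_Icc]
    constructor
    · exact fun h => ⟨⟨Nat.pos_of_dvd_of_pos h.1 ha.1, (Nat.le_of_dvd ha.1 h.1).trans ha.2⟩, h.1⟩
    · exact fun h => ⟨h.2, by omega⟩
  rw [Finset.sum_congr rfl h1, Finset.sum_comm, sq, harm, Finset.sum_mul]
  refine Finset.sum_le_sum fun u hu => ?_
  rw [← Finset.sum_filter, sum_Icc_multiples (fun a => 1 / (a : ℝ)) D (Finset.mem_Icc.1 hu).1,
    Finset.mul_sum]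
  refine le_trans (le_of_eq ?_) (Finset.sum_le_sum_of_subset_of_nonneg
    (Finset.Icc_subset_Icc_right (Nat.div_le_self D u)) fun m _ _ => by positivity)
  refine Finset.sum_congr rfl fun m _ => ?_
  push_cast
  rw [one_div_mul_one_div]

lemma abs_pairMain_sub_le {D : ℕ} {H : ℝ} (hH : 0 < H) :
    |pairMain D H - Real.sqrt H * sawInt * ∑ t ∈ tripleBox D, tripleTerm t|
      ≤ harm D ^ 5 * ((sawInt + 4) * H ^ (3 / 8 : ℝ) + 2 * (H / D)) := by
  have hsI := sawInt_pos
  have hhD := harm_nonneg D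
  have hE : 0 ≤ (sawInt + 4) * H ^ (3 / 8 : ℝ) + 2 * (H / (D : ℝ)) := by positivity
  rw [pairMain_eq_sum_coprimePairs, sum_tripleBox_tripleTerm_eq, Finset.mul_sum,
    ← Finset.sum_sub_distrib]
  have key : ∀ q ∈ coprimePairs D, |moebSq q.1 * moebSq q.2 *
      (∑ g ∈ Finset.Icc 1 (D / max q.1 q.2),
        (if Nat.Coprime g (q.1 * q.2) then (ArithmeticFunction.moebius g : ℝ) ^ 2 else 0) *
          sawSq (H / (g : ℝ) ^ 2)) - Real.sqrt H * sawInt * (moebSq q.1 * moebSq q.2 *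
      ∑ s ∈ (Finset.Icc 1 D).filter (fun s => Nat.Coprime s (q.1 * q.2)),
        moebSq s * ∑ e ∈ (q.1 * q.2).divisors, (ArithmeticFunction.moebius e : ℝ) / e)|
      ≤ harm D * ((sawInt + 4) * H ^ (3 / 8 : ℝ) + 2 * (H / (D : ℝ))) *
        ((q.1.divisors.card : ℝ) / q.1 * ((q.2.divisors.card : ℝ) / q.2)) := by
    rintro ⟨a, b⟩ hq
    rw [mem_coprimePairs] at hq
    obtain ⟨⟨⟨ha1, ha2⟩, hb1, hb2⟩, hc⟩ := hq
    simp only at *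
    have har : (1 : ℝ) ≤ a := by exact_mod_cast ha1
    have hbr : (1 : ℝ) ≤ b := by exact_mod_cast hb1
    have hDr : (1 : ℝ) ≤ D := by exact_mod_cast ha1.trans ha2
    have hmain := abs_sum_moebius_sq_coprime_sawSq_sub_le hH (T := D / max a b) (c := a * b)
      (D := D) (Nat.div_le_self _ _) (Nat.mul_pos ha1 hb1)
    rw [hc.card_divisors_mul] at hmain
    have hm : ∀ n : ℕ, |moebSq n| ≤ 1 / (n : ℝ) ^ 2 := fun n => by
      rw [moebSq_apply, abs_div, abs_of_nonneg (by positivity : (0 : ℝ) ≤ (n : ℝ) ^ 2)]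
      gcongr
      exact abs_moebius_cast_le_one n
    have hT : H / (((D / max a b : ℕ) : ℝ) + 1) ≤ a * b * (H / D) := by
      have h1 : D + 1 ≤ max a b * (D / max a b + 1) :=
        Nat.lt_mul_div_succ D (lt_of_lt_of_le ha1 (le_max_left _ _))
      have h2 : max a b ≤ a * b := max_le (Nat.le_mul_of_pos_right a hb1)
        (Nat.le_mul_of_pos_left b ha1)
      have h3 : D ≤ a * b * (D / max a b + 1) :=
        (Nat.le_succ D).trans (h1.trans (Nat.mul_le_mul_right _ h2))
      have h4 : (D : ℝ) ≤ a * b * (((D / max a b : ℕ) : ℝ) + 1) := by exact_mod_cast h3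
      rw [div_le_iff₀ (by positivity)]
      calc H = H / D * D := by field_simp
        _ ≤ H / D * (a * b * (((D / max a b : ℕ) : ℝ) + 1)) := by gcongr
        _ = _ := by ring
    rw [show ∀ u v w x : ℝ, u * v - w * (u * x) = u * (v - w * x) from fun u v w x => by ring,
      abs_mul, abs_mul]
    have hab1 : (1 : ℝ) ≤ a * b := one_le_mul_of_one_le_of_one_le har hbr
    calc _ ≤ 1 / (a : ℝ) ^ 2 * (1 / (b : ℝ) ^ 2) * (harm D *
          (((a.divisors.card * b.divisors.card : ℕ) : ℝ) *
            ((sawInt + 4) * H ^ (3 / 8 : ℝ)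
              + 2 * (H / (((D / max a b : ℕ) : ℝ) + 1))))) := by
          gcongr
          · exact hm a
          · exact hm b
      _ ≤ 1 / (a : ℝ) ^ 2 * (1 / (b : ℝ) ^ 2) * (harm D *
          (((a.divisors.card * b.divisors.card : ℕ) : ℝ) *
            (a * b * ((sawInt + 4) * H ^ (3 / 8 : ℝ)) + 2 * (a * b * (H / D))))) := by
          gcongr 1 / (a : ℝ) ^ 2 * (1 / (b : ℝ) ^ 2) * (harm D *
            (((a.divisors.card * b.divisors.card : ℕ) : ℝ) * (?_ + 2 * ?_)))
          exact le_mul_of_one_le_left (by positivity) hab1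
      _ = _ := by
          push_cast
          field_simp
  refine (Finset.abs_sum_le_sum_abs _ _).trans ((Finset.sum_le_sum key).trans ?_)
  rw [← Finset.mul_sum]
  have h2 : ∑ q ∈ coprimePairs D, (q.1.divisors.card : ℝ) / q.1 * ((q.2.divisors.card : ℝ) / q.2)
      ≤ harm D ^ 2 * harm D ^ 2 := by
    refine (Finset.sum_le_sum_of_subset_of_nonneg (Finset.filter_subset _ _)
      fun q _ _ => by positivity).trans ?_
    rw [Finset.sum_product]
    refine (Finset.sum_mul_sum (Finset.Icc 1 D) (Finset.Icc 1 D)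
      (fun a : ℕ => (a.divisors.card : ℝ) / a) fun b : ℕ => (b.divisors.card : ℝ) / b).ge.trans ?_
    exact mul_le_mul (sum_card_divisors_div_le D) (sum_card_divisors_div_le D)
      (Finset.sum_nonneg fun _ _ => by positivity) (by positivity)
  calc _ ≤ harm D * ((sawInt + 4) * H ^ (3 / 8 : ℝ) + 2 * (H / (D : ℝ)))
        * (harm D ^ 2 * harm D ^ 2) := mul_le_mul_of_nonneg_left h2 (mul_nonneg hhD hE)
    _ = _ := by ring

/-- Asymptotics for the diagonal contribution. -/
lemma abs_pairMain_sub_sqfConst_le {D : ℕ} {H : ℝ} (hD : 1 ≤ D) (hH : 0 < H) :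
    |pairMain D H - sqfConst * Real.sqrt H|
      ≤ harm D ^ 5 * ((sawInt + 4) * H ^ (3 / 8 : ℝ) + 2 * (H / D))
        + Real.sqrt H * sawInt * (zetaThreeHalves ^ 3 / Real.sqrt D) := by
  have e : sqfConst * Real.sqrt H = Real.sqrt H * sawInt * ∑' n, eulerFun n := by
    rw [sqfConst, ← sawInt_eq, tsum_eulerFun_eq_tprod]
    ring
  have h1 := abs_pairMain_sub_le (D := D) hH
  have h2 := abs_sum_tripleBox_sub_le hD
  have h3 : |Real.sqrt H * sawInt * ∑ t ∈ tripleBox D, tripleTerm t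
      - Real.sqrt H * sawInt * ∑' n, eulerFun n|
      ≤ Real.sqrt H * sawInt * (zetaThreeHalves ^ 3 / Real.sqrt D) := by
    have := sawInt_pos
    rw [← mul_sub, abs_mul, abs_of_nonneg (by positivity)]
    gcongr
  rw [e]
  exact (abs_sub_le _ _ _).trans (add_le_add h1 h3)

lemma abs_mean_sq_shortErr_sub_le {D : ℕ} {H X : ℝ} (hD : 1 ≤ D) (hH : 0 < H) (hX : 0 < X)
    (hDX : (D : ℝ) ^ 2 ≤ X) {h : ℝ} (hh : harm (8 * D ^ 6) ≤ h) :
    |(1 / X) * (∫ x in X..(2 * X), shortErr D H x ^ 2) - sqfConst * Real.sqrt H|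
      ≤ h ^ 5 * (18 + 4 * ((D : ℝ) ^ 2 / Real.sqrt X) + 17 * ((D : ℝ) ^ 2 * H / X)
        + (sawInt + 4) * H ^ (3 / 8 : ℝ) + 2 * (H / D)
        + sawInt * zetaThreeHalves ^ 3 * (Real.sqrt H / Real.sqrt D)) := by
  have hsI := sawInt_pos
  have hz0 : 0 ≤ zetaThreeHalves := tsum_nonneg fun n => by positivity
  have hDr : (1 : ℝ) ≤ D := by exact_mod_cast hD
  have hN : D ^ 4 ≤ 8 * D ^ 6 := by
    have := Nat.pow_le_pow_right hD (show 4 ≤ 6 by norm_num)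
    omega
  have hDJ : D ≤ 8 * D ^ 6 := by
    have := Nat.pow_le_pow_right hD (show 1 ≤ 6 by norm_num)
    rw [pow_one] at this
    omega
  have hJ : 4 * D ^ 2 * (D + D ^ 4) ≤ 8 * D ^ 6 := by
    have := Nat.pow_le_pow_right hD (show 3 ≤ 6 by norm_num)
    nlinarith
  have h1 : 1 ≤ h := (one_le_harm (by omega)).trans hh
  have hhD : harm D ≤ h := (harm_mono hDJ).trans hh
  have hhN : harm (D ^ 4) ≤ h := (harm_mono hN).trans hh
  have hh0 := harm_nonneg D
  have hh1 := harm_nonneg (D ^ 4)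
  have hh2 := harm_nonneg (8 * D ^ 6)
  have b1 : |(1 / X) * (∫ x in X..(2 * X), shortErr D H x ^ 2)
      - (1 / X) * ∫ x in X..(2 * X), shortTrunc D (D ^ 4) H x ^ 2| ≤ 17 := by
    rw [← mul_sub, abs_mul, abs_of_nonneg (by positivity)]
    calc _ ≤ 1 / X * (17 * X) := by
          gcongr
          exact abs_integral_shortErr_sq_sub_le hD hDX le_rfl
      _ = 17 := by field_simp
  have b2 := abs_mean_sq_shortTrunc_sub_le (N := D ^ 4) hD hH.le hX hJ
  have b3 := abs_diagSum_sub_pairMain_le hD H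
  have b4 := abs_pairMain_sub_sqfConst_le hD hH
  have p1 : h ≤ h ^ 5 := le_self_pow₀ h1 (by norm_num)
  have p0 : 1 ≤ h ^ 5 := one_le_pow₀ h1
  have p2 : h ^ 2 ≤ h ^ 5 := pow_le_pow_right₀ h1 (by norm_num)
  have p3 : h ^ 3 ≤ h ^ 5 := pow_le_pow_right₀ h1 (by norm_num)
  have p4 : h ^ 4 ≤ h ^ 5 := pow_le_pow_right₀ h1 (by norm_num)
  have b2' : harm (D ^ 4) ^ 2 * (harm D * (4 * (D : ℝ) ^ 2 * (1 / Real.sqrt X)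
      + 16 * (D : ℝ) ^ 2 * (H / X) * harm (8 * D ^ 6)))
      + harm (D ^ 4) ^ 2 * ((D : ℝ) ^ 2 * (H / X))
      ≤ h ^ 5 * (4 * ((D : ℝ) ^ 2 / Real.sqrt X) + 17 * ((D : ℝ) ^ 2 * H / X)) := by
    calc _ ≤ h ^ 2 * (h * (4 * (D : ℝ) ^ 2 * (1 / Real.sqrt X)
          + 16 * (D : ℝ) ^ 2 * (H / X) * h)) + h ^ 2 * ((D : ℝ) ^ 2 * (H / X)) := by gcongr
      _ = h ^ 3 * (4 * ((D : ℝ) ^ 2 / Real.sqrt X)) + h ^ 4 * (16 * ((D : ℝ) ^ 2 * H / X))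
          + h ^ 2 * ((D : ℝ) ^ 2 * H / X) := by ring
      _ ≤ h ^ 5 * (4 * ((D : ℝ) ^ 2 / Real.sqrt X)) + h ^ 5 * (16 * ((D : ℝ) ^ 2 * H / X))
          + h ^ 5 * ((D : ℝ) ^ 2 * H / X) := by gcongr
      _ = _ := by ring
  have b4' : harm D ^ 5 * ((sawInt + 4) * H ^ (3 / 8 : ℝ) + 2 * (H / D))
        + Real.sqrt H * sawInt * (zetaThreeHalves ^ 3 / Real.sqrt D)
      ≤ h ^ 5 * ((sawInt + 4) * H ^ (3 / 8 : ℝ) + 2 * (H / D))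
        + h ^ 5 * (sawInt * zetaThreeHalves ^ 3 * (Real.sqrt H / Real.sqrt D)) := by
    have : Real.sqrt H * sawInt * (zetaThreeHalves ^ 3 / Real.sqrt D)
        = 1 * (sawInt * zetaThreeHalves ^ 3 * (Real.sqrt H / Real.sqrt D)) := by ring
    rw [this]
    gcongr
  have b := (abs_sub_le _ _ _).trans (add_le_add b1 ((abs_sub_le _ _ _).trans (add_le_add
    (b2.trans b2') ((abs_sub_le _ _ _).trans (add_le_add b3 (b4.trans b4'))))))
  refine b.trans ?_
  have p18 : (17 : ℝ) + 1 ≤ h ^ 5 * 18 := by linarith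
  have e : h ^ 5 * (18 + 4 * ((D : ℝ) ^ 2 / Real.sqrt X) + 17 * ((D : ℝ) ^ 2 * H / X)
        + (sawInt + 4) * H ^ (3 / 8 : ℝ) + 2 * (H / D)
        + sawInt * zetaThreeHalves ^ 3 * (Real.sqrt H / Real.sqrt D))
      = h ^ 5 * 18 + h ^ 5 * (4 * ((D : ℝ) ^ 2 / Real.sqrt X) + 17 * ((D : ℝ) ^ 2 * H / X))
        + (h ^ 5 * ((sawInt + 4) * H ^ (3 / 8 : ℝ) + 2 * (H / D))
        + h ^ 5 * (sawInt * zetaThreeHalves ^ 3 * (Real.sqrt H / Real.sqrt D))) := by ring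
  rw [e]
  linarith only [p18]

lemma one_add_log_le_of_rpow_le {ε X H : ℝ} (hε : 0 < ε) (hX : 1 ≤ X) (hH : X ^ ε ≤ H) :
    1 + Real.log X ≤ (1 + 50 / ε ^ 2) * H ^ (ε / 50) := by
  have hH1 : 1 ≤ H := (Real.one_le_rpow hX hε.le).trans hH
  have h1 : 1 ≤ H ^ (ε / 50) := Real.one_le_rpow hH1 (by positivity)
  have h2 : Real.log X ≤ X ^ (ε ^ 2 / 50) / (ε ^ 2 / 50) :=
    Real.log_le_rpow_div (by linarith) (by positivity)
  have h3 : X ^ (ε ^ 2 / 50) ≤ H ^ (ε / 50) := by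
    rw [show ε ^ 2 / 50 = ε * (ε / 50) by ring, Real.rpow_mul (by linarith)]
    gcongr
  calc 1 + Real.log X ≤ H ^ (ε / 50) + H ^ (ε / 50) / (ε ^ 2 / 50) := by
        refine add_le_add h1 (h2.trans ?_)
        gcongr
    _ = _ := by field_simp

lemma harm_le_of_sq_le {D : ℕ} {X : ℝ} (hD : 1 ≤ D) (hX : 1 ≤ X) (hDX : (D : ℝ) ^ 2 ≤ X) :
    harm (8 * D ^ 6) ≤ 4 * (1 + Real.log X) := by
  have hDr : (1 : ℝ) ≤ D := by exact_mod_cast hD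
  have hl := Real.log_nonneg hX
  have h1 := harm_le (8 * D ^ 6)
  have h2 : Real.log ((8 * D ^ 6 : ℕ) : ℝ) ≤ 3 + 3 * Real.log X := by
    push_cast
    rw [Real.log_mul (by norm_num) (by positivity), show (D : ℝ) ^ 6 = ((D : ℝ) ^ 2) ^ 3 by ring,
      Real.log_pow, show (8 : ℝ) = 2 ^ 3 by norm_num, Real.log_pow]
    have := Real.log_two_lt_d9
    have := Real.log_le_log (by positivity) hDX
    push_cast
    linarith
  linarith

lemma sum_error_terms_le {D : ℕ} {ε X H z : ℝ} (hε : ε ∈ Set.Ioo (0 : ℝ) (1 / 100)) (hX : 1 ≤ X)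
    (hH : 1 ≤ H) (hz : H ^ (1 + ε) ≤ z) (hz1 : z ≤ X / H ^ ((1 : ℝ) / 2 + ε))
    (hz2 : z ≤ H ^ ((1 : ℝ) / 2 - ε) * X ^ ((1 : ℝ) / 2)) (hD : 1 ≤ D) (hDz : (D : ℝ) ^ 2 ≤ z)
    (hzD : Real.sqrt z ≤ 2 * D) {c : ℝ} (hc : 0 ≤ c) :
    18 + 4 * ((D : ℝ) ^ 2 / Real.sqrt X) + 17 * ((D : ℝ) ^ 2 * H / X)
        + (sawInt + 4) * H ^ (3 / 8 : ℝ) + 2 * (H / D) + c * (Real.sqrt H / Real.sqrt D)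
      ≤ (47 + sawInt + 3 * c) * H ^ ((1 : ℝ) / 2 - ε / 5) := by
  obtain ⟨hε0, hε1⟩ := hε
  have hsI := sawInt_pos
  have hDr : (1 : ℝ) ≤ D := by exact_mod_cast hD
  have hH0 : 0 < H := by linarith
  have hX0 : 0 < X := by linarith
  set B := H ^ ((1 : ℝ) / 2 - ε / 5) with hB
  have hB1 : 1 ≤ B := Real.one_le_rpow hH (by linarith)
  have mono : ∀ t : ℝ, t ≤ 1 / 2 - ε / 5 → H ^ t ≤ B := fun t ht =>
    Real.rpow_le_rpow_of_exponent_le hH ht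
  have t1 : (D : ℝ) ^ 2 / Real.sqrt X ≤ B := by
    refine le_trans ?_ (mono (1 / 2 - ε) (by linarith))
    rw [div_le_iff₀ (by positivity), Real.sqrt_eq_rpow]
    exact hDz.trans hz2
  have t2 : (D : ℝ) ^ 2 * H / X ≤ B := by
    refine le_trans ?_ (mono (1 / 2 - ε) (by linarith))
    rw [div_le_iff₀ hX0]
    have e : H ^ ((1 : ℝ) / 2 - ε) * H ^ ((1 : ℝ) / 2 + ε) = H := by
      rw [← Real.rpow_add hH0]; norm_num
    have h1 := hDz.trans hz1
    rw [le_div_iff₀ (by positivity)] at h1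
    calc (D : ℝ) ^ 2 * H = H ^ ((1 : ℝ) / 2 - ε) * ((D : ℝ) ^ 2 * H ^ ((1 : ℝ) / 2 + ε)) := by
          nth_rewrite 1 [← e]; ring
      _ ≤ H ^ ((1 : ℝ) / 2 - ε) * X := by gcongr
  have t3 : H ^ (3 / 8 : ℝ) ≤ B := mono _ (by linarith)
  have t4 : H / D ≤ 2 * B := by
    have h1 : H ^ (1 / 2 + ε / 2) ≤ 2 * D := by
      refine le_trans ?_ hzD
      rw [show (1 / 2 + ε / 2 : ℝ) = (1 + ε) * (1 / 2) by ring, Real.rpow_mul hH0.le,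
        ← Real.sqrt_eq_rpow]
      exact Real.sqrt_le_sqrt hz
    rw [div_le_iff₀ (by linarith)]
    have e : H ^ ((1 : ℝ) / 2 - ε / 2) * H ^ ((1 : ℝ) / 2 + ε / 2) = H := by
      rw [← Real.rpow_add hH0]; norm_num
    calc H = H ^ ((1 : ℝ) / 2 - ε / 2) * H ^ ((1 : ℝ) / 2 + ε / 2) := e.symm
      _ ≤ B * (2 * D) := by
          gcongr
          exact mono _ (by linarith)
      _ = _ := by ring
  have t5 : Real.sqrt H / Real.sqrt D ≤ 3 * B := by
    rw [← Real.sqrt_div hH0.le]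
    have h0 : 0 ≤ H / D := by positivity
    have h1 : Real.sqrt (H / D) ≤ 1 + H / D := by
      rw [Real.sqrt_le_left (by positivity)]
      nlinarith
    linarith
  have u3 := mul_le_mul_of_nonneg_left t3 (by linarith : 0 ≤ sawInt + 4)
  have u5 := mul_le_mul_of_nonneg_left t5 hc
  linarith

theorem small_divisors_variance :
    ∀ ε : ℝ, ε ∈ Set.Ioo (0 : ℝ) (1 / 100) →
      ∃ K : ℝ, 0 < K ∧
        ∀ X H z : ℝ, 1 ≤ X → X ^ ε ≤ H → H ≤ X ^ ((2 : ℝ) / 3 - ε) →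
          H ^ (1 + ε) ≤ z →
          z ≤ min (X / H ^ ((1 : ℝ) / 2 + ε)) (H ^ ((1 : ℝ) / 2 - ε) * X ^ ((1 : ℝ) / 2)) →
            |(1 / X) * (∫ x in X..(2 * X), |pairShortLE x H z - H * mertensTrunc z| ^ 2)
                - sqfConst * Real.sqrt H| ≤ K * H ^ ((1 : ℝ) / 2 - ε / 10) := by
  intro ε hε
  have hε0 := hε.1
  have hsI := sawInt_pos
  have hz0 : 0 ≤ zetaThreeHalves := tsum_nonneg fun n => by positivity
  refine ⟨(4 * (1 + 50 / ε ^ 2)) ^ 5 * (47 + sawInt + 3 * (sawInt * zetaThreeHalves ^ 3)),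
    by positivity, ?_⟩
  intro X H z hX hXH _ hz hzmin
  obtain ⟨hz1, hz2⟩ := le_min_iff.1 hzmin
  have hH : 1 ≤ H := (Real.one_le_rpow hX hε0.le).trans hXH
  have hH0 : 0 < H := by linarith
  have hX0 : 0 < X := by linarith
  have h1z : 1 ≤ z := (Real.one_le_rpow hH (by linarith)).trans hz
  set D := ⌊Real.sqrt z⌋₊ with hDdef
  have hD : 1 ≤ D := Nat.le_floor (by simpa using Real.one_le_sqrt.2 h1z)
  have hDr : (1 : ℝ) ≤ D := by exact_mod_cast hD
  have hDz : (D : ℝ) ^ 2 ≤ z := by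
    have h1 : (D : ℝ) ≤ Real.sqrt z := Nat.floor_le (Real.sqrt_nonneg z)
    calc (D : ℝ) ^ 2 ≤ Real.sqrt z ^ 2 := by gcongr
      _ = z := Real.sq_sqrt (by linarith)
  have hzD : Real.sqrt z ≤ 2 * D := by
    have := Nat.lt_floor_add_one (Real.sqrt z)
    rw [← hDdef] at this
    linarith
  have hDX : (D : ℝ) ^ 2 ≤ X := by
    refine hDz.trans (hz1.trans (div_le_self hX0.le ?_))
    exact Real.one_le_rpow hH (by linarith)
  have hint : ∫ x in X..(2 * X), |pairShortLE x H z - H * mertensTrunc z| ^ 2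
      = ∫ x in X..(2 * X), shortErr D H x ^ 2 := by
    refine intervalIntegral.integral_congr fun x hx => ?_
    rw [Set.uIcc_of_le (by linarith)] at hx
    rw [sq_abs, pairShortLE_sub_eq_shortErr (by linarith [hx.1]) hH0.le]
  rw [hint]
  have hL : harm (8 * D ^ 6) ≤ 4 * ((1 + 50 / ε ^ 2) * H ^ (ε / 50)) :=
    (harm_le_of_sq_le hD hX hDX).trans (by
      have := one_add_log_le_of_rpow_le hε0 hX hXH
      linarith)
  have hmain := abs_mean_sq_shortErr_sub_le hD hH0 hX0 hDX hL
  have hbr := sum_error_terms_le hε hX hH hz hz1 hz2 hD hDz hzD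
    (show 0 ≤ sawInt * zetaThreeHalves ^ 3 by positivity)
  refine hmain.trans ((mul_le_mul_of_nonneg_left hbr (by positivity)).trans (le_of_eq ?_))
  have e1 : (H ^ (ε / 50)) ^ 5 = H ^ (ε / 10) := by
    rw [← Real.rpow_natCast, ← Real.rpow_mul hH0.le]
    congr 1
    push_cast
    ring
  have e2 : H ^ (ε / 10) * H ^ ((1 : ℝ) / 2 - ε / 5) = H ^ ((1 : ℝ) / 2 - ε / 10) := by
    rw [← Real.rpow_add hH0]
    congr 1
    ring
  rw [← e2, ← e1]
  ring
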